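/- arXiv:2601.19797 — 3 statements merged into one kernel-verified Lean document; each statement's English description precedes it below -/
import Mathlib

section
/- Let ρ satisfy (H0)–(H4) and have compact support, let Ω ⊂ ℝ^n be open and bounded, and let C : ℝ^{n×n}_sym → ℝ^{n×n}_sym be a linear map which is positive definite, i.e. C[M] : M > 0 for every nonzero symmetric matrix M. Then there exists a constant c > 0 such that for every v ∈ C_c^∞(Ω; ℝ^n) (extended by zero to ℝ^n), ∫_{ℝ^n} C[(D_ρ v(x))_sym] : (D_ρ v(x))_sym dx ≥ c ( ‖v‖_{L²(Ω)}² + ‖D_ρ v‖_{L²(ℝ^n; ℝ^{n×n})}² ). (Coercivity of the bilinear form of nonlocal linear elasticity, the key estimate in the existence–uniqueness theorem for the Dirichlet problem.) -/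
open MeasureTheory Metric Set Matrix
open scoped ENNReal InnerProductSpace

noncomputable section

/-- Points of `ℝ^n` with the Euclidean norm. -/
abbrev Eu (n : ℕ) := EuclideanSpace ℝ (Fin n)

/-- Hypothesis (H0): `ρ` is a nonnegative radial kernel (with radial representation `ρb`),
locally integrable, with `∫ min{1,|x|⁻¹} ρ(x) dx < ∞`, and bounded below away from zero
on a closed ball of some radius `ε > 0`. -/
def IsKernelH0 (n : ℕ) (ρ : Eu n → ℝ) (ρb : ℝ → ℝ) (ε : ℝ) : Prop :=
  (∀ x, 0 ≤ ρ x) ∧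
  (∀ x : Eu n, x ≠ 0 → ρ x = ρb ‖x‖) ∧
  LocallyIntegrable ρ volume ∧
  Integrable (fun x : Eu n => min 1 ‖x‖⁻¹ * ρ x) volume ∧
  0 < ε ∧
  ∃ c > (0 : ℝ), ∀ x ∈ closedBall (0 : Eu n) ε, x ≠ 0 → c ≤ ρ x

/-- The auxiliary function `f_ρ(r) = r^(n-2) ρ̄(r)`. -/
def fRho (n : ℕ) (ρb : ℝ → ℝ) (r : ℝ) : ℝ := r ^ ((n : ℝ) - 2) * ρb r

/-- Hypothesis (H1): `f_ρ` and `r ↦ r^ν f_ρ(r)` are decreasing on `(0, ε)` for some `ν > 0`. -/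
def IsKernelH1 (n : ℕ) (ρb : ℝ → ℝ) (ε : ℝ) : Prop :=
  ∃ ν > (0 : ℝ), AntitoneOn (fRho n ρb) (Ioo 0 ε) ∧
    AntitoneOn (fun r => r ^ ν * fRho n ρb r) (Ioo 0 ε)

/-- Hypothesis (H2): `f_ρ` is smooth away from the origin and its derivatives satisfy
`|f_ρ^{(k)}(r)| ≤ C(k) r^(-k) f_ρ(r)` on `(0, ε)`. -/
def IsKernelH2 (n : ℕ) (ρb : ℝ → ℝ) (ε : ℝ) : Prop :=
  ContDiffOn ℝ (⊤ : ℕ∞) (fRho n ρb) (Ioi 0) ∧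
  ∀ k : ℕ, 0 < k → ∃ C > (0 : ℝ), ∀ r ∈ Ioo (0 : ℝ) ε,
    |iteratedDerivWithin k (fRho n ρb) (Ioi 0) r| ≤ C * r ^ (-(k : ℝ)) * fRho n ρb r

/-- Hypothesis (H3): `r ↦ r^(n+s-1) ρ̄(r)` is almost decreasing on `(0, ε)` for some `s ∈ (0,1)`. -/
def IsKernelH3 (n : ℕ) (ρb : ℝ → ℝ) (ε : ℝ) : Prop :=
  ∃ s ∈ Ioo (0 : ℝ) 1, ∃ C > (0 : ℝ), ∀ r₁ ∈ Ioo (0 : ℝ) ε, ∀ r₂ ∈ Ioo (0 : ℝ) ε, r₁ ≤ r₂ →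
    C * (r₂ ^ ((n : ℝ) + s - 1) * ρb r₂) ≤ r₁ ^ ((n : ℝ) + s - 1) * ρb r₁

/-- Hypothesis (H4): `r ↦ r^(n+t-1) ρ̄(r)` is almost increasing on `(0, ε)` for some `t ∈ (0,1)`. -/
def IsKernelH4 (n : ℕ) (ρb : ℝ → ℝ) (ε : ℝ) : Prop :=
  ∃ t ∈ Ioo (0 : ℝ) 1, ∃ C > (0 : ℝ), ∀ r₁ ∈ Ioo (0 : ℝ) ε, ∀ r₂ ∈ Ioo (0 : ℝ) ε, r₁ ≤ r₂ →
    C * (r₁ ^ ((n : ℝ) + t - 1) * ρb r₁) ≤ r₂ ^ ((n : ℝ) + t - 1) * ρb r₂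

variable {n : ℕ}

/-- Nonlocal gradient of a scalar field:
`D_ρ u(x) = ∫ ((u(x) - u(y))/|x-y|) ((x-y)/|x-y|) ρ(x-y) dy`. -/
def nlGradS (ρ : Eu n → ℝ) (u : Eu n → ℝ) (x : Eu n) : Eu n :=
  ∫ y, ((u x - u y) * ρ (x - y) / ‖x - y‖ ^ 2) • (x - y)

/-- The (i,j) entry of the integrand of the nonlocal gradient of a vector field. -/
def nlGradMInt (ρ : Eu n → ℝ) (u : Eu n → Eu n) (x : Eu n) (i j : Fin n) : Eu n → ℝ :=
  fun y => (u x - u y) i * (x - y) j * ρ (x - y) / ‖x - y‖ ^ 2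

/-- Nonlocal gradient of a vector field, as a matrix:
`D_ρ u(x) = ∫ ((u(x)-u(y))/|x-y|) ⊗ ((x-y)/|x-y|) ρ(x-y) dy`. -/
def nlGradM (ρ : Eu n → ℝ) (u : Eu n → Eu n) (x : Eu n) : Matrix (Fin n) (Fin n) ℝ :=
  Matrix.of fun i j => ∫ y, nlGradMInt ρ u x i j y

/-- The integrand of the nonlocal divergence of a vector field. -/
def nlDivVInt (ρ : Eu n → ℝ) (u : Eu n → Eu n) (x : Eu n) : Eu n → ℝ :=
  fun y => ⟪u x - u y, x - y⟫_ℝ * ρ (x - y) / ‖x - y‖ ^ 2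

/-- Nonlocal divergence of a vector field:
`div_ρ u(x) = ∫ ((u(x)-u(y))·(x-y)/|x-y|²) ρ(x-y) dy`. -/
def nlDivV (ρ : Eu n → ℝ) (u : Eu n → Eu n) (x : Eu n) : ℝ :=
  ∫ y, nlDivVInt ρ u x y

/-- The i-th component of the integrand of the nonlocal divergence of a matrix field. -/
def nlDivMInt (ρ : Eu n → ℝ) (Φ : Eu n → Matrix (Fin n) (Fin n) ℝ) (x : Eu n) (i : Fin n) :
    Eu n → ℝ :=
  fun y => (∑ j, (Φ x i j - Φ y i j) * (x - y) j) * ρ (x - y) / ‖x - y‖ ^ 2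

/-- Nonlocal divergence of a matrix field:
`div_ρ Φ(x) = ∫ ((Φ(x)-Φ(y))/|x-y|) ((x-y)/|x-y|) ρ(x-y) dy ∈ ℝ^n`. -/
def nlDivM (ρ : Eu n → ℝ) (Φ : Eu n → Matrix (Fin n) (Fin n) ℝ) (x : Eu n) : Eu n :=
  (WithLp.equiv 2 (Fin n → ℝ)).symm fun i => ∫ y, nlDivMInt ρ Φ x i y

/-- Frobenius inner product `A : B = Σ_{ij} a_{ij} b_{ij}` of matrices. -/
def frobInner (A B : Matrix (Fin n) (Fin n) ℝ) : ℝ := ∑ i, ∑ j, A i j * B i j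

/-- Symmetric part of a matrix, `M_sym = (M + Mᵀ)/2`. -/
def symPart (M : Matrix (Fin n) (Fin n) ℝ) : Matrix (Fin n) (Fin n) ℝ :=
  (1 / 2 : ℝ) • (M + Mᵀ)

/-- The potential `Q_ρ(x) = ∫_{|x|}^∞ ρ̄(t)/t dt`. -/
def Qker (n : ℕ) (ρb : ℝ → ℝ) (x : Eu n) : ℝ := ∫ t in Ioi ‖x‖, ρb t / t

/-- Classical Jacobian matrix of a vector field, `(Du)_{ij} = ∂u_i/∂x_j`. -/
def jacobianM (u : Eu n → Eu n) (x : Eu n) : Matrix (Fin n) (Fin n) ℝ :=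
  Matrix.of fun i j => fderiv ℝ (fun z => u z i) x (EuclideanSpace.single j 1)

/-- Rank-one matrix `a ⊗ b = (a_i b_j)`. -/
def tensorP (a b : Eu n) : Matrix (Fin n) (Fin n) ℝ := Matrix.of fun i j => a i * b j

/-- Isotropic elasticity tensor `C[M] = 2μ M_sym + λ (tr M) I`. -/
def isoC (μ lam : ℝ) (M : Matrix (Fin n) (Fin n) ℝ) : Matrix (Fin n) (Fin n) ℝ :=
  (2 * μ) • symPart M + (lam * Matrix.trace M) • (1 : Matrix (Fin n) (Fin n) ℝ)

/-- Fourier transform `𝓕 f(ξ) = ∫ f(x) e^{-2πi x·ξ} dx` of a complex-valued function on ℝ^n. -/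
def fInt (f : Eu n → ℂ) (ξ : Eu n) : ℂ :=
  ∫ x, f x * Complex.exp (-(2 * Real.pi * (⟪x, ξ⟫_ℝ : ℝ) * Complex.I))

/-- The nonlocal Laplacian `(-Δ)_ρ v = -div_ρ (D_ρ v)` of a vector field. -/
def nlLap (ρ : Eu n → ℝ) (v : Eu n → Eu n) (x : Eu n) : Eu n :=
  -nlDivM ρ (fun z => nlGradM ρ v z) x

/-- The i-th component of the integrand of `K_{ρ,φ}(Φ)` from the nonlocal Leibniz rule. -/
def KtermInt (ρ : Eu n → ℝ) (φ : Eu n → ℝ) (Φ : Eu n → Matrix (Fin n) (Fin n) ℝ)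
    (x : Eu n) (i : Fin n) : Eu n → ℝ :=
  fun y => (φ x - φ y) * (∑ j, Φ y i j * (x - y) j) * ρ (x - y) / ‖x - y‖ ^ 2

/-- `K_{ρ,φ}(Φ)(x) = ∫ ((φ(x)-φ(y))/|x-y|) Φ(y) ((x-y)/|x-y|) ρ(x-y) dy`. -/
def Kterm (ρ : Eu n → ℝ) (φ : Eu n → ℝ) (Φ : Eu n → Matrix (Fin n) (Fin n) ℝ)
    (x : Eu n) : Eu n :=
  (WithLp.equiv 2 (Fin n → ℝ)).symm fun i => ∫ y, KtermInt ρ φ Φ x i y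

/-- Classical divergence of a vector field. -/
def divCl (w : Eu n → Eu n) (x : Eu n) : ℝ :=
  ∑ i, fderiv ℝ (fun z => w z i) x (EuclideanSpace.single i 1)

open scoped FourierTransform in
/-- Plancherel's identity for continuous integrable functions with integrable Fourier transform. -/
theorem integral_norm_sq_fourier_of_continuous {f : Eu n → ℂ} (hc : Continuous f)
    (hf : Integrable f) (h'f : Integrable (𝓕 f)) :
    ∫ ξ, ‖𝓕 f ξ‖ ^ 2 = ∫ x, ‖f x‖ ^ 2 := by
  have key : ∫ ξ, innerSL ℂ (𝓕 f ξ) (𝓕 f ξ) = ∫ x, innerSL ℂ (f x) (𝓕⁻ (𝓕 f) x) := by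
    have := VectorFourier.integral_sesq_fourierIntegral_eq_neg_flip (innerSL ℂ (E := ℂ))
      (L := innerₗ (Eu n)) Real.continuous_fourierChar continuous_inner hf h'f
    rw [flip_innerₗ] at this
    exact this
  rw [hc.fourierInv_fourier_eq hf h'f] at key
  apply Complex.ofRealLI.injective
  simpa [← LinearIsometry.integral_comp_comm, inner_self_eq_norm_sq_to_K] using key

theorem frobInner_self_nonneg (M : Matrix (Fin n) (Fin n) ℝ) : 0 ≤ frobInner M M :=
  Finset.sum_nonneg fun _ _ => Finset.sum_nonneg fun _ _ => mul_self_nonneg _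

theorem frobInner_self_pos {M : Matrix (Fin n) (Fin n) ℝ} (hM : M ≠ 0) : 0 < frobInner M M := by
  refine lt_of_le_of_ne (frobInner_self_nonneg M) fun h => hM ?_
  have h1 := (Finset.sum_eq_zero_iff_of_nonneg fun i _ =>
    Finset.sum_nonneg fun j _ => mul_self_nonneg (M i j)).1 h.symm
  ext i j
  have h2 := (Finset.sum_eq_zero_iff_of_nonneg fun j _ => mul_self_nonneg (M i j)).1
    (h1 i (Finset.mem_univ i)) j (Finset.mem_univ j)
  simpa using h2

theorem frobInner_smul_smul (t : ℝ) (A B : Matrix (Fin n) (Fin n) ℝ) :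
    frobInner (t • A) (t • B) = t ^ 2 * frobInner A B := by
  simp only [frobInner, Finset.mul_sum, Matrix.smul_apply, smul_eq_mul]
  exact Finset.sum_congr rfl fun i _ => Finset.sum_congr rfl fun j _ => by ring

theorem continuous_frobInner {X : Type*} [TopologicalSpace X]
    {A B : X → Matrix (Fin n) (Fin n) ℝ} (hA : Continuous A) (hB : Continuous B) :
    Continuous fun x => frobInner (A x) (B x) := by
  unfold frobInner
  exact continuous_finsetSum _ fun i _ => continuous_finsetSum _ fun j _ =>
    (hA.matrix_elem i j).mul (hB.matrix_elem i j)

theorem abs_le_one_of_frobInner_eq_one {M : Matrix (Fin n) (Fin n) ℝ} (h : frobInner M M = 1)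
    (i j : Fin n) : |M i j| ≤ 1 := by
  have h1 : M i j * M i j ≤ frobInner M M :=
    (Finset.single_le_sum (f := fun j => M i j * M i j) (fun j _ => mul_self_nonneg (M i j))
      (Finset.mem_univ j)).trans
    (Finset.single_le_sum (f := fun i => ∑ j, M i j * M i j)
      (fun i _ => Finset.sum_nonneg fun j _ => mul_self_nonneg (M i j)) (Finset.mem_univ i))
  rw [h] at h1
  exact abs_le_one_iff_mul_self_le_one.2 h1

/-- A linear map that is positive definite on symmetric matrices is coercive there. -/
theorem exists_coercive (C : Matrix (Fin n) (Fin n) ℝ →ₗ[ℝ] Matrix (Fin n) (Fin n) ℝ)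
    (hCpos : ∀ M : Matrix (Fin n) (Fin n) ℝ, M.IsSymm → M ≠ 0 → 0 < frobInner (C M) M) :
    ∃ c > (0 : ℝ), ∀ M : Matrix (Fin n) (Fin n) ℝ, M.IsSymm →
      c * frobInner M M ≤ frobInner (C M) M := by
  have hC : Continuous C := LinearMap.continuous_of_finiteDimensional C
  set S : Set (Matrix (Fin n) (Fin n) ℝ) := {M | M.IsSymm ∧ frobInner M M = 1} with hS
  have hSc : IsCompact S := by
    have hK : IsCompact (Set.pi univ fun _ : Fin n => Set.pi univ fun _ : Fin n =>
        Icc (-1 : ℝ) 1) :=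
      isCompact_univ_pi fun _ => isCompact_univ_pi fun _ => isCompact_Icc
    refine IsCompact.of_isClosed_subset hK ?_ ?_
    · refine IsClosed.inter (isClosed_eq (f := fun M : Matrix (Fin n) (Fin n) ℝ => Mᵀ)
        (g := fun M => M) ?_ continuous_id) (isClosed_eq ?_ continuous_const)
      · exact continuous_id.matrix_transpose
      · exact continuous_frobInner continuous_id continuous_id
    · intro M hM i _ j _
      exact abs_le.1 (abs_le_one_of_frobInner_eq_one hM.2 i j)
  have hne : ∀ M ∈ S, M ≠ 0 := by
    rintro M hM rfl
    simpa [frobInner] using hM.2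
  obtain ⟨c, hc, hcS⟩ : ∃ c > (0 : ℝ), ∀ M ∈ S, c ≤ frobInner (C M) M := by
    rcases S.eq_empty_or_nonempty with h | h
    · exact ⟨1, one_pos, by simp [h]⟩
    · obtain ⟨M, hM, hmin⟩ := hSc.exists_isMinOn h
        (continuous_frobInner hC continuous_id).continuousOn
      exact ⟨_, hCpos M hM.1 (hne M hM), fun N hN => hmin hN⟩
  refine ⟨c, hc, fun M hM => ?_⟩
  by_cases h0 : M = 0
  · simp [h0, frobInner]
  have hp := frobInner_self_pos h0
  set t : ℝ := (√(frobInner M M))⁻¹ with ht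
  have ht2 : t ^ 2 = (frobInner M M)⁻¹ := by rw [ht, inv_pow, Real.sq_sqrt hp.le]
  have hmem : t • M ∈ S := by
    refine ⟨hM.smul t, ?_⟩
    rw [frobInner_smul_smul, ht2, inv_mul_cancel₀ hp.ne']
  have := hcS _ hmem
  rw [map_smul, frobInner_smul_smul, ht2] at this
  have h3 := mul_le_mul_of_nonneg_right this hp.le
  rwa [mul_right_comm, inv_mul_cancel₀ hp.ne', one_mul] at h3

theorem deriv_le_of_antitoneOn_rpow_mul {f : ℝ → ℝ} {ε ν r : ℝ} (hf : DifferentiableAt ℝ f r)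
    (h : AntitoneOn (fun r => r ^ ν * f r) (Ioo 0 ε)) (hr : r ∈ Ioo 0 ε) :
    deriv f r + ν * (f r / r) ≤ 0 := by
  have hd : HasDerivAt (fun r => r ^ ν * f r) (ν * r ^ (ν - 1) * f r + r ^ ν * deriv f r) r :=
    (Real.hasDerivAt_rpow_const (Or.inl hr.1.ne')).mul hf.hasDerivAt
  have h1 := h.derivWithin_nonpos (x := r)
  rw [derivWithin_of_isOpen isOpen_Ioo hr, hd.deriv, Real.rpow_sub_one hr.1.ne'] at h1
  have hp := Real.rpow_pos_of_pos hr.1 ν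
  have h2 : r ^ ν * (deriv f r + ν * (f r / r)) ≤ 0 := by
    have : r ^ ν * (deriv f r + ν * (f r / r)) =
      ν * (r ^ ν / r) * f r + r ^ ν * deriv f r := by ring
    rw [this]; exact h1
  exact nonpos_of_mul_nonpos_right h2 hp

theorem one_sub_cos_le (x : ℝ) : 1 - Real.cos x ≤ x ^ 2 / 2 := by
  linarith [Real.one_sub_sq_div_two_le_cos (x := x)]

theorem integrableOn_sin_mul {f : ℝ → ℝ} {b : ℝ} (hf : ContinuousOn f (Ioi 0))
    (hint : IntegrableOn (fun r => r * f r) (Ioo 0 b)) (a : ℝ) :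
    IntegrableOn (fun r => Real.sin (a * r) * f r) (Ioo 0 b) := by
  have hsub : Ioo 0 b ⊆ Ioi 0 := fun r hr => hr.1
  refine Integrable.mono' ((hint.norm).const_mul |a|) ?_ ?_
  · exact ((by fun_prop : Continuous fun r => Real.sin (a * r)).continuousOn.mul
      (hf.mono hsub)).aestronglyMeasurable measurableSet_Ioo
  · refine (ae_restrict_iff' measurableSet_Ioo).2 (Filter.Eventually.of_forall fun r hr => ?_)
    rw [norm_mul, norm_mul, ← mul_assoc, Real.norm_eq_abs (Real.sin _), Real.norm_eq_abs r,
      ← abs_mul]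
    exact mul_le_mul_of_nonneg_right Real.abs_sin_le_abs (norm_nonneg _)

theorem integrableOn_one_sub_cos_mul_div {f : ℝ → ℝ} {b : ℝ} (hf : ContinuousOn f (Ioi 0))
    (hint : IntegrableOn (fun r => r * f r) (Ioo 0 b)) (a : ℝ) :
    IntegrableOn (fun r => (1 - Real.cos (a * r)) * (f r / r)) (Ioo 0 b) := by
  have hsub : Ioo 0 b ⊆ Ioi 0 := fun r hr => hr.1
  refine Integrable.mono' ((hint.norm).const_mul (a ^ 2 / 2)) ?_ ?_
  · exact ((by fun_prop : Continuous fun r => 1 - Real.cos (a * r)).continuousOn.mul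
      ((hf.mono hsub).div continuousOn_id fun r hr => hr.1.ne')).aestronglyMeasurable
        measurableSet_Ioo
  · refine (ae_restrict_iff' measurableSet_Ioo).2 (Filter.Eventually.of_forall fun r hr => ?_)
    have hr0 : 0 < r := hr.1
    rw [norm_mul, norm_mul, norm_div, Real.norm_eq_abs (1 - _),
      abs_of_nonneg (by linarith [Real.cos_le_one (a * r)]), Real.norm_of_nonneg hr0.le]
    have h1 : a ^ 2 / 2 * (r * ‖f r‖) = ((a * r) ^ 2 / 2) * (‖f r‖ / r) := by
      field_simp
    rw [h1]
    exact mul_le_mul_of_nonneg_right (one_sub_cos_le _) (by positivity)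

/-- Quantitative positivity of the sine transform of a decreasing function. -/
theorem integral_sin_mul_ge {f : ℝ → ℝ} {b ε ν a : ℝ} (hb : 0 < b) (hbε : b < ε) (ha : 0 < a)
    (hf : ContDiffOn ℝ 1 f (Ioi 0)) (hanti : AntitoneOn f (Ioo 0 ε))
    (hν : AntitoneOn (fun r => r ^ ν * f r) (Ioo 0 ε)) (hpos : ∀ r ∈ Ioo 0 ε, 0 ≤ f r)
    (hint : IntegrableOn (fun r => r * f r) (Ioo 0 b)) :
    ν / a * ∫ r in Ioo 0 b, (1 - Real.cos (a * r)) * (f r / r) ≤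
      ∫ r in Ioo 0 b, Real.sin (a * r) * f r := by
  have hfd : ∀ r, 0 < r → DifferentiableAt ℝ f r := fun r hr =>
    ((hf.differentiableOn one_ne_zero) r hr).differentiableAt (Ioi_mem_nhds hr)
  have hfd' : ContinuousOn (deriv f) (Ioi 0) := hf.continuousOn_deriv_of_isOpen isOpen_Ioi le_rfl
  have hI1 := integrableOn_sin_mul hf.continuousOn hint a
  have hI2 := (integrableOn_one_sub_cos_mul_div hf.continuousOn hint a).const_mul (ν / a)
  set h : ℝ → ℝ := fun r =>
    Real.sin (a * r) * f r - ν / a * ((1 - Real.cos (a * r)) * (f r / r)) with hh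
  have hhI : IntegrableOn h (Ioo 0 b) := hI1.sub hI2
  have hhi : IntervalIntegrable h volume 0 b :=
    (intervalIntegrable_iff_integrableOn_Ioo_of_le hb.le).2 hhI
  have hgi : IntervalIntegrable (fun r => r * f r) volume 0 b :=
    (intervalIntegrable_iff_integrableOn_Ioo_of_le hb.le).2 hint
  have hsubset : ∀ η ∈ Ioo 0 b, uIcc 0 η ⊆ uIcc 0 b ∧ uIcc η b ⊆ uIcc 0 b := by
    intro η hη
    rw [uIcc_of_le hη.1.le, uIcc_of_le hη.2.le, uIcc_of_le hb.le]
    exact ⟨Icc_subset_Icc_right hη.2.le, Icc_subset_Icc_left hη.1.le⟩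
  have hlow : ∀ η ∈ Ioo 0 b, (∫ r in (0 : ℝ)..η, h r) - a * (∫ r in (0 : ℝ)..η, r * f r) ≤
      ∫ r in (0 : ℝ)..b, h r := by
    intro η hη
    have hη0 : 0 < η := hη.1
    have hηε : η ∈ Ioo 0 ε := ⟨hη.1, hη.2.trans hbε⟩
    have hs := hsubset η hη
    have hh1 := hhi.mono_set hs.1
    have hh2 := hhi.mono_set hs.2
    rw [← intervalIntegral.integral_add_adjacent_intervals hh1 hh2]
    have hpos' : Icc η b ⊆ Ioi 0 := fun r hr => hη0.trans_le hr.1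
    set P : ℝ → ℝ := fun r => (1 - Real.cos (a * r)) / a * f r with hP
    set P' : ℝ → ℝ := fun r =>
      Real.sin (a * r) * f r + (1 - Real.cos (a * r)) / a * deriv f r with hP'
    have hPd : ∀ r ∈ uIcc η b, HasDerivAt P (P' r) r := by
      intro r hr
      rw [uIcc_of_le hη.2.le] at hr
      have hc : HasDerivAt (fun r => (1 - Real.cos (a * r)) / a) (Real.sin (a * r)) r := by
        have := (((hasDerivAt_id r).const_mul a).cos.const_sub 1).div_const a
        simp only [id, mul_one, neg_mul, neg_neg] at this
        rwa [mul_div_cancel_right₀ _ ha.ne'] at this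
      exact hc.mul (hfd r (hpos' hr)).hasDerivAt
    have hP'i : IntervalIntegrable P' volume η b := by
      apply ContinuousOn.intervalIntegrable
      rw [uIcc_of_le hη.2.le]
      refine ContinuousOn.add (ContinuousOn.mul (by fun_prop) (hf.continuousOn.mono hpos'))
        (ContinuousOn.mul (by fun_prop) (hfd'.mono hpos'))
    have hFTC := intervalIntegral.integral_eq_sub_of_hasDerivAt hPd hP'i
    have hmono : ∫ r in η..b, P' r ≤ ∫ r in η..b, h r := by
      refine intervalIntegral.integral_mono_on hη.2.le hP'i hh2 fun r hr => ?_
      have hrε : r ∈ Ioo 0 ε := ⟨hpos' hr, hr.2.trans_lt hbε⟩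
      have hd := deriv_le_of_antitoneOn_rpow_mul (hfd r hrε.1) hν hrε
      have hc : 0 ≤ (1 - Real.cos (a * r)) / a :=
        div_nonneg (by linarith [Real.cos_le_one (a * r)]) ha.le
      have := mul_nonpos_of_nonneg_of_nonpos hc hd
      have e : P' r - h r = (1 - Real.cos (a * r)) / a * (deriv f r + ν * (f r / r)) := by
        simp only [hP', hh]; ring
      linarith
    have hPb : 0 ≤ P b := mul_nonneg
      (div_nonneg (by linarith [Real.cos_le_one (a * b)]) ha.le) (hpos b ⟨hb, hbε⟩)
    have hPη : P η ≤ a * (η ^ 2 / 2 * f η) := by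
      have h1 : (1 - Real.cos (a * η)) / a ≤ a * (η ^ 2 / 2) := by
        rw [div_le_iff₀ ha]
        calc _ ≤ (a * η) ^ 2 / 2 := one_sub_cos_le _
          _ = _ := by ring
      calc P η ≤ a * (η ^ 2 / 2) * f η := mul_le_mul_of_nonneg_right h1 (hpos η hηε)
        _ = _ := by ring
    have hΨ : η ^ 2 / 2 * f η ≤ ∫ r in (0 : ℝ)..η, r * f r := by
      have : ∫ r in (0 : ℝ)..η, r * f η = η ^ 2 / 2 * f η := by
        rw [intervalIntegral.integral_mul_const, integral_id]; ring
      rw [← this]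
      refine intervalIntegral.integral_mono_on_of_le_Ioo hη0.le
        (Continuous.intervalIntegrable (by fun_prop) _ _) (hgi.mono_set hs.1) fun r hr => ?_
      exact mul_le_mul_of_nonneg_left (hanti ⟨hr.1, hr.2.trans hηε.2⟩ hηε hr.2.le) hr.1.le
    have := mul_le_mul_of_nonneg_left hΨ ha.le
    linarith
  have hlim : Filter.Tendsto (fun η => (∫ r in (0 : ℝ)..η, h r) - a * (∫ r in (0 : ℝ)..η, r * f r))
      (nhdsWithin 0 (Ioo 0 b)) (nhds 0) := by
    have hsub : Ioo 0 b ⊆ uIcc 0 b := by rw [uIcc_of_le hb.le]; exact Ioo_subset_Icc_self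
    have h0 : (0 : ℝ) ∈ uIcc 0 b := left_mem_uIcc
    have t1 := ((intervalIntegral.continuousOn_primitive_interval
      ((intervalIntegrable_iff' enorm_ne_top).1 hhi)) 0 h0).mono_left (nhdsWithin_mono 0 hsub)
    have t2 := ((intervalIntegral.continuousOn_primitive_interval
      ((intervalIntegrable_iff' enorm_ne_top).1 hgi)) 0 h0).mono_left (nhdsWithin_mono 0 hsub)
    simpa using t1.sub (t2.const_mul a)
  have : (nhdsWithin (0 : ℝ) (Ioo 0 b)).NeBot := by
    rw [nhdsWithin_Ioo_eq_nhdsGT hb]; infer_instance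
  have hfin : 0 ≤ ∫ r in (0 : ℝ)..b, h r :=
    le_of_tendsto hlim (Filter.eventually_of_mem self_mem_nhdsWithin hlow)
  rw [intervalIntegral.integral_of_le hb.le, integral_Ioc_eq_integral_Ioo,
    integral_sub hI1 hI2, integral_const_mul] at hfin
  linarith

theorem integral_sin_mul_nonneg {f : ℝ → ℝ} {b ε ν a : ℝ} (hb : 0 < b) (hbε : b < ε) (ha : 0 < a)
    (hν0 : 0 < ν) (hf : ContDiffOn ℝ 1 f (Ioi 0)) (hanti : AntitoneOn f (Ioo 0 ε))
    (hν : AntitoneOn (fun r => r ^ ν * f r) (Ioo 0 ε)) (hpos : ∀ r ∈ Ioo 0 ε, 0 ≤ f r)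
    (hint : IntegrableOn (fun r => r * f r) (Ioo 0 b)) :
    0 ≤ ∫ r in Ioo 0 b, Real.sin (a * r) * f r := by
  refine le_trans (mul_nonneg (by positivity) (setIntegral_nonneg measurableSet_Ioo fun r hr => ?_))
    (integral_sin_mul_ge hb hbε ha hf hanti hν hpos hint)
  exact mul_nonneg (by linarith [Real.cos_le_one (a * r)])
    (div_nonneg (hpos r ⟨hr.1, hr.2.trans hbε⟩) hr.1.le)

theorem integral_sin_mul_ge_const {f : ℝ → ℝ} {b ε ν a c : ℝ} (hb : 0 < b) (hbε : b < ε)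
    (ha : 0 < a) (hab : Real.pi < a * b)
    (hν0 : 0 < ν) (hf : ContDiffOn ℝ 1 f (Ioi 0)) (hanti : AntitoneOn f (Ioo 0 ε))
    (hν : AntitoneOn (fun r => r ^ ν * f r) (Ioo 0 ε)) (hc : 0 < c)
    (hpos : ∀ r ∈ Ioo 0 ε, c ≤ r * f r)
    (hint : IntegrableOn (fun r => r * f r) (Ioo 0 b)) :
    ν * c / (2 * Real.pi) ≤ ∫ r in Ioo 0 b, Real.sin (a * r) * f r := by
  have hπ := Real.pi_pos
  have hf0 : ∀ r ∈ Ioo 0 ε, 0 ≤ f r := fun r hr =>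
    (pos_of_mul_pos_right (hc.trans_le (hpos r hr)) hr.1.le).le
  refine le_trans ?_ (integral_sin_mul_ge hb hbε ha hf hanti hν hf0 hint)
  have hsub : Ioo (Real.pi / (2 * a)) (Real.pi / a) ⊆ Ioo 0 b := by
    intro r hr
    refine ⟨lt_trans (by positivity) hr.1, hr.2.trans ?_⟩
    rwa [div_lt_iff₀ ha, mul_comm]
  have hI := integrableOn_one_sub_cos_mul_div hf.continuousOn hint a
  have hnn : ∀ r ∈ Ioo 0 b, 0 ≤ (1 - Real.cos (a * r)) * (f r / r) := fun r hr =>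
    mul_nonneg (by linarith [Real.cos_le_one (a * r)])
      (div_nonneg (hf0 r ⟨hr.1, hr.2.trans hbε⟩) hr.1.le)
  have h1 : ∫ r in Ioo (Real.pi / (2 * a)) (Real.pi / a), c * (a / Real.pi) ^ 2 ≤
      ∫ r in Ioo 0 b, (1 - Real.cos (a * r)) * (f r / r) := by
    refine le_trans ?_ (setIntegral_mono_set hI
      ((ae_restrict_iff' measurableSet_Ioo).2 (Filter.Eventually.of_forall hnn))
      hsub.eventuallyLE)
    refine setIntegral_mono_on (integrableOn_const (by simp)) (hI.mono_set hsub)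
      measurableSet_Ioo fun r hr => ?_
    have hr' := hsub hr
    have hr0 : 0 < r := hr'.1
    have hcos : Real.cos (a * r) ≤ 0 := by
      have e1 := (div_lt_iff₀ (by positivity)).1 hr.1
      have e2 := (lt_div_iff₀ ha).1 hr.2
      exact Real.cos_nonpos_of_pi_div_two_le_of_le (by linarith) (by linarith)
    have hfr := hpos r ⟨hr0, hr'.2.trans hbε⟩
    have h2 : c * (a / Real.pi) ^ 2 ≤ f r / r := by
      have e : f r / r = r * f r * (1 / r) ^ 2 := by field_simp
      rw [e]
      have : a / Real.pi ≤ 1 / r := by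
        rw [div_le_div_iff₀ hπ hr0]
        have e2 := (lt_div_iff₀ ha).1 hr.2
        linarith
      exact mul_le_mul hfr (pow_le_pow_left₀ (by positivity) this 2) (by positivity)
        (hc.le.trans hfr)
    have h3 : 0 ≤ f r / r := le_trans (by positivity) h2
    nlinarith
  have h4 := mul_le_mul_of_nonneg_left h1 (by positivity : 0 ≤ ν / a)
  refine le_trans (le_of_eq ?_) h4
  rw [setIntegral_const, Real.volume_real_Ioo_of_le, smul_eq_mul]
  · field_simp
    ring
  · gcongr; linarith

/-- The radial profile of the symbol of the nonlocal gradient, computed along a direction `e`. -/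
def radialSymbol (ρ : Eu n → ℝ) (e : Eu n) (t : ℝ) : ℝ :=
  ∫ z, Real.sin (2 * Real.pi * t * ⟪z, e⟫_ℝ) * (⟪z, e⟫_ℝ * ρ z / ‖z‖ ^ 2)

theorem LocallyIntegrable.integrable_of_compactSupport {ρ : Eu n → ℝ}
    (h : LocallyIntegrable ρ volume) (hs : HasCompactSupport ρ) : Integrable ρ :=
  (integrableOn_iff_integrable_of_support_subset (subset_tsupport ρ)).1
    (h.integrableOn_isCompact hs)

theorem abs_inner_mul_div_le {ρ : Eu n → ℝ} (hρ0 : ∀ x, 0 ≤ ρ x) {e : Eu n} (he : ‖e‖ = 1)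
    (z : Eu n) : |⟪z, e⟫_ℝ * ρ z / ‖z‖ ^ 2| ≤ ρ z / ‖z‖ := by
  rcases eq_or_ne z 0 with rfl | hz
  · simp
  have hz' : 0 < ‖z‖ := norm_pos_iff.2 hz
  rw [abs_div, abs_mul, abs_of_nonneg (hρ0 z), abs_of_nonneg (by positivity : 0 ≤ ‖z‖ ^ 2),
    div_le_div_iff₀ (by positivity) hz']
  have := abs_real_inner_le_norm z e
  rw [he, mul_one] at this
  calc |⟪z, e⟫_ℝ| * ρ z * ‖z‖ ≤ ‖z‖ * ρ z * ‖z‖ := by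
        gcongr; exact hρ0 z
    _ = _ := by ring

theorem aestronglyMeasurable_inner_mul_div {ρ : Eu n → ℝ} (hρ : Integrable ρ) (e : Eu n) :
    AEStronglyMeasurable (fun z => ⟪z, e⟫_ℝ * ρ z / ‖z‖ ^ 2) volume := by
  have h1 : AEStronglyMeasurable (fun z : Eu n => ⟪z, e⟫_ℝ) volume :=
    (by fun_prop : Continuous fun z : Eu n => ⟪z, e⟫_ℝ).aestronglyMeasurable
  have h2 : AEMeasurable (fun z : Eu n => ‖z‖ ^ 2) volume := by fun_prop
  exact ((h1.mul hρ.1).aemeasurable.div h2).aestronglyMeasurable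

theorem integrable_sin_mul_inner_mul_div {ρ : Eu n → ℝ} (hρ0 : ∀ x, 0 ≤ ρ x) (hρ : Integrable ρ)
    {e : Eu n} (he : ‖e‖ = 1) (t : ℝ) :
    Integrable fun z => Real.sin (2 * Real.pi * t * ⟪z, e⟫_ℝ) * (⟪z, e⟫_ℝ * ρ z / ‖z‖ ^ 2) := by
  refine Integrable.mono' (hρ.const_mul (2 * Real.pi * |t|)) ?_ (Filter.Eventually.of_forall ?_)
  · exact (by fun_prop : Continuous fun z : Eu n =>
      Real.sin (2 * Real.pi * t * ⟪z, e⟫_ℝ)).aestronglyMeasurable.mul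
      (aestronglyMeasurable_inner_mul_div hρ e)
  · intro z
    rw [norm_mul, Real.norm_eq_abs, Real.norm_eq_abs]
    have h1 : |Real.sin (2 * Real.pi * t * ⟪z, e⟫_ℝ)| ≤ 2 * Real.pi * |t| * ‖z‖ := by
      refine Real.abs_sin_le_abs.trans ?_
      rw [abs_mul, abs_mul, abs_of_pos Real.two_pi_pos]
      have := abs_real_inner_le_norm z e
      rw [he, mul_one] at this
      gcongr
    refine (mul_le_mul h1 (abs_inner_mul_div_le hρ0 he z) (abs_nonneg _)
      (by have := Real.pi_pos; positivity)).trans ?_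
    rcases eq_or_ne z 0 with rfl | hz
    · simp only [norm_zero, mul_zero, zero_mul]
      exact mul_nonneg (by have := Real.pi_pos; positivity) (hρ0 0)
    · rw [mul_assoc, mul_div_cancel₀ _ (norm_ne_zero_iff.2 hz)]

theorem integral_polar (hn : 0 < n) {H : Eu n → ℝ} (hH : Integrable H) :
    Integrable (fun θ : sphere (0 : Eu n) 1 => ∫ r in Ioi (0 : ℝ), r ^ (n - 1) * H (r • θ.1))
      (volume : Measure (Eu n)).toSphere ∧
    ∫ x, H x = ∫ θ : sphere (0 : Eu n) 1, (∫ r in Ioi (0 : ℝ), r ^ (n - 1) * H (r • θ.1))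
      ∂(volume : Measure (Eu n)).toSphere := by
  have : Nonempty (Fin n) := ⟨⟨0, hn⟩⟩
  set μ : Measure (Eu n) := volume with hμ
  have hmp := μ.measurePreserving_homeomorphUnitSphereProd
  have hemb := (homeomorphUnitSphereProd (Eu n)).measurableEmbedding
  rw [finrank_euclideanSpace_fin] at hmp
  set K : sphere (0 : Eu n) 1 × Ioi (0 : ℝ) → ℝ := fun p => H (p.2.1 • p.1.1) with hK
  have hKc : ∀ x : ({0}ᶜ : Set (Eu n)), K (homeomorphUnitSphereProd (Eu n) x) = H x.1 := by
    intro x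
    have hx : ‖x.1‖ ≠ 0 := norm_ne_zero_iff.2 x.2
    simp [hK, homeomorphUnitSphereProd, smul_smul, mul_inv_cancel₀ hx]
  have hcomp : K ∘ homeomorphUnitSphereProd (Eu n) = H ∘ Subtype.val := funext hKc
  have hHI : Integrable (H ∘ Subtype.val) (μ.comap (Subtype.val : ({0}ᶜ : Set (Eu n)) → Eu n)) := by
    rw [← (MeasurableEmbedding.subtype_coe (measurableSet_singleton _).compl).integrable_map_iff,
      map_comap_subtype_coe (measurableSet_singleton _).compl]
    exact hH.restrict
  have hKI : Integrable K (μ.toSphere.prod (.volumeIoiPow (n - 1))) := by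
    rw [← hmp.integrable_comp_emb hemb, hcomp]
    exact hHI
  have hin : ∀ θ : sphere (0 : Eu n) 1, ∫ r, K (θ, r) ∂(Measure.volumeIoiPow (n - 1)) =
      ∫ r in Ioi (0 : ℝ), r ^ (n - 1) * H (r • θ.1) := by
    intro θ
    simp only [Measure.volumeIoiPow, ENNReal.ofReal]
    rw [integral_withDensity_eq_integral_smul
      ((measurable_subtype_coe.pow_const _).real_toNNReal),
      integral_subtype_comap measurableSet_Ioi
        fun a : ℝ => Real.toNNReal (a ^ (n - 1)) • H (a • θ.1)]
    refine setIntegral_congr_fun measurableSet_Ioi fun x hx => ?_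
    simp only [NNReal.smul_def, Real.coe_toNNReal _ (pow_nonneg (mem_Ioi.1 hx).le _), smul_eq_mul]
  have hI := hKI.integral_prod_left
  have hE := integral_prod _ hKI
  simp only [hin] at hI hE
  refine ⟨hI, ?_⟩
  rw [← hE, ← hmp.integral_comp hemb]
  simp only [hKc]
  rw [integral_subtype_comap (measurableSet_singleton _).compl H, restrict_compl_singleton]

theorem tendsto_integral_sin_inner_mul {k : Eu n → ℝ} (hk : Integrable k) {e : Eu n}
    (he : ‖e‖ = 1) :
    Filter.Tendsto (fun t : ℝ => ∫ z, Real.sin (2 * Real.pi * t * ⟪z, e⟫_ℝ) * k z)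
      Filter.atTop (nhds 0) := by
  have h1 := tendsto_integral_exp_inner_smul_cocompact (V := Eu n) (fun z => (k z : ℂ))
  have h2 : Filter.Tendsto (fun t : ℝ => t • e) Filter.atTop (Filter.cocompact (Eu n)) := by
    rw [← Metric.cobounded_eq_cocompact, ← tendsto_norm_atTop_iff_cobounded]
    simp only [norm_smul, he, mul_one]
    exact tendsto_norm_atTop_atTop
  have h3 := (Complex.continuous_im.tendsto 0).comp (h1.comp h2)
  have h4 := h3.neg
  simp only [Complex.zero_im, neg_zero] at h4
  refine h4.congr fun t => ?_
  have hI : Integrable (fun v => Real.fourierChar (-⟪v, t • e⟫_ℝ) • (k v : ℂ)) :=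
    (Real.fourierIntegral_convergent_iff _).2 hk.ofReal
  have : (∫ v, Real.fourierChar (-⟪v, t • e⟫_ℝ) • (k v : ℂ)).im =
      ∫ v, (Real.fourierChar (-⟪v, t • e⟫_ℝ) • (k v : ℂ)).im :=
    (Complex.imCLM.integral_comp_comm hI).symm
  simp only [Function.comp_def]
  rw [this, ← integral_neg]
  refine integral_congr_ae (Filter.Eventually.of_forall fun z => ?_)
  simp only [Circle.smul_def, Real.fourierChar_apply, smul_eq_mul, inner_smul_right]
  rw [Complex.im_mul_ofReal, Complex.exp_ofReal_mul_I_im, ← neg_mul, ← Real.sin_neg]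
  congr 2
  ring

theorem pow_pred_eq (hn : 0 < n) {r : ℝ} (hr : 0 < r) :
    r ^ (n - 1) = r * r ^ ((n : ℝ) - 2) := by
  rw [← Real.rpow_natCast, Nat.cast_pred hn, show (n : ℝ) - 1 = 1 + (n - 2) by ring,
    Real.rpow_add hr, Real.rpow_one]

theorem radial_integrableOn (hn : 0 < n) {ρ : Eu n → ℝ} {ρb : ℝ → ℝ} (hρ : Integrable ρ)
    (hrad : ∀ x : Eu n, x ≠ 0 → ρ x = ρb ‖x‖) (b : ℝ) :
    IntegrableOn (fun r => r * fRho n ρb r) (Ioo 0 b) := by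
  have : Nonempty (Fin n) := ⟨⟨0, hn⟩⟩
  have h1 : Integrable (fun x : Eu n => ρb ‖x‖) := by
    refine hρ.congr ?_
    have : ({0}ᶜ : Set (Eu n)) ∈ ae volume := compl_mem_ae_iff.2 (measure_singleton 0)
    filter_upwards [this] with x hx using hrad x hx
  rw [integrable_fun_norm_addHaar, finrank_euclideanSpace_fin] at h1
  refine (h1.mono_set (fun r hr => hr.1 : Ioo 0 b ⊆ Ioi 0)).congr_fun (fun r hr => ?_)
    measurableSet_Ioo
  have hr0 : 0 < r := hr.1
  simp only [fRho, smul_eq_mul]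
  rw [pow_pred_eq hn hr0, mul_assoc]

theorem exists_le_mul_fRho (hn : 0 < n) {ρ : Eu n → ℝ} {ρb : ℝ → ℝ} {ε : ℝ}
    (h0 : IsKernelH0 n ρ ρb ε) (h3 : IsKernelH3 n ρb ε) :
    ∃ c > (0 : ℝ), ∀ r ∈ Ioo 0 (ε / 2), c ≤ r * fRho n ρb r := by
  obtain ⟨-, hrad, -, -, hε, c, hc, hcρ⟩ := h0
  obtain ⟨s, hs, C, hC, hdec⟩ := h3
  have hε2 : 0 < ε / 2 := by positivity
  have hb : 0 < ρb (ε / 2) := by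
    set x : Eu n := EuclideanSpace.single ⟨0, hn⟩ (ε / 2) with hx
    have hxn : ‖x‖ = ε / 2 := by simp [hx, abs_of_pos hε]
    have hx0 : x ≠ 0 := norm_pos_iff.1 (hxn ▸ hε2)
    have := hcρ x (by rw [mem_closedBall_zero_iff, hxn]; linarith) hx0
    rw [hrad x hx0, hxn] at this
    exact hc.trans_le this
  set K : ℝ := C * ((ε / 2) ^ ((n : ℝ) + s - 1) * ρb (ε / 2)) with hK
  have hKpos : 0 < K := by
    have := Real.rpow_pos_of_pos hε2 ((n : ℝ) + s - 1)
    positivity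
  refine ⟨K / (ε / 2) ^ s, div_pos hKpos (Real.rpow_pos_of_pos hε2 s), fun r hr => ?_⟩
  have hr0 : 0 < r := hr.1
  have h := hdec r ⟨hr0, hr.2.trans (by linarith)⟩ (ε / 2) ⟨hε2, by linarith⟩ hr.2.le
  have e : r ^ ((n : ℝ) + s - 1) * ρb r = r ^ s * (r * fRho n ρb r) := by
    rw [fRho, show (n : ℝ) + s - 1 = s + (1 + (n - 2)) by ring, Real.rpow_add hr0,
      Real.rpow_add hr0, Real.rpow_one]
    ring
  rw [e] at h
  have hrs := Real.rpow_pos_of_pos hr0 s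
  have hpos : 0 ≤ r * fRho n ρb r := (pos_of_mul_pos_right (hKpos.trans_le h) hrs.le).le
  rw [div_le_iff₀ (Real.rpow_pos_of_pos hε2 s), mul_comm]
  exact h.trans (mul_le_mul_of_nonneg_right
    (Real.rpow_le_rpow hr0.le hr.2.le hs.1.le) hpos)

theorem integral_radial_slice (hn : 0 < n) {ρ : Eu n → ℝ} {ρb : ℝ → ℝ}
    (hrad : ∀ x : Eu n, x ≠ 0 → ρ x = ρb ‖x‖) (e : Eu n) (t b : ℝ) (θ : sphere (0 : Eu n) 1) :
    ∫ r in Ioi (0 : ℝ), r ^ (n - 1) * (ball (0 : Eu n) b).indicator (fun z =>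
      Real.sin (2 * Real.pi * t * ⟪z, e⟫_ℝ) * (⟪z, e⟫_ℝ * ρ z / ‖z‖ ^ 2)) (r • θ.1) =
    ⟪θ.1, e⟫_ℝ * ∫ r in Ioo 0 b, Real.sin (2 * Real.pi * t * ⟪θ.1, e⟫_ℝ * r) * fRho n ρb r := by
  have hθ : ‖θ.1‖ = 1 := by simp
  rw [← integral_const_mul, ← Ioi_inter_Iio, ← setIntegral_indicator measurableSet_Iio]
  refine setIntegral_congr_fun measurableSet_Ioi fun r hr => ?_
  have hr0 : 0 < r := hr
  have hnorm : ‖r • θ.1‖ = r := by rw [norm_smul, hθ, mul_one, Real.norm_of_nonneg hr0.le]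
  by_cases hrb : r < b
  · rw [indicator_of_mem (by rwa [mem_ball_zero_iff, hnorm]), indicator_of_mem (by exact hrb),
      hrad _ (norm_pos_iff.1 (by rwa [hnorm])), hnorm, real_inner_smul_left, pow_pred_eq hn hr0,
      fRho, show 2 * Real.pi * t * (r * ⟪θ.1, e⟫_ℝ) = 2 * Real.pi * t * ⟪θ.1, e⟫_ℝ * r by ring]
    field_simp
  · rw [indicator_of_notMem (by rwa [mem_ball_zero_iff, hnorm]),
      indicator_of_notMem (by exact hrb), mul_zero]

/-- The radial profile of the symbol is bounded below at high frequencies. -/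
theorem exists_le_radialSymbol (hn : 0 < n) {ρ : Eu n → ℝ} {ρb : ℝ → ℝ} {ε : ℝ}
    (h0 : IsKernelH0 n ρ ρb ε) (h1 : IsKernelH1 n ρb ε) (h2 : IsKernelH2 n ρb ε)
    (h3 : IsKernelH3 n ρb ε) (hρ : Integrable ρ) {e : Eu n} (he : ‖e‖ = 1) :
    ∃ κ > (0 : ℝ), ∃ T > (0 : ℝ), ∀ t ≥ T, κ ≤ radialSymbol ρ e t := by
  obtain ⟨c, hc, hcf⟩ := exists_le_mul_fRho hn h0 h3
  obtain ⟨hρ0, hrad, -, -, hε, -⟩ := h0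
  obtain ⟨ν, hν0, hanti, hν⟩ := h1
  have hsub : Ioo 0 (ε / 2) ⊆ Ioo 0 ε := Ioo_subset_Ioo_right (by linarith)
  replace hanti := hanti.mono hsub
  replace hν := hν.mono hsub
  have hfC : ContDiffOn ℝ 1 (fRho n ρb) (Ioi 0) := h2.1.of_le (by exact_mod_cast le_top)
  have hf0 : ∀ r ∈ Ioo 0 (ε / 2), 0 ≤ fRho n ρb r := fun r hr =>
    (pos_of_mul_pos_right (hc.trans_le (hcf r hr)) hr.1.le).le
  set b : ℝ := ε / 4 with hbdef
  have hb : 0 < b := by positivity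
  have hbε : b < ε / 2 := by rw [hbdef]; linarith
  have hint := radial_integrableOn hn hρ hrad b
  set F : ℝ → Eu n → ℝ := fun t z =>
    Real.sin (2 * Real.pi * t * ⟪z, e⟫_ℝ) * (⟪z, e⟫_ℝ * ρ z / ‖z‖ ^ 2) with hF
  have hFI : ∀ t, Integrable (F t) := integrable_sin_mul_inner_mul_div hρ0 hρ he
  set σ : Measure (sphere (0 : Eu n) 1) := (volume : Measure (Eu n)).toSphere with hσ
  set U : Set (sphere (0 : Eu n) 1) := {θ | 1 / 2 < ⟪θ.1, e⟫_ℝ} with hU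
  have hUo : IsOpen U := isOpen_lt continuous_const (by fun_prop)
  have hUpos : 0 < σ.real U := by
    refine ENNReal.toReal_pos (hUo.measure_pos σ ⟨⟨e, by simpa using he⟩, ?_⟩).ne'
      (measure_ne_top _ _)
    simp only [hU, mem_ofPred_eq, real_inner_self_eq_norm_sq, he]
    norm_num
  set κ₀ : ℝ := ν * c / (2 * Real.pi) with hκ₀
  have hκ₀pos : 0 < κ₀ := by have := Real.pi_pos; positivity
  have hnear : ∀ t > 1 / b, κ₀ / 2 * σ.real U ≤ ∫ z, (ball (0 : Eu n) b).indicator (F t) z := by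
    intro t ht
    have ht0 : 0 < t := lt_trans (by positivity) ht
    obtain ⟨hpI, hpE⟩ := integral_polar hn ((hFI t).indicator (measurableSet_ball (x := 0) (ε := b)))
    simp only [hF, integral_radial_slice hn hrad e t b] at hpI hpE
    rw [hpE]
    have hslice : ∀ θ : sphere (0 : Eu n) 1, U.indicator (fun _ => κ₀ / 2) θ ≤ ⟪θ.1, e⟫_ℝ *
        ∫ r in Ioo 0 b, Real.sin (2 * Real.pi * t * ⟪θ.1, e⟫_ℝ * r) * fRho n ρb r := by
      intro θ
      by_cases hθ : θ ∈ U
      · rw [indicator_of_mem hθ]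
        have hθ' : 1 / 2 < ⟪θ.1, e⟫_ℝ := hθ
        have hab : Real.pi < 2 * Real.pi * t * ⟪θ.1, e⟫_ℝ * b := by
          have h4 : 1 < t * b := (div_lt_iff₀ hb).1 ht
          have h5 : (1 / 2) * 1 < ⟪θ.1, e⟫_ℝ * (t * b) :=
            mul_lt_mul'' hθ' h4 (by norm_num) (by norm_num)
          calc Real.pi = 2 * Real.pi * (1 / 2 * 1) := by ring
            _ < 2 * Real.pi * (⟪θ.1, e⟫_ℝ * (t * b)) :=
              mul_lt_mul_of_pos_left h5 Real.two_pi_pos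
            _ = _ := by ring
        have hκ := integral_sin_mul_ge_const hb hbε
          (mul_pos (mul_pos Real.two_pi_pos ht0) (by linarith)) hab hν0 hfC hanti hν hc hcf hint
        calc κ₀ / 2 = 1 / 2 * κ₀ := by ring
          _ ≤ _ := mul_le_mul hθ'.le hκ hκ₀pos.le (by linarith)
      · rw [indicator_of_notMem hθ]
        have hnn : ∀ τ : ℝ, 0 < τ →
            0 ≤ ∫ r in Ioo 0 b, Real.sin (2 * Real.pi * t * τ * r) * fRho n ρb r := fun τ hτ =>
          integral_sin_mul_nonneg hb hbε (mul_pos (mul_pos Real.two_pi_pos ht0) hτ) hν0 hfC hanti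
            hν hf0 hint
        rcases lt_trichotomy ⟪θ.1, e⟫_ℝ 0 with h | h | h
        · have h6 := hnn (-⟪θ.1, e⟫_ℝ) (by linarith)
          simp only [mul_neg, neg_mul, Real.sin_neg, integral_neg] at h6
          exact mul_nonneg_of_nonpos_of_nonpos h.le (by linarith)
        · rw [h, zero_mul]
        · exact mul_nonneg h.le (hnn _ h)
    have h7 := integral_mono ((integrable_const _).indicator hUo.measurableSet) hpI hslice
    rwa [integral_indicator hUo.measurableSet, setIntegral_const, smul_eq_mul, mul_comm] at h7
  set k : Eu n → ℝ := (ball (0 : Eu n) b)ᶜ.indicator fun z => ⟪z, e⟫_ℝ * ρ z / ‖z‖ ^ 2 with hk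
  have hkI : Integrable k := by
    refine Integrable.mono' (hρ.const_mul b⁻¹)
      ((aestronglyMeasurable_inner_mul_div hρ e).indicator measurableSet_ball.compl)
      (Filter.Eventually.of_forall fun z => ?_)
    by_cases hz : z ∈ (ball (0 : Eu n) b)ᶜ
    · rw [hk, indicator_of_mem hz]
      have hz' : b ≤ ‖z‖ := by simpa using hz
      refine (abs_inner_mul_div_le hρ0 he z).trans ?_
      rw [div_eq_inv_mul]
      exact mul_le_mul_of_nonneg_right (inv_anti₀ hb hz') (hρ0 z)
    · rw [hk, indicator_of_notMem hz, norm_zero]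
      exact mul_nonneg (by positivity) (hρ0 z)
  have hκ : 0 < κ₀ / 2 * σ.real U := by positivity
  have hfar := (tendsto_integral_sin_inner_mul hkI he).eventually
    (Ioi_mem_nhds (by linarith : -(κ₀ / 2 * σ.real U / 2) < 0))
  obtain ⟨T, hT⟩ := Filter.eventually_atTop.1 hfar
  refine ⟨κ₀ / 2 * σ.real U / 2, by positivity, max T (1 / b + 1),
    lt_max_of_lt_right (by positivity), fun t ht => ?_⟩
  have hN := hnear t (by linarith [le_max_right T (1 / b + 1)])
  have hFar := hT t ((le_max_left _ _).trans ht)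
  have hsum : radialSymbol ρ e t = (∫ z, (ball (0 : Eu n) b).indicator (F t) z) +
      ∫ z, Real.sin (2 * Real.pi * t * ⟪z, e⟫_ℝ) * k z := by
    have h8 : ∀ z, Real.sin (2 * Real.pi * t * ⟪z, e⟫_ℝ) * k z =
        (ball (0 : Eu n) b)ᶜ.indicator (F t) z := fun z => by
      by_cases hz : z ∈ (ball (0 : Eu n) b)ᶜ
      · rw [hk, indicator_of_mem hz, indicator_of_mem hz]
      · rw [hk, indicator_of_notMem hz, indicator_of_notMem hz, mul_zero]
    simp only [h8]
    rw [integral_indicator measurableSet_ball, integral_indicator measurableSet_ball.compl,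
      integral_add_compl measurableSet_ball (hFI t)]
    rfl
  rw [hsum]
  linarith

theorem Complex.norm_cos_le_exp_norm (w : ℂ) : ‖Complex.cos w‖ ≤ Real.exp ‖w‖ := by
  rw [Complex.cos, norm_div]
  have h1 : ‖Complex.exp (w * Complex.I)‖ ≤ Real.exp ‖w‖ := by
    refine (Complex.norm_exp_le_exp_norm _).trans (by simp)
  have h2 : ‖Complex.exp (-w * Complex.I)‖ ≤ Real.exp ‖w‖ := by
    refine (Complex.norm_exp_le_exp_norm _).trans (by simp)
  have h3 := norm_add_le (Complex.exp (w * Complex.I)) (Complex.exp (-w * Complex.I))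
  rw [Complex.norm_two]
  linarith

theorem Complex.norm_sin_le_norm_mul_exp_norm (w : ℂ) :
    ‖Complex.sin w‖ ≤ ‖w‖ * Real.exp ‖w‖ := by
  have h (x : ℂ) : ‖Complex.exp x - 1‖ ≤ ‖x‖ * Real.exp ‖x‖ := by
    simpa using Complex.norm_exp_sub_sum_le_norm_mul_exp x 1
  have h1 := h (w * Complex.I)
  have h2 := h (-w * Complex.I)
  simp only [norm_mul, norm_neg, Complex.norm_I, mul_one] at h1 h2
  have h3 : Complex.sin w = ((Complex.exp (-w * Complex.I) - 1) -
      (Complex.exp (w * Complex.I) - 1)) * Complex.I / 2 := by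
    rw [Complex.sin]; ring
  rw [h3, norm_div, norm_mul, Complex.norm_I, mul_one, Complex.norm_two]
  have := norm_sub_le (Complex.exp (-w * Complex.I) - 1) (Complex.exp (w * Complex.I) - 1)
  linarith

theorem radialSymbol_eq_of_norm_eq {ρ : Eu n → ℝ} {ρb : ℝ → ℝ}
    (hrad : ∀ x : Eu n, x ≠ 0 → ρ x = ρb ‖x‖) {e e' : Eu n} (h : ‖e‖ = ‖e'‖) (t : ℝ) :
    radialSymbol ρ e t = radialSymbol ρ e' t := by
  set R := (ℝ ∙ (e - e'))ᗮ.reflection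
  have hR : R e = e' := Submodule.reflection_sub h
  unfold radialSymbol
  rw [← R.measurePreserving.integral_comp R.toHomeomorph.measurableEmbedding
    (fun z => Real.sin (2 * Real.pi * t * ⟪z, e'⟫_ℝ) * (⟪z, e'⟫_ℝ * ρ z / ‖z‖ ^ 2))]
  · refine integral_congr_ae (Filter.Eventually.of_forall fun z => ?_)
    have h1 : ⟪R z, e'⟫_ℝ = ⟪z, e⟫_ℝ := by rw [← hR, R.inner_map_map]
    have h2 : ρ (R z) = ρ z := by
      rcases eq_or_ne z 0 with rfl | hz
      · simp
      · rw [hrad z hz, hrad (R z) (by simpa using hz), R.norm_map]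
    simp only [h1, h2, R.norm_map]

/-- The extension of `radialSymbol` to complex frequencies. -/
def complexRadialSymbol (ρ : Eu n → ℝ) (e : Eu n) (w : ℂ) : ℂ :=
  ∫ z, Complex.sin (w * (2 * Real.pi * ⟪z, e⟫_ℝ : ℝ)) * (⟪z, e⟫_ℝ * ρ z / ‖z‖ ^ 2 : ℝ)

theorem complexRadialSymbol_ofReal (ρ : Eu n → ℝ) (e : Eu n) (t : ℝ) :
    complexRadialSymbol ρ e t = radialSymbol ρ e t := by
  rw [complexRadialSymbol, radialSymbol, ← integral_complex_ofReal]
  refine integral_congr_ae (Filter.Eventually.of_forall fun z => ?_)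
  have : (t : ℂ) * (2 * Real.pi * ⟪z, e⟫_ℝ : ℝ) = ((2 * Real.pi * t * ⟪z, e⟫_ℝ : ℝ) : ℂ) := by
    push_cast; ring
  beta_reduce
  rw [this, Complex.ofReal_mul (Real.sin _), Complex.ofReal_sin]

theorem abs_inner_mul_abs_inner_mul_div_le {ρ : Eu n → ℝ} (hρ0 : ∀ x, 0 ≤ ρ x) {e : Eu n}
    (he : ‖e‖ = 1) (z : Eu n) : |⟪z, e⟫_ℝ| * |⟪z, e⟫_ℝ * ρ z / ‖z‖ ^ 2| ≤ ρ z := by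
  have h := abs_real_inner_le_norm z e
  rw [he, mul_one] at h
  refine (mul_le_mul h (abs_inner_mul_div_le hρ0 he z) (abs_nonneg _) (norm_nonneg _)).trans ?_
  rcases eq_or_ne z 0 with rfl | hz
  · simpa using hρ0 0
  · rw [mul_div_cancel₀ _ (norm_ne_zero_iff.2 hz)]

theorem differentiable_complexRadialSymbol {ρ : Eu n → ℝ} (hρ0 : ∀ x, 0 ≤ ρ x)
    (hρ : Integrable ρ) (hs : HasCompactSupport ρ) {e : Eu n} (he : ‖e‖ = 1) :
    Differentiable ℂ (complexRadialSymbol ρ e) := by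
  obtain ⟨R, hR⟩ := hs.isCompact.isBounded.exists_norm_le
  intro w₀
  have hk := (Complex.continuous_ofReal.comp_aestronglyMeasurable
    (aestronglyMeasurable_inner_mul_div hρ e))
  have hb (w : ℂ) (hw : ‖w‖ ≤ ‖w₀‖ + 1) (z : Eu n) :
      Real.exp ‖w * (2 * Real.pi * ⟪z, e⟫_ℝ : ℝ)‖ * ρ z ≤
        Real.exp ((‖w₀‖ + 1) * (2 * Real.pi * R)) * ρ z := by
    by_cases hz : ρ z = 0
    · simp [hz]
    have hzR := hR z (subset_tsupport ρ hz)
    have h := abs_real_inner_le_norm z e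
    rw [he, mul_one] at h
    refine mul_le_mul_of_nonneg_right (Real.exp_le_exp.2 ?_) (hρ0 z)
    rw [norm_mul, Complex.norm_real, Real.norm_eq_abs, abs_mul, abs_of_pos Real.two_pi_pos]
    have := Real.pi_pos
    gcongr
    exact h.trans hzR
  have hsin (w : ℂ) : Continuous fun z : Eu n =>
    Complex.sin (w * (2 * Real.pi * ⟪z, e⟫_ℝ : ℝ)) := by fun_prop
  have hcos (w : ℂ) : Continuous fun z : Eu n =>
    Complex.cos (w * (2 * Real.pi * ⟪z, e⟫_ℝ : ℝ)) * (2 * Real.pi * ⟪z, e⟫_ℝ : ℝ) := by fun_prop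
  have key := hasDerivAt_integral_of_dominated_loc_of_deriv_le (μ := (volume : Measure (Eu n)))
    (F := fun (w : ℂ) (z : Eu n) => Complex.sin (w * (2 * Real.pi * ⟪z, e⟫_ℝ : ℝ)) *
      (⟪z, e⟫_ℝ * ρ z / ‖z‖ ^ 2 : ℝ))
    (F' := fun (w : ℂ) (z : Eu n) => (Complex.cos (w * (2 * Real.pi * ⟪z, e⟫_ℝ : ℝ)) *
      (2 * Real.pi * ⟪z, e⟫_ℝ : ℝ)) * (⟪z, e⟫_ℝ * ρ z / ‖z‖ ^ 2 : ℝ))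
    (bound := fun z => 2 * Real.pi * (Real.exp ((‖w₀‖ + 1) * (2 * Real.pi * R)) * ρ z))
    (x₀ := w₀) (s := ball w₀ 1) (ball_mem_nhds _ one_pos)
    (Filter.Eventually.of_forall fun w => (hsin w).aestronglyMeasurable.mul hk)
    ?_ ((hcos w₀).aestronglyMeasurable.mul hk) ?_ ?_ ?_
  · exact key.2.differentiableAt
  · refine Integrable.mono' ((hρ.const_mul
      (Real.exp ((‖w₀‖ + 1) * (2 * Real.pi * R)))).const_mul (‖w₀‖ * (2 * Real.pi)))
      ((hsin w₀).aestronglyMeasurable.mul hk) (Filter.Eventually.of_forall fun z => ?_)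
    rw [norm_mul, Complex.norm_real, Real.norm_eq_abs]
    refine (mul_le_mul_of_nonneg_right (Complex.norm_sin_le_norm_mul_exp_norm _)
      (abs_nonneg _)).trans ?_
    refine le_trans ?_ (mul_le_mul_of_nonneg_left (hb w₀ (by linarith) z)
      (by have := Real.pi_pos; positivity))
    have h1 : ‖w₀ * (2 * Real.pi * ⟪z, e⟫_ℝ : ℝ)‖ = ‖w₀‖ * (2 * Real.pi) * |⟪z, e⟫_ℝ| := by
      rw [norm_mul, Complex.norm_real, Real.norm_eq_abs, abs_mul, abs_of_pos Real.two_pi_pos,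
        ← mul_assoc]
    set E := Real.exp ‖w₀ * (2 * Real.pi * ⟪z, e⟫_ℝ : ℝ)‖
    rw [h1]
    calc ‖w₀‖ * (2 * Real.pi) * |⟪z, e⟫_ℝ| * E * |⟪z, e⟫_ℝ * ρ z / ‖z‖ ^ 2|
        = ‖w₀‖ * (2 * Real.pi) * (E * (|⟪z, e⟫_ℝ| * |⟪z, e⟫_ℝ * ρ z / ‖z‖ ^ 2|)) := by ring
      _ ≤ _ := by
        have := Real.pi_pos
        gcongr
        exact abs_inner_mul_abs_inner_mul_div_le hρ0 he z
  · refine Filter.Eventually.of_forall fun z w hw => ?_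
    have hw' : ‖w‖ ≤ ‖w₀‖ + 1 := by
      have h1 := norm_sub_norm_le w w₀
      have h2 := mem_ball_iff_norm.1 hw
      linarith
    rw [norm_mul, norm_mul, Complex.norm_real, Complex.norm_real, Real.norm_eq_abs,
      Real.norm_eq_abs, abs_mul (2 * Real.pi), abs_of_pos Real.two_pi_pos]
    refine le_trans ?_ (mul_le_mul_of_nonneg_left (hb w hw' z) Real.two_pi_pos.le)
    have := Complex.norm_cos_le_exp_norm (w * (2 * Real.pi * ⟪z, e⟫_ℝ : ℝ))
    calc _ = 2 * Real.pi * (‖Complex.cos (w * (2 * Real.pi * ⟪z, e⟫_ℝ : ℝ))‖ *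
          (|⟪z, e⟫_ℝ| * |⟪z, e⟫_ℝ * ρ z / ‖z‖ ^ 2|)) := by ring
      _ ≤ _ := by
        have := Real.pi_pos
        gcongr
        exact abs_inner_mul_abs_inner_mul_div_le hρ0 he z
  · exact (hρ.const_mul _).const_mul _
  · refine Filter.Eventually.of_forall fun z w _ => ?_
    have h1 : HasDerivAt (fun w : ℂ => w * (2 * Real.pi * ⟪z, e⟫_ℝ : ℝ))
      (2 * Real.pi * ⟪z, e⟫_ℝ : ℝ) w := by
      simpa using (hasDerivAt_id w).mul_const ((2 * Real.pi * ⟪z, e⟫_ℝ : ℝ) : ℂ)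
    exact ((Complex.hasDerivAt_sin _).comp w h1).mul_const _

theorem continuous_radialSymbol {ρ : Eu n → ℝ} (hρ0 : ∀ x, 0 ≤ ρ x)
    (hρ : Integrable ρ) (hs : HasCompactSupport ρ) {e : Eu n} (he : ‖e‖ = 1) :
    Continuous (radialSymbol ρ e) := by
  have h := Complex.continuous_re.comp
    ((differentiable_complexRadialSymbol hρ0 hρ hs he).continuous.comp Complex.continuous_ofReal)
  refine h.congr fun t => ?_
  simp [complexRadialSymbol_ofReal]

theorem countable_zeros_of_differentiable {f : ℂ → ℂ} (hf : Differentiable ℂ f) {w₀ : ℂ}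
    (h : f w₀ ≠ 0) : {w | f w = 0}.Countable := by
  have ha : AnalyticOnNhd ℂ f univ := fun w _ => hf.analyticAt w
  rcases ha.eqOn_zero_or_eventually_ne_zero_of_preconnected isPreconnected_univ with h0 | h0
  · exact absurd (h0 (mem_univ w₀)) h
  · have := (HereditarilyLindelofSpace.isLindelof ({w | f w ≠ 0}ᶜ ∩ univ)).countable_of_isDiscrete
      (isDiscrete_of_codiscreteWithin (by simpa using! h0))
    simpa [compl_def] using this

theorem volume_radialSymbol_eq_zero (hn : 0 < n) {ρ : Eu n → ℝ} (hρ0 : ∀ x, 0 ≤ ρ x)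
    (hρ : Integrable ρ) (hs : HasCompactSupport ρ) {e : Eu n} (he : ‖e‖ = 1) {t₀ : ℝ}
    (ht : radialSymbol ρ e t₀ ≠ 0) :
    volume {ξ : Eu n | radialSymbol ρ e ‖ξ‖ = 0} = 0 := by
  have : Nonempty (Fin n) := ⟨⟨0, hn⟩⟩
  have hc : {t : ℝ | radialSymbol ρ e t = 0}.Countable := by
    have h1 := countable_zeros_of_differentiable (w₀ := (t₀ : ℂ))
      (differentiable_complexRadialSymbol hρ0 hρ hs he)
      (by rw [complexRadialSymbol_ofReal]; exact_mod_cast ht)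
    have h2 := h1.preimage Complex.ofReal_injective
    simpa [preimage, complexRadialSymbol_ofReal] using h2
  have h3 : {ξ : Eu n | radialSymbol ρ e ‖ξ‖ = 0} =
      ⋃ t ∈ {t : ℝ | radialSymbol ρ e t = 0}, sphere (0 : Eu n) t := by
    ext ξ; simp
  rw [h3, measure_biUnion_null_iff hc]
  intro t _
  exact Measure.addHaar_sphere _ _ _

theorem exists_volume_radialSymbol_lt_le (hn : 0 < n) {ρ : Eu n → ℝ} (hρ0 : ∀ x, 0 ≤ ρ x)
    (hρ : Integrable ρ) (hs : HasCompactSupport ρ) {e : Eu n} (he : ‖e‖ = 1) {κ T : ℝ}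
    (hκ : 0 < κ) (hT : ∀ t ≥ T, κ ≤ radialSymbol ρ e t) {η : ℝ≥0∞} (hη : 0 < η) :
    ∃ δ > 0, volume {ξ : Eu n | |radialSymbol ρ e ‖ξ‖| < δ} ≤ η := by
  have hcont : Continuous fun ξ : Eu n => |radialSymbol ρ e ‖ξ‖| :=
    ((continuous_radialSymbol hρ0 hρ hs he).comp continuous_norm).abs
  set S : ℕ → Set (Eu n) := fun k => {ξ | |radialSymbol ρ e ‖ξ‖| < κ / (k + 1)} with hS
  have hlim : Filter.Tendsto (fun k : ℕ => κ / ((k : ℝ) + 1)) Filter.atTop (nhds 0) := by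
    simpa [div_eq_mul_inv] using tendsto_one_div_add_atTop_nhds_zero_nat.const_mul κ
  have hanti : Antitone S := by
    intro k l hkl ξ hξ
    refine lt_of_lt_of_le (show |radialSymbol ρ e ‖ξ‖| < κ / (l + 1) from hξ) ?_
    gcongr
  have h0 : volume (⋂ k, S k) = 0 := by
    refine measure_mono_null ?_ (volume_radialSymbol_eq_zero hn hρ0 hρ hs he (t₀ := T)
      (hκ.trans_le (hT T le_rfl)).ne')
    intro ξ hξ
    have : |radialSymbol ρ e ‖ξ‖| ≤ 0 :=
      ge_of_tendsto' hlim fun k => (mem_iInter.1 hξ k).le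
    simpa using this
  have hfin : volume (S 0) ≠ ∞ := by
    refine ((measure_mono ?_).trans_lt (measure_ball_lt_top (x := (0 : Eu n)) (r := T))).ne
    intro ξ hξ
    rw [mem_ball_zero_iff]
    by_contra! hc
    have h1 := hT _ hc
    have h2 : |radialSymbol ρ e ‖ξ‖| < κ := by simpa [hS] using hξ
    linarith [le_abs_self (radialSymbol ρ e ‖ξ‖)]
  have ht := tendsto_measure_iInter_atTop (μ := (volume : Measure (Eu n))) (s := S)
    (fun k => (measurableSet_lt hcont.measurable measurable_const).nullMeasurableSet)
    hanti ⟨0, hfin⟩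
  rw [h0] at ht
  obtain ⟨k, hk⟩ := (ht.eventually (ge_mem_nhds hη)).exists
  exact ⟨κ / (k + 1), by positivity, hk⟩

/-- The directional component along `e` of the nonlocal gradient of a complex scalar field. -/
def nlDeriv (ρ : Eu n → ℝ) (e : Eu n) (U : Eu n → ℂ) (x : Eu n) : ℂ :=
  ∫ z, (U x - U (x - z)) * (⟪z, e⟫_ℝ * ρ z / ‖z‖ ^ 2 : ℝ)

/-- The Fourier multiplier of `nlDeriv ρ e`. -/
def nlSymbol (ρ : Eu n → ℝ) (e : Eu n) (ξ : Eu n) : ℂ :=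
  ∫ z, (1 - (Real.fourierChar (-⟪z, ξ⟫_ℝ) : ℂ)) * (⟪z, e⟫_ℝ * ρ z / ‖z‖ ^ 2 : ℝ)

theorem ofReal_nlGradM (ρ : Eu n → ℝ) (v : Eu n → Eu n) (x : Eu n) (i j : Fin n) :
    (nlGradM ρ v x i j : ℂ) =
      nlDeriv ρ (EuclideanSpace.single j 1) (fun y => (v y i : ℂ)) x := by
  have h : nlGradM ρ v x i j = ∫ z, nlGradMInt ρ v x i j (x - z) :=
    (integral_sub_left_eq_self (nlGradMInt ρ v x i j) volume x).symm
  rw [h, nlDeriv, ← integral_complex_ofReal]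
  refine integral_congr_ae (Filter.Eventually.of_forall fun z => ?_)
  simp only [nlGradMInt, sub_sub_cancel, PiLp.sub_apply, EuclideanSpace.inner_single_right]
  push_cast
  simp
  ring

theorem norm_mul_inner_mul_div_le {ρ : Eu n → ℝ} (hρ0 : ∀ x, 0 ≤ ρ x) {e : Eu n} (he : ‖e‖ = 1)
    {a : ℂ} {L : ℝ} (hL : 0 ≤ L) {z : Eu n} (ha : ‖a‖ ≤ L * ‖z‖) :
    ‖a * (⟪z, e⟫_ℝ * ρ z / ‖z‖ ^ 2 : ℝ)‖ ≤ L * ρ z := by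
  rw [norm_mul, Complex.norm_real, Real.norm_eq_abs]
  refine (mul_le_mul ha (abs_inner_mul_div_le hρ0 he z) (abs_nonneg _) (by positivity)).trans ?_
  rcases eq_or_ne z 0 with rfl | hz
  · simpa using mul_nonneg hL (hρ0 0)
  · rw [mul_assoc, mul_div_cancel₀ _ (norm_ne_zero_iff.2 hz)]

theorem norm_sub_sub_le {U : Eu n → ℂ} {L : NNReal} (hU : LipschitzWith L U) (x z : Eu n) :
    ‖U x - U (x - z)‖ ≤ L * ‖z‖ := by
  simpa [dist_eq_norm] using hU.dist_le_mul x (x - z)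

theorem continuous_nlDeriv {ρ : Eu n → ℝ} (hρ0 : ∀ x, 0 ≤ ρ x) (hρ : Integrable ρ)
    {e : Eu n} (he : ‖e‖ = 1) {U : Eu n → ℂ} {L : NNReal} (hU : LipschitzWith L U) :
    Continuous (nlDeriv ρ e U) := by
  have hc := hU.continuous
  refine continuous_of_dominated (bound := fun z => L * ρ z) (fun x => ?_) (fun x => ?_)
    (hρ.const_mul _) ?_
  · exact (by fun_prop : Continuous fun z => U x - U (x - z)).aestronglyMeasurable.mul
      (Complex.continuous_ofReal.comp_aestronglyMeasurable
        (aestronglyMeasurable_inner_mul_div hρ e))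
  · exact Filter.Eventually.of_forall fun z =>
      norm_mul_inner_mul_div_le hρ0 he L.2 (norm_sub_sub_le hU x z)
  · exact Filter.Eventually.of_forall fun z => by fun_prop

theorem exists_nlDeriv_support {ρ : Eu n → ℝ} (hs : HasCompactSupport ρ) (e : Eu n)
    {U : Eu n → ℂ} (hUs : HasCompactSupport U) :
    ∃ R, ∀ x ∉ closedBall (0 : Eu n) R, ∀ z,
      (U x - U (x - z)) * (⟪z, e⟫_ℝ * ρ z / ‖z‖ ^ 2 : ℝ) = 0 := by
  obtain ⟨R₁, h₁⟩ := hs.isCompact.isBounded.exists_norm_le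
  obtain ⟨R₂, h₂⟩ := hUs.isCompact.isBounded.exists_norm_le
  refine ⟨max R₂ (R₁ + R₂), fun x hx z => ?_⟩
  rw [mem_closedBall_zero_iff, not_le, max_lt_iff] at hx
  by_cases hz : ρ z = 0
  · simp [hz]
  have hz1 := h₁ z (subset_tsupport _ hz)
  have hx0 : U x = 0 := by
    by_contra h
    linarith [h₂ x (subset_tsupport _ h)]
  have hx1 : U (x - z) = 0 := by
    by_contra h
    have h3 := h₂ _ (subset_tsupport _ h)
    have h4 := norm_le_norm_add_norm_sub' x z
    linarith
  simp [hx0, hx1]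

theorem hasCompactSupport_nlDeriv {ρ : Eu n → ℝ} (hs : HasCompactSupport ρ) (e : Eu n)
    {U : Eu n → ℂ} (hUs : HasCompactSupport U) : HasCompactSupport (nlDeriv ρ e U) := by
  obtain ⟨R, hR⟩ := exists_nlDeriv_support hs e hUs
  refine HasCompactSupport.intro (isCompact_closedBall 0 R) fun x hx => ?_
  simp only [nlDeriv, hR x hx, integral_zero]

theorem integrable_prod_nlDeriv {ρ : Eu n → ℝ} (hρ0 : ∀ x, 0 ≤ ρ x) (hρ : Integrable ρ)
    (hs : HasCompactSupport ρ) {e : Eu n} (he : ‖e‖ = 1) {U : Eu n → ℂ} {L : NNReal}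
    (hU : LipschitzWith L U) (hUs : HasCompactSupport U) :
    Integrable (fun p : Eu n × Eu n =>
      (U p.1 - U (p.1 - p.2)) * (⟪p.2, e⟫_ℝ * ρ p.2 / ‖p.2‖ ^ 2 : ℝ))
      ((volume : Measure (Eu n)).prod volume) := by
  obtain ⟨R, hR⟩ := exists_nlDeriv_support hs e hUs
  have hc := hU.continuous
  have hK : Integrable ((closedBall (0 : Eu n) R).indicator fun _ => (1 : ℝ)) :=
    (integrable_indicator_iff measurableSet_closedBall).2
      (integrableOn_const (measure_closedBall_lt_top.ne))
  refine (hK.mul_prod (hρ.const_mul (L : ℝ))).mono' ?_ (Filter.Eventually.of_forall fun p => ?_)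
  · refine (by fun_prop : Continuous fun p : Eu n × Eu n =>
      U p.1 - U (p.1 - p.2)).aestronglyMeasurable.mul ?_
    exact (Complex.continuous_ofReal.comp_aestronglyMeasurable
      (aestronglyMeasurable_inner_mul_div hρ e)).comp_snd
  · by_cases hp : p.1 ∈ closedBall (0 : Eu n) R
    · rw [indicator_of_mem hp, one_mul]
      exact norm_mul_inner_mul_div_le hρ0 he L.2 (norm_sub_sub_le hU p.1 p.2)
    · rw [hR _ hp, indicator_of_notMem hp]; simp

theorem norm_one_sub_fourierChar_le (z ξ : Eu n) :
    ‖1 - (Real.fourierChar (-⟪z, ξ⟫_ℝ) : ℂ)‖ ≤ 2 * Real.pi * ‖ξ‖ * ‖z‖ := by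
  rw [norm_sub_rev, Real.fourierChar_apply]
  have h := Real.norm_exp_I_mul_ofReal_sub_one_le (x := 2 * Real.pi * -⟪z, ξ⟫_ℝ)
  rw [mul_comm Complex.I] at h
  refine h.trans ?_
  rw [Real.norm_eq_abs, abs_mul, abs_neg, abs_of_pos Real.two_pi_pos,
    mul_assoc _ ‖ξ‖, mul_comm ‖ξ‖ ‖z‖]
  have := Real.pi_pos
  gcongr
  exact abs_real_inner_le_norm z ξ

theorem continuous_one_sub_fourierChar (ξ : Eu n) :
    Continuous fun z : Eu n => 1 - (Real.fourierChar (-⟪z, ξ⟫_ℝ) : ℂ) := by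
  simp only [Real.fourierChar_apply]
  fun_prop

theorem integrable_nlSymbol {ρ : Eu n → ℝ} (hρ0 : ∀ x, 0 ≤ ρ x) (hρ : Integrable ρ)
    {e : Eu n} (he : ‖e‖ = 1) (ξ : Eu n) :
    Integrable fun z => (1 - (Real.fourierChar (-⟪z, ξ⟫_ℝ) : ℂ)) *
      (⟪z, e⟫_ℝ * ρ z / ‖z‖ ^ 2 : ℝ) := by
  refine Integrable.mono' (hρ.const_mul (2 * Real.pi * ‖ξ‖)) ?_
    (Filter.Eventually.of_forall fun z => norm_mul_inner_mul_div_le hρ0 he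
      (by have := Real.pi_pos; positivity) (norm_one_sub_fourierChar_le z ξ))
  exact (continuous_one_sub_fourierChar ξ).aestronglyMeasurable.mul
    (Complex.continuous_ofReal.comp_aestronglyMeasurable
      (aestronglyMeasurable_inner_mul_div hρ e))

theorem norm_nlSymbol_le {ρ : Eu n → ℝ} (hρ0 : ∀ x, 0 ≤ ρ x) (hρ : Integrable ρ)
    {e : Eu n} (he : ‖e‖ = 1) (ξ : Eu n) :
    ‖nlSymbol ρ e ξ‖ ≤ 2 * Real.pi * ‖ξ‖ * ∫ z, ρ z := by
  rw [← integral_const_mul]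
  exact norm_integral_le_of_norm_le (hρ.const_mul _)
    (Filter.Eventually.of_forall fun z => norm_mul_inner_mul_div_le hρ0 he
      (by have := Real.pi_pos; positivity) (norm_one_sub_fourierChar_le z ξ))

open scoped FourierTransform in
theorem fourier_nlDeriv {ρ : Eu n → ℝ} (hρ0 : ∀ x, 0 ≤ ρ x) (hρ : Integrable ρ)
    (hs : HasCompactSupport ρ) {e : Eu n} (he : ‖e‖ = 1) {U : Eu n → ℂ} {L : NNReal}
    (hU : LipschitzWith L U) (hUs : HasCompactSupport U) (ξ : Eu n) :
    𝓕 (nlDeriv ρ e U) ξ = 𝓕 U ξ * nlSymbol ρ e ξ := by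
  have hUi : Integrable U := hU.continuous.integrable_of_hasCompactSupport hUs
  have hchar : Continuous fun x : Eu n => (𝐞 (-⟪x, ξ⟫_ℝ) : ℂ) := by
    simp only [Real.fourierChar_apply]; fun_prop
  have htr (z : Eu n) : ∫ x, 𝐞 (-⟪x, ξ⟫_ℝ) • U (x - z) = 𝐞 (-⟪z, ξ⟫_ℝ) • 𝓕 U ξ := by
    have h := integral_sub_right_eq_self (μ := (volume : Measure (Eu n)))
      (fun x => 𝐞 (-⟪x + z, ξ⟫_ℝ) • U x) z
    simp only [sub_add_cancel] at h
    rw [h, Real.fourier_eq, Circle.smul_def, smul_eq_mul, ← integral_const_mul]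
    refine integral_congr_ae (Filter.Eventually.of_forall fun x => ?_)
    simp only [inner_add_left, neg_add, Circle.smul_def, smul_eq_mul, AddChar.map_add_eq_mul,
      Circle.coe_mul]
    ring
  have hprod := (integrable_prod_nlDeriv hρ0 hρ hs he hU hUs).bdd_mul (c := 1)
    (f := fun p : Eu n × Eu n => (𝐞 (-⟪p.1, ξ⟫_ℝ) : ℂ))
    (by exact (hchar.comp continuous_fst).aestronglyMeasurable)
    (Filter.Eventually.of_forall fun p => (Circle.norm_coe _).le)
  rw [Real.fourier_eq]
  calc ∫ x, 𝐞 (-⟪x, ξ⟫_ℝ) • nlDeriv ρ e U x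
      = ∫ x, ∫ z, (𝐞 (-⟪x, ξ⟫_ℝ) : ℂ) * ((U x - U (x - z)) *
          (⟪z, e⟫_ℝ * ρ z / ‖z‖ ^ 2 : ℝ)) := by
        refine integral_congr_ae (Filter.Eventually.of_forall fun x => ?_)
        simp only [nlDeriv]
        rw [integral_const_mul]; rfl
    _ = ∫ z, ∫ x, (𝐞 (-⟪x, ξ⟫_ℝ) : ℂ) * ((U x - U (x - z)) *
          (⟪z, e⟫_ℝ * ρ z / ‖z‖ ^ 2 : ℝ)) := integral_integral_swap hprod
    _ = ∫ z, 𝓕 U ξ * ((1 - (𝐞 (-⟪z, ξ⟫_ℝ) : ℂ)) * (⟪z, e⟫_ℝ * ρ z / ‖z‖ ^ 2 : ℝ)) := by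
        refine integral_congr_ae (Filter.Eventually.of_forall fun z => ?_)
        simp only [← mul_assoc]
        rw [integral_mul_const]
        congr 1
        have hi1 : Integrable fun x => 𝐞 (-⟪x, ξ⟫_ℝ) • U x :=
          (Real.fourierIntegral_convergent_iff ξ).2 hUi
        have hi2 : Integrable fun x => 𝐞 (-⟪x, ξ⟫_ℝ) • U (x - z) :=
          (Real.fourierIntegral_convergent_iff ξ).2 (hUi.comp_sub_right z)
        have : ∫ x, (𝐞 (-⟪x, ξ⟫_ℝ) : ℂ) * (U x - U (x - z)) =
            ∫ x, (𝐞 (-⟪x, ξ⟫_ℝ) • U x - 𝐞 (-⟪x, ξ⟫_ℝ) • U (x - z)) := by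
          refine integral_congr_ae (Filter.Eventually.of_forall fun x => ?_)
          simp only [Circle.smul_def, smul_eq_mul]; ring
        rw [this, integral_sub hi1 hi2, htr, ← Real.fourier_eq, Circle.smul_def, smul_eq_mul]
        ring
    _ = _ := by rw [integral_const_mul, nlSymbol]

open scoped FourierTransform in
theorem continuous_fourier_of_integrable {U : Eu n → ℂ} (hU : Integrable U) :
    Continuous (𝓕 U) :=
  VectorFourier.fourierIntegral_continuous (L := innerₗ (Eu n)) Real.continuous_fourierChar
    continuous_inner hU

open scoped FourierTransform in
theorem norm_fourier_le_integral_norm (U : Eu n → ℂ) (ξ : Eu n) :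
    ‖𝓕 U ξ‖ ≤ ∫ x, ‖U x‖ :=
  VectorFourier.norm_fourierIntegral_le_integral_norm Real.fourierChar volume (innerₗ (Eu n)) U ξ

open scoped FourierTransform in
theorem integrable_norm_sq_fourier {U : Eu n → ℂ} (hU : Integrable U)
    (hU' : Integrable (𝓕 U)) : Integrable fun ξ => ‖𝓕 U ξ‖ ^ 2 := by
  refine (hU'.norm.const_mul (∫ x, ‖U x‖)).mono'
    ((continuous_fourier_of_integrable hU).norm.pow 2).aestronglyMeasurable
    (Filter.Eventually.of_forall fun ξ => ?_)
  rw [norm_pow, norm_norm, sq]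
  exact mul_le_mul_of_nonneg_right (norm_fourier_le_integral_norm U ξ) (norm_nonneg _)

open scoped FourierTransform in
theorem integrable_fourier_nlDeriv {ρ : Eu n → ℝ} (hρ0 : ∀ x, 0 ≤ ρ x) (hρ : Integrable ρ)
    (hs : HasCompactSupport ρ) {e : Eu n} (he : ‖e‖ = 1) {U : Eu n → ℂ}
    (hU : ContDiff ℝ (⊤ : ℕ∞) U) (hUs : HasCompactSupport U) :
    Integrable (𝓕 (nlDeriv ρ e U)) := by
  obtain ⟨L, hL⟩ := hU.lipschitzWith_of_hasCompactSupport hUs (by simp)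
  have h1 := (𝓕 (hUs.toSchwartzMap hU) : SchwartzMap (Eu n) ℂ).integrable_pow_mul volume 1
  have h2 : ⇑(𝓕 (hUs.toSchwartzMap hU) : SchwartzMap (Eu n) ℂ) = 𝓕 U := by
    rw [SchwartzMap.fourier_coe]; rfl
  rw [h2] at h1
  refine (h1.const_mul (2 * Real.pi * ∫ z, ρ z)).mono' ?_ (Filter.Eventually.of_forall fun ξ => ?_)
  · exact (continuous_fourier_of_integrable ((continuous_nlDeriv hρ0 hρ he
      hL).integrable_of_hasCompactSupport
        (hasCompactSupport_nlDeriv hs e hUs))).aestronglyMeasurable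
  · rw [fourier_nlDeriv hρ0 hρ hs he hL hUs, norm_mul, mul_comm]
    refine (mul_le_mul_of_nonneg_right (norm_nlSymbol_le hρ0 hρ he ξ) (norm_nonneg _)).trans ?_
    rw [pow_one]
    exact le_of_eq (by ring)

open scoped FourierTransform in
theorem integrable_fourier_of_contDiff {U : Eu n → ℂ}
    (hU : ContDiff ℝ (⊤ : ℕ∞) U) (hUs : HasCompactSupport U) : Integrable (𝓕 U) := by
  have h1 := (𝓕 (hUs.toSchwartzMap hU) : SchwartzMap (Eu n) ℂ).integrable (μ := volume)
  have h2 : ⇑(𝓕 (hUs.toSchwartzMap hU) : SchwartzMap (Eu n) ℂ) = 𝓕 U := by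
    rw [SchwartzMap.fourier_coe]; rfl
  rwa [h2] at h1

theorem im_nlSymbol {ρ : Eu n → ℝ} (hρ0 : ∀ x, 0 ≤ ρ x) (hρ : Integrable ρ)
    {e : Eu n} (he : ‖e‖ = 1) (ξ : Eu n) :
    (nlSymbol ρ e ξ).im =
      ∫ z, Real.sin (2 * Real.pi * ⟪z, ξ⟫_ℝ) * (⟪z, e⟫_ℝ * ρ z / ‖z‖ ^ 2) := by
  have := integral_im (integrable_nlSymbol hρ0 hρ he ξ)
  simp only [RCLike.im_eq_complex_im] at this
  rw [nlSymbol, ← this]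
  refine integral_congr_ae (Filter.Eventually.of_forall fun z => ?_)
  simp only [Complex.im_mul_ofReal, Complex.sub_im, Complex.one_im, Real.fourierChar_apply,
    Complex.exp_ofReal_mul_I_im]
  rw [mul_neg, Real.sin_neg]
  ring

theorem sq_radialSymbol_le_sum {ρ : Eu n → ℝ} {ρb : ℝ → ℝ} (hρ0 : ∀ x, 0 ≤ ρ x)
    (hρ : Integrable ρ) (hrad : ∀ x : Eu n, x ≠ 0 → ρ x = ρb ‖x‖)
    {e : Eu n} (he : ‖e‖ = 1) {ξ : Eu n} (hξ : ξ ≠ 0) :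
    radialSymbol ρ e ‖ξ‖ ^ 2 ≤ ∑ j, ‖nlSymbol ρ (EuclideanSpace.single j 1) ξ‖ ^ 2 := by
  have hξ' : ‖ξ‖ ≠ 0 := norm_ne_zero_iff.2 hξ
  set ω : Eu n := ‖ξ‖⁻¹ • ξ with hω
  have hω1 : ‖ω‖ = 1 := by rw [hω, norm_smul, norm_inv, norm_norm, inv_mul_cancel₀ hξ']
  have hej (j : Fin n) : ‖(EuclideanSpace.single j 1 : Eu n)‖ = 1 := by simp
  have hsc (z : Eu n) : ‖ξ‖ * ⟪z, ω⟫_ℝ = ⟪z, ξ⟫_ℝ := by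
    rw [hω, inner_smul_right, mul_inv_cancel_left₀ hξ']
  have hint (j : Fin n) : Integrable fun z => Real.sin (2 * Real.pi * ⟪z, ξ⟫_ℝ) *
      (⟪z, (EuclideanSpace.single j 1 : Eu n)⟫_ℝ * ρ z / ‖z‖ ^ 2) := by
    have h := (integrable_nlSymbol hρ0 hρ (hej j) ξ).im
    refine h.congr (Filter.Eventually.of_forall fun z => ?_)
    simp only [RCLike.im_eq_complex_im, Complex.im_mul_ofReal, Complex.sub_im, Complex.one_im,
      Real.fourierChar_apply, Complex.exp_ofReal_mul_I_im]
    rw [mul_neg, Real.sin_neg]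
    ring
  have hsum : radialSymbol ρ e ‖ξ‖ =
      ∑ j, ω j * (nlSymbol ρ (EuclideanSpace.single j 1) ξ).im := by
    rw [radialSymbol_eq_of_norm_eq hrad (he.trans hω1.symm), radialSymbol]
    simp only [im_nlSymbol hρ0 hρ (hej _), ← integral_const_mul]
    rw [← integral_finsetSum _ fun j _ => (hint j).const_mul _]
    refine integral_congr_ae (Filter.Eventually.of_forall fun z => ?_)
    simp only [mul_assoc (2 * Real.pi), hsc]
    have : ⟪z, ω⟫_ℝ = ∑ j, ω j * ⟪z, (EuclideanSpace.single j 1 : Eu n)⟫_ℝ := by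
      simp [PiLp.inner_apply]
    rw [this, Finset.sum_mul, Finset.sum_div, Finset.mul_sum]
    exact Finset.sum_congr rfl fun j _ => by ring
  rw [hsum]
  refine (Finset.sum_mul_sq_le_sq_mul_sq _ _ _).trans ?_
  have h1 : ∑ j, ω j ^ 2 = 1 := by
    rw [← EuclideanSpace.real_norm_sq_eq, hω1, one_pow]
  rw [h1, one_mul]
  refine Finset.sum_le_sum fun j _ => ?_
  rw [← sq_abs]
  gcongr
  exact Complex.abs_im_le_norm _

theorem sum_norm_sq_le_sum_norm_sq_symmetrized (a μ : Fin n → ℂ) :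
    (1 / 2 : ℝ) * ∑ i, ∑ j, ‖a i * μ j‖ ^ 2 ≤
      ∑ i, ∑ j, ‖(1 / 2 : ℂ) * (a i * μ j + a j * μ i)‖ ^ 2 := by
  have hpt (i j : Fin n) : ‖(1 / 2 : ℂ) * (a i * μ j + a j * μ i)‖ ^ 2 =
      (1 / 4 : ℝ) * ‖a i * μ j‖ ^ 2 + (1 / 4 : ℝ) * ‖a j * μ i‖ ^ 2 +
        (1 / 2 : ℝ) * ((a i * starRingEnd ℂ (μ i)) * starRingEnd ℂ (a j * starRingEnd ℂ (μ j))).re := by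
    simp only [← Complex.normSq_eq_norm_sq, Complex.normSq_apply, Complex.mul_re, Complex.mul_im,
      Complex.add_re, Complex.add_im, Complex.conj_re, Complex.conj_im, map_mul, Complex.conj_conj]
    norm_num
    ring
  have hcross : ∑ i, ∑ j,
      ((a i * starRingEnd ℂ (μ i)) * starRingEnd ℂ (a j * starRingEnd ℂ (μ j))).re =
        ‖∑ i, a i * starRingEnd ℂ (μ i)‖ ^ 2 := by
    simp only [← Complex.re_sum]
    rw [← Finset.sum_mul_sum, ← map_sum, Complex.mul_conj, Complex.ofReal_re,
      Complex.normSq_eq_norm_sq]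
  have hswap : ∑ i, ∑ j, ‖a j * μ i‖ ^ 2 = ∑ i, ∑ j, ‖a i * μ j‖ ^ 2 := Finset.sum_comm
  simp only [hpt, Finset.sum_add_distrib, ← Finset.mul_sum, hcross, hswap]
  have := sq_nonneg ‖∑ i, a i * starRingEnd ℂ (μ i)‖
  linarith

theorem sq_integral_le_measureReal_univ_mul {α : Type*} [MeasurableSpace α] {μ : Measure α}
    [IsFiniteMeasure μ] {g : α → ℝ} (hg : Integrable g μ) (hg2 : Integrable (fun x => g x ^ 2) μ) :
    (∫ x, g x ∂μ) ^ 2 ≤ μ.real univ * ∫ x, g x ^ 2 ∂μ := by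
  generalize hI : ∫ x, g x ∂μ = I
  generalize hm : μ.real univ = m
  have hm0 : 0 ≤ m := hm ▸ measureReal_nonneg
  have hexp : ∫ x, (m * g x - I) ^ 2 ∂μ = m * (m * (∫ x, g x ^ 2 ∂μ) - I ^ 2) := by
    have : (fun x => (m * g x - I) ^ 2) =
        fun x => m ^ 2 * g x ^ 2 - 2 * m * I * g x + I ^ 2 := by
      funext x; ring
    rw [this, integral_add (f := fun x => m ^ 2 * g x ^ 2 - 2 * m * I * g x) ((hg2.const_mul _).sub (hg.const_mul _))
        (integrable_const _),
      integral_sub (hg2.const_mul _) (hg.const_mul _), integral_const_mul, integral_const_mul,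
      integral_const, hI, hm, smul_eq_mul]
    ring
  have hpos : 0 ≤ ∫ x, (m * g x - I) ^ 2 ∂μ := integral_nonneg fun x => sq_nonneg _
  rw [hexp] at hpos
  rcases hm0.eq_or_lt with h0 | h0
  · have hv : μ = 0 := by
      rw [← h0, measureReal_def] at hm
      exact Measure.measure_univ_eq_zero.1
        (((ENNReal.toReal_eq_zero_iff _).1 hm).resolve_right (measure_ne_top _ _))
    have : I = 0 := by rw [← hI, hv, integral_zero_measure]
    simp [this, ← h0]
  · exact sub_nonneg.1 (nonneg_of_mul_nonneg_right hpos h0)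

theorem Continuous.integrable_norm_sq_of_hasCompactSupport {U : Eu n → ℂ} (hU : Continuous U)
    (hUs : HasCompactSupport U) : Integrable fun x => ‖U x‖ ^ 2 := by
  have hs : HasCompactSupport fun x => ‖U x‖ ^ 2 :=
    hUs.mono fun x hx h => hx (by simp [h])
  have hc : Continuous fun x => ‖U x‖ ^ 2 := by fun_prop
  exact hc.integrable_of_hasCompactSupport hs

theorem sq_integral_norm_le {U : Eu n → ℂ} (hU : Continuous U) (hUs : HasCompactSupport U)
    {Ω : Set (Eu n)} (hΩ : volume Ω ≠ ∞) (hsub : tsupport U ⊆ Ω) :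
    (∫ x, ‖U x‖) ^ 2 ≤ volume.real Ω * ∫ x, ‖U x‖ ^ 2 := by
  have hz (x : Eu n) (hx : x ∉ Ω) : U x = 0 := image_eq_zero_of_notMem_tsupport fun h => hx (hsub h)
  have : IsFiniteMeasure (volume.restrict Ω) := ⟨by simpa using hΩ.lt_top⟩
  have h1 : ∫ x in Ω, ‖U x‖ = ∫ x, ‖U x‖ :=
    setIntegral_eq_integral_of_forall_compl_eq_zero fun x hx => by simp [hz x hx]
  have h2 : ∫ x in Ω, ‖U x‖ ^ 2 = ∫ x, ‖U x‖ ^ 2 :=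
    setIntegral_eq_integral_of_forall_compl_eq_zero fun x hx => by simp [hz x hx]
  have i1 : Integrable (fun x => ‖U x‖) (volume.restrict Ω) :=
    (hU.norm.integrable_of_hasCompactSupport hUs.norm).restrict
  have i2 : Integrable (fun x => ‖U x‖ ^ 2) (volume.restrict Ω) :=
    (hU.integrable_norm_sq_of_hasCompactSupport hUs).restrict
  rw [← h1, ← h2]
  simpa using sq_integral_le_measureReal_univ_mul i1 i2

theorem radialSymbol_zero (ρ : Eu n → ℝ) (e : Eu n) : radialSymbol ρ e 0 = 0 := by
  simp [radialSymbol]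

open scoped FourierTransform in
/-- Nonlocal Poincaré inequality: the symbol is bounded below outside a set of small measure. -/
theorem nonlocal_poincare {ρ : Eu n → ℝ} {ρb : ℝ → ℝ} (hρ0 : ∀ x, 0 ≤ ρ x)
    (hρ : Integrable ρ) (hs : HasCompactSupport ρ) (hrad : ∀ x : Eu n, x ≠ 0 → ρ x = ρb ‖x‖)
    {e : Eu n} (he : ‖e‖ = 1) {Ω : Set (Eu n)} (hΩ : volume Ω ≠ ∞) {δ : ℝ} (hδ : 0 < δ)
    (hZ : volume {ξ : Eu n | |radialSymbol ρ e ‖ξ‖| < δ} ≤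
      ENNReal.ofReal (1 / (2 * (volume.real Ω + 1))))
    {U : Eu n → ℂ} (hU : ContDiff ℝ (⊤ : ℕ∞) U) (hUs : HasCompactSupport U)
    (hsub : tsupport U ⊆ Ω) :
    δ ^ 2 / 2 * ∫ x, ‖U x‖ ^ 2 ≤
      ∑ j, ∫ x, ‖nlDeriv ρ (EuclideanSpace.single j 1) U x‖ ^ 2 := by
  obtain ⟨L, hL⟩ := hU.lipschitzWith_of_hasCompactSupport hUs (by simp)
  have hej (j : Fin n) : ‖(EuclideanSpace.single j 1 : Eu n)‖ = 1 := by simp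
  have hUi : Integrable U := hU.continuous.integrable_of_hasCompactSupport hUs
  have hUF := integrable_fourier_of_contDiff hU hUs
  have hFi (j : Fin n) : Integrable (nlDeriv ρ (EuclideanSpace.single j 1) U) :=
    (continuous_nlDeriv hρ0 hρ (hej j) hL).integrable_of_hasCompactSupport
      (hasCompactSupport_nlDeriv hs _ hUs)
  have hFF (j : Fin n) := integrable_fourier_nlDeriv hρ0 hρ hs (hej j) hU hUs
  set Z := {ξ : Eu n | |radialSymbol ρ e ‖ξ‖| < δ} with hZdef
  have hZm : MeasurableSet Z := measurableSet_lt
    ((continuous_radialSymbol hρ0 hρ hs he).comp continuous_norm).abs.measurable measurable_const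
  set m := volume.real Ω
  have hm0 : 0 ≤ m := measureReal_nonneg
  set A := ∫ x, ‖U x‖ ^ 2 with hA
  have hA0 : 0 ≤ A := integral_nonneg fun x => sq_nonneg _
  have hZtop : volume Z ≠ ∞ := (hZ.trans_lt ENNReal.ofReal_lt_top).ne
  have hZr : volume.real Z ≤ 1 / (2 * (m + 1)) :=
    ENNReal.toReal_le_of_le_ofReal (by positivity) hZ
  have hint := integrable_norm_sq_fourier hUi hUF
  have hplan : ∫ ξ, ‖𝓕 U ξ‖ ^ 2 = A :=
    integral_norm_sq_fourier_of_continuous hU.continuous hUi hUF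
  have hbound (ξ : Eu n) : ‖𝓕 U ξ‖ ^ 2 ≤ m * A := by
    refine le_trans ?_ (sq_integral_norm_le hU.continuous hUs hΩ hsub)
    gcongr
    exact norm_fourier_le_integral_norm U ξ
  have hsmall : ∫ ξ in Z, ‖𝓕 U ξ‖ ^ 2 ≤ A / 2 := by
    calc ∫ ξ in Z, ‖𝓕 U ξ‖ ^ 2 ≤ ∫ ξ in Z, m * A :=
          setIntegral_mono_on hint.integrableOn (integrableOn_const hZtop) hZm
            fun ξ _ => hbound ξ
      _ = volume.real Z * (m * A) := by rw [setIntegral_const, smul_eq_mul]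
      _ ≤ 1 / (2 * (m + 1)) * (m * A) := by gcongr
      _ ≤ A / 2 := by
        rw [div_mul_eq_mul_div, div_le_div_iff₀ (by positivity) two_pos]
        nlinarith
  have hsplit := integral_add_compl hZm hint
  rw [hplan] at hsplit
  have hlow : ∫ ξ in Zᶜ, δ ^ 2 * ‖𝓕 U ξ‖ ^ 2 ≤
      ∫ ξ, ∑ j, ‖𝓕 (nlDeriv ρ (EuclideanSpace.single j 1) U) ξ‖ ^ 2 := by
    have hsumint : Integrable fun ξ =>
        ∑ j, ‖𝓕 (nlDeriv ρ (EuclideanSpace.single j 1) U) ξ‖ ^ 2 :=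
      integrable_finsetSum _ fun j _ => integrable_norm_sq_fourier (hFi j) (hFF j)
    refine (setIntegral_mono_on (hint.const_mul _).integrableOn hsumint.integrableOn hZm.compl
      fun ξ hξ => ?_).trans (setIntegral_le_integral hsumint
        (Filter.Eventually.of_forall fun ξ => Finset.sum_nonneg fun j _ => sq_nonneg _))
    simp only [fourier_nlDeriv hρ0 hρ hs (hej _) hL hUs, norm_mul, mul_pow]
    rw [← Finset.mul_sum, mul_comm]
    refine mul_le_mul_of_nonneg_left ?_ (sq_nonneg _)
    have hξδ : δ ≤ |radialSymbol ρ e ‖ξ‖| := not_lt.1 hξ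
    have hξ0 : ξ ≠ 0 := by
      rintro rfl
      rw [norm_zero, radialSymbol_zero, abs_zero] at hξδ
      linarith
    refine le_trans ?_ (sq_radialSymbol_le_sum hρ0 hρ hrad he hξ0)
    rw [← sq_abs (radialSymbol _ _ _)]
    gcongr
  rw [integral_finsetSum _ fun j _ => integrable_norm_sq_fourier (hFi j) (hFF j),
    integral_const_mul] at hlow
  simp only [integral_norm_sq_fourier_of_continuous (continuous_nlDeriv hρ0 hρ (hej _) hL)
    (hFi _) (hFF _)] at hlow
  refine le_trans ?_ hlow
  have : A / 2 ≤ ∫ ξ in Zᶜ, ‖𝓕 U ξ‖ ^ 2 := by linarith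
  calc δ ^ 2 / 2 * A = δ ^ 2 * (A / 2) := by ring
    _ ≤ _ := by gcongr

open scoped FourierTransform in
theorem fourier_half_add {f g : Eu n → ℂ} (hf : Integrable f) (hg : Integrable g) (ξ : Eu n) :
    𝓕 (fun x => (1 / 2 : ℂ) * (f x + g x)) ξ = (1 / 2 : ℂ) * (𝓕 f ξ + 𝓕 g ξ) := by
  simp only [Real.fourier_eq]
  rw [← integral_add ((Real.fourierIntegral_convergent_iff ξ).2 hf)
    ((Real.fourierIntegral_convergent_iff ξ).2 hg), ← integral_const_mul]
  refine integral_congr_ae (Filter.Eventually.of_forall fun x => ?_)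
  simp only [Circle.smul_def, smul_eq_mul]
  ring

theorem frobInner_nlGradM (ρ : Eu n → ℝ) (v : Eu n → Eu n) (x : Eu n) :
    frobInner (nlGradM ρ v x) (nlGradM ρ v x) =
      ∑ i, ∑ j, ‖nlDeriv ρ (EuclideanSpace.single j 1) (fun y => (v y i : ℂ)) x‖ ^ 2 := by
  simp only [frobInner, ← ofReal_nlGradM, Complex.norm_real, Real.norm_eq_abs, sq_abs]
  simp only [sq]

theorem frobInner_symPart_nlGradM (ρ : Eu n → ℝ) (v : Eu n → Eu n) (x : Eu n) :
    frobInner (symPart (nlGradM ρ v x)) (symPart (nlGradM ρ v x)) =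
      ∑ i, ∑ j, ‖(1 / 2 : ℂ) *
        (nlDeriv ρ (EuclideanSpace.single j 1) (fun y => (v y i : ℂ)) x +
          nlDeriv ρ (EuclideanSpace.single i 1) (fun y => (v y j : ℂ)) x)‖ ^ 2 := by
  simp only [frobInner, ← ofReal_nlGradM]
  refine Finset.sum_congr rfl fun i _ => Finset.sum_congr rfl fun j _ => ?_
  have : (1 / 2 : ℂ) * ((nlGradM ρ v x i j : ℂ) + (nlGradM ρ v x j i : ℂ)) =
      ((symPart (nlGradM ρ v x) i j : ℝ) : ℂ) := by
    simp [symPart]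
  rw [this, Complex.norm_real, Real.norm_eq_abs, sq_abs, sq]

theorem contDiff_ofReal_apply {v : Eu n → Eu n} (hv : ContDiff ℝ (⊤ : ℕ∞) v) (i : Fin n) :
    ContDiff ℝ (⊤ : ℕ∞) fun y => (v y i : ℂ) :=
  Complex.ofRealCLM.contDiff.comp ((EuclideanSpace.proj (𝕜 := ℝ) i).contDiff.comp hv)

theorem support_ofReal_apply_subset (v : Eu n → Eu n) (i : Fin n) :
    Function.support (fun y => (v y i : ℂ)) ⊆ Function.support v := by
  intro y hy h
  exact hy (by simp [h])

theorem continuous_nlGradM {ρ : Eu n → ℝ} (hρ0 : ∀ x, 0 ≤ ρ x) (hρ : Integrable ρ)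
    {v : Eu n → Eu n} (hv : ContDiff ℝ (⊤ : ℕ∞) v) (hvs : HasCompactSupport v) :
    Continuous (nlGradM ρ v) := by
  refine continuous_matrix fun i j => ?_
  obtain ⟨L, hL⟩ := (contDiff_ofReal_apply hv i).lipschitzWith_of_hasCompactSupport
    (hvs.mono (support_ofReal_apply_subset v i)) (by simp)
  refine (Complex.continuous_re.comp (continuous_nlDeriv hρ0 hρ
    (e := EuclideanSpace.single j 1) (by simp) hL)).congr fun x => ?_
  simp [← ofReal_nlGradM]

theorem hasCompactSupport_nlGradM {ρ : Eu n → ℝ} (hs : HasCompactSupport ρ)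
    {v : Eu n → Eu n} (hvs : HasCompactSupport v) : HasCompactSupport (nlGradM ρ v) := by
  have h (i : Fin n) := fun j : Fin n =>
    hasCompactSupport_nlDeriv hs (EuclideanSpace.single j 1)
      (hvs.mono (support_ofReal_apply_subset v i))
  refine HasCompactSupport.intro
    (isCompact_iUnion fun i => isCompact_iUnion fun j => (h i j).isCompact) fun x hx => ?_
  ext i j
  simp only [mem_iUnion, not_exists] at hx
  have := image_eq_zero_of_notMem_tsupport (hx i j)
  rw [← ofReal_nlGradM] at this
  exact_mod_cast this

open scoped FourierTransform in
theorem integral_sum_norm_sq_fourier {H : Fin n → Fin n → Eu n → ℂ}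
    (hHc : ∀ i j, Continuous (H i j)) (hHs : ∀ i j, HasCompactSupport (H i j))
    (hHF : ∀ i j, Integrable (𝓕 (H i j))) :
    ∫ x, ∑ i, ∑ j, ‖H i j x‖ ^ 2 = ∫ ξ, ∑ i, ∑ j, ‖𝓕 (H i j) ξ‖ ^ 2 := by
  have hHi (i j : Fin n) : Integrable (H i j) :=
    (hHc i j).integrable_of_hasCompactSupport (hHs i j)
  have h1 (i j : Fin n) : Integrable fun x => ‖H i j x‖ ^ 2 :=
    (hHc i j).integrable_norm_sq_of_hasCompactSupport (hHs i j)
  have h2 (i j : Fin n) := integrable_norm_sq_fourier (hHi i j) (hHF i j)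
  rw [integral_finsetSum _ fun i _ => integrable_finsetSum _ fun j _ => h1 i j,
    integral_finsetSum _ fun i _ => integrable_finsetSum _ fun j _ => h2 i j]
  refine Finset.sum_congr rfl fun i _ => ?_
  rw [integral_finsetSum _ fun j _ => h1 i j, integral_finsetSum _ fun j _ => h2 i j]
  exact Finset.sum_congr rfl fun j _ =>
    (integral_norm_sq_fourier_of_continuous (hHc i j) (hHi i j) (hHF i j)).symm

open scoped FourierTransform in
/-- Nonlocal Korn inequality, by Plancherel and the symbol of the nonlocal gradient. -/
theorem nonlocal_korn {ρ : Eu n → ℝ} (hρ0 : ∀ x, 0 ≤ ρ x)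
    (hρ : Integrable ρ) (hs : HasCompactSupport ρ) {v : Eu n → Eu n}
    (hv : ContDiff ℝ (⊤ : ℕ∞) v) (hvs : HasCompactSupport v) :
    (1 / 2 : ℝ) * ∫ x, frobInner (nlGradM ρ v x) (nlGradM ρ v x) ≤
      ∫ x, frobInner (symPart (nlGradM ρ v x)) (symPart (nlGradM ρ v x)) := by
  set U : Fin n → Eu n → ℂ := fun i y => (v y i : ℂ) with hUdef
  set F : Fin n → Fin n → Eu n → ℂ :=
    fun i j => nlDeriv ρ (EuclideanSpace.single j 1) (U i) with hFdef
  set G : Fin n → Fin n → Eu n → ℂ := fun i j x => (1 / 2 : ℂ) * (F i j x + F j i x) with hGdef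
  have hej (j : Fin n) : ‖(EuclideanSpace.single j 1 : Eu n)‖ = 1 := by simp
  have hU (i : Fin n) : ContDiff ℝ (⊤ : ℕ∞) (U i) := contDiff_ofReal_apply hv i
  have hUs (i : Fin n) : HasCompactSupport (U i) := hvs.mono (support_ofReal_apply_subset v i)
  choose L hL using fun i => (hU i).lipschitzWith_of_hasCompactSupport (hUs i) (by simp)
  have hFc (i j : Fin n) : Continuous (F i j) := continuous_nlDeriv hρ0 hρ (hej j) (hL i)
  have hFs (i j : Fin n) : HasCompactSupport (F i j) := hasCompactSupport_nlDeriv hs _ (hUs i)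
  have hFi (i j : Fin n) : Integrable (F i j) :=
    (hFc i j).integrable_of_hasCompactSupport (hFs i j)
  have hFF (i j : Fin n) : Integrable (𝓕 (F i j)) :=
    integrable_fourier_nlDeriv hρ0 hρ hs (hej j) (hU i) (hUs i)
  have hF (i j : Fin n) (ξ : Eu n) : 𝓕 (F i j) ξ =
      𝓕 (U i) ξ * nlSymbol ρ (EuclideanSpace.single j 1) ξ :=
    fourier_nlDeriv hρ0 hρ hs (hej j) (hL i) (hUs i) ξ
  have hGc (i j : Fin n) : Continuous (G i j) := ((hFc i j).add (hFc j i)).const_mul _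
  have hGi (i j : Fin n) : Integrable (G i j) := ((hFi i j).add (hFi j i)).const_mul _
  have hGs (i j : Fin n) : HasCompactSupport (G i j) := ((hFs i j).add (hFs j i)).mul_left
  have hG (i j : Fin n) : 𝓕 (G i j) = fun ξ => (1 / 2 : ℂ) * (𝓕 (F i j) ξ + 𝓕 (F j i) ξ) :=
    funext fun ξ => fourier_half_add (hFi i j) (hFi j i) ξ
  have hGF (i j : Fin n) : Integrable (𝓕 (G i j)) := by
    rw [hG]; exact ((hFF i j).add (hFF j i)).const_mul _
  simp only [frobInner_nlGradM, frobInner_symPart_nlGradM]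
  change (1 / 2 : ℝ) * ∫ x, ∑ i, ∑ j, ‖F i j x‖ ^ 2 ≤ ∫ x, ∑ i, ∑ j, ‖G i j x‖ ^ 2
  rw [integral_sum_norm_sq_fourier hFc hFs hFF, integral_sum_norm_sq_fourier hGc hGs hGF, ← integral_const_mul]
  refine integral_mono ((integrable_finsetSum _ fun i _ => integrable_finsetSum _ fun j _ =>
    integrable_norm_sq_fourier (hFi i j) (hFF i j)).const_mul _)
    (integrable_finsetSum _ fun i _ => integrable_finsetSum _ fun j _ =>
    integrable_norm_sq_fourier (hGi i j) (hGF i j)) fun ξ => ?_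
  simp only [hG, hF]
  exact sum_norm_sq_le_sum_norm_sq_symmetrized (fun i => 𝓕 (U i) ξ)
    fun j => nlSymbol ρ (EuclideanSpace.single j 1) ξ

theorem symPart_isSymm (M : Matrix (Fin n) (Fin n) ℝ) : (symPart M).IsSymm := by
  rw [Matrix.IsSymm, symPart, Matrix.transpose_smul, Matrix.transpose_add,
    Matrix.transpose_transpose, add_comm]

theorem continuous_symPart : Continuous (symPart (n := n)) := by
  unfold symPart
  fun_prop

theorem integrable_frobInner {E : Eu n → Matrix (Fin n) (Fin n) ℝ} (hE : Continuous E)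
    (hEs : HasCompactSupport E)
    {f g : Matrix (Fin n) (Fin n) ℝ → Matrix (Fin n) (Fin n) ℝ} (hf : Continuous f)
    (hg : Continuous g) (hg0 : g 0 = 0) :
    Integrable fun x => frobInner (f (E x)) (g (E x)) :=
  (continuous_frobInner (hf.comp hE) (hg.comp hE)).integrable_of_hasCompactSupport
    (hEs.comp_left (g := fun M => frobInner (f M) (g M)) (by simp [hg0, frobInner]))

theorem integral_coercive {C : Matrix (Fin n) (Fin n) ℝ →ₗ[ℝ] Matrix (Fin n) (Fin n) ℝ} {c : ℝ}
    (hC : ∀ M : Matrix (Fin n) (Fin n) ℝ, M.IsSymm → c * frobInner M M ≤ frobInner (C M) M)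
    {E : Eu n → Matrix (Fin n) (Fin n) ℝ} (hE : Continuous E) (hEs : HasCompactSupport E) :
    c * ∫ x, frobInner (symPart (E x)) (symPart (E x)) ≤
      ∫ x, frobInner (C (symPart (E x))) (symPart (E x)) := by
  have hsym0 : symPart (0 : Matrix (Fin n) (Fin n) ℝ) = 0 := by simp [symPart]
  have hCcont : Continuous C := C.continuous_of_finiteDimensional
  have hi₁ := integrable_frobInner hE hEs continuous_symPart continuous_symPart hsym0
  have hi₂ := integrable_frobInner hE hEs (hCcont.comp continuous_symPart) continuous_symPart hsym0
  rw [← integral_const_mul]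
  exact integral_mono (hi₁.const_mul c) hi₂ fun x => hC _ (symPart_isSymm _)

variable (n)

/-- coercivity of the bilinear form of nonlocal linear elasticity. -/
theorem stmt0 (hn : 0 < n) (ρ : Eu n → ℝ) (ρb : ℝ → ℝ) (ε : ℝ)
    (h0 : IsKernelH0 n ρ ρb ε) (h1 : IsKernelH1 n ρb ε) (h2 : IsKernelH2 n ρb ε)
    (h3 : IsKernelH3 n ρb ε) (h4 : IsKernelH4 n ρb ε) (hsupp : HasCompactSupport ρ)
    (Ω : Set (Eu n)) (hΩo : IsOpen Ω) (hΩb : Bornology.IsBounded Ω)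
    (C : Matrix (Fin n) (Fin n) ℝ →ₗ[ℝ] Matrix (Fin n) (Fin n) ℝ)
    (hCsym : ∀ M : Matrix (Fin n) (Fin n) ℝ, M.IsSymm → (C M).IsSymm)
    (hCpos : ∀ M : Matrix (Fin n) (Fin n) ℝ, M.IsSymm → M ≠ 0 → 0 < frobInner (C M) M) :
    ∃ c > (0 : ℝ), ∀ v : Eu n → Eu n,
      ContDiff ℝ (⊤ : ℕ∞) v → HasCompactSupport v → tsupport v ⊆ Ω →
      c * ((∫ x in Ω, ‖v x‖ ^ 2) + ∫ x, frobInner (nlGradM ρ v x) (nlGradM ρ v x)) ≤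
        ∫ x, frobInner (C (symPart (nlGradM ρ v x))) (symPart (nlGradM ρ v x)) := by
  obtain ⟨hρ0, hrad, hloc, -, -, -⟩ := id h0
  have hρ : Integrable ρ := LocallyIntegrable.integrable_of_compactSupport hloc hsupp
  have he : ‖(EuclideanSpace.single ⟨0, hn⟩ 1 : Eu n)‖ = 1 := by simp
  obtain ⟨κ, hκ, T, -, hT⟩ := exists_le_radialSymbol hn h0 h1 h2 h3 hρ he
  have hΩ : volume Ω ≠ ∞ := hΩb.measure_lt_top.ne
  have hη : 0 < ENNReal.ofReal (1 / (2 * (volume.real Ω + 1))) := by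
    have : 0 ≤ volume.real Ω := measureReal_nonneg
    exact ENNReal.ofReal_pos.2 (by positivity)
  obtain ⟨δ, hδ, hZ⟩ := exists_volume_radialSymbol_lt_le hn hρ0 hρ hsupp he hκ hT hη
  obtain ⟨c₀, hc₀, hcoer⟩ := exists_coercive C hCpos
  refine ⟨c₀ / 2 / (2 / δ ^ 2 + 1), by positivity, fun v hv hvs hvΩ => ?_⟩
  have hU (i : Fin n) := contDiff_ofReal_apply hv i
  have hUs (i : Fin n) : HasCompactSupport fun y => (v y i : ℂ) :=
    hvs.mono (support_ofReal_apply_subset v i)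
  have hpoin (i : Fin n) := nonlocal_poincare hρ0 hρ hsupp hrad he hΩ hδ hZ (hU i) (hUs i)
    ((closure_mono (support_ofReal_apply_subset v i)).trans hvΩ)
  have hv2 : ∫ x in Ω, ‖v x‖ ^ 2 = ∑ i, ∫ x, ‖(v x i : ℂ)‖ ^ 2 := by
    rw [setIntegral_eq_integral_of_forall_compl_eq_zero fun x hx => by
        rw [image_eq_zero_of_notMem_tsupport fun h => hx (hvΩ h)]; simp,
      ← integral_finsetSum _ fun i _ =>
        (hU i).continuous.integrable_norm_sq_of_hasCompactSupport (hUs i)]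
    refine integral_congr_ae (Filter.Eventually.of_forall fun x => ?_)
    simp only [EuclideanSpace.real_norm_sq_eq, Complex.norm_real, Real.norm_eq_abs, sq_abs]
  have hgrad : ∫ x, frobInner (nlGradM ρ v x) (nlGradM ρ v x) = ∑ i, ∑ j,
      ∫ x, ‖nlDeriv ρ (EuclideanSpace.single j 1) (fun y => (v y i : ℂ)) x‖ ^ 2 := by
    have hint (i j : Fin n) : Integrable fun x =>
        ‖nlDeriv ρ (EuclideanSpace.single j 1) (fun y => (v y i : ℂ)) x‖ ^ 2 := by
      obtain ⟨L, hL⟩ := (hU i).lipschitzWith_of_hasCompactSupport (hUs i) (by simp)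
      exact (continuous_nlDeriv hρ0 hρ (by simp) hL).integrable_norm_sq_of_hasCompactSupport
        (hasCompactSupport_nlDeriv hsupp _ (hUs i))
    simp only [frobInner_nlGradM]
    rw [integral_finsetSum _ fun i _ => integrable_finsetSum _ fun j _ => hint i j]
    exact Finset.sum_congr rfl fun i _ => integral_finsetSum _ fun j _ => hint i j
  have hkorn := nonlocal_korn hρ0 hρ hsupp hv hvs
  have hlow := integral_coercive hcoer (continuous_nlGradM hρ0 hρ hv hvs)
    (hasCompactSupport_nlGradM hsupp hvs)
  set P := ∫ x in Ω, ‖v x‖ ^ 2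
  set D := ∫ x, frobInner (nlGradM ρ v x) (nlGradM ρ v x)
  have hPD : δ ^ 2 / 2 * P ≤ D := by
    rw [hv2, hgrad, Finset.mul_sum]
    exact Finset.sum_le_sum fun i _ => hpoin i
  have hPD' : P ≤ 2 / δ ^ 2 * D := by
    calc P = 2 / δ ^ 2 * (δ ^ 2 / 2 * P) := by field_simp
      _ ≤ _ := by gcongr
  calc c₀ / 2 / (2 / δ ^ 2 + 1) * (P + D)
      ≤ c₀ / 2 / (2 / δ ^ 2 + 1) * (2 / δ ^ 2 * D + D) := by gcongr
    _ = c₀ * (1 / 2 * D) := by field_simp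
    _ ≤ _ := (mul_le_mul_of_nonneg_left hkorn hc₀.le).trans hlow
end
end

section
/- Let ρ satisfy (H0) and have compact support, and set A_ρ(x, y) := (Q_ρ * Q_ρ)(x − y). Let C : ℝ^{n×n} → ℝ^{n×n} be any linear map. Then for all v, w ∈ C_c^∞(ℝ^n; ℝ^n), ∫_{ℝ^n} ∫_{ℝ^n} A_ρ(x, y) C[(Dv(x))_sym] : (Dw(y))_sym dx dy = ∫_{ℝ^n} C[(D_ρ v(x))_sym] : (D_ρ w(x))_sym dx, where Dv denotes the classical Jacobian matrix. (Equality of the Eringen bilinear form with kernel Q_ρ * Q_ρ and the bilinear form of nonlocal linear elasticity.) -/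
open MeasureTheory Metric Set Matrix
open scoped ENNReal InnerProductSpace

noncomputable section

variable {n : ℕ}

/-! ### Radial functions -/

lemma hasDerivAt_norm_add_smul {E : Type*} [NormedAddCommGroup E] [InnerProductSpace ℝ E]
    {z : E} (hz : z ≠ 0) (v : E) :
    HasDerivAt (fun t : ℝ => ‖z + t • v‖) (⟪z, v⟫_ℝ / ‖z‖) 0 := by
  have h1 : HasDerivAt (fun t : ℝ => z + t • v) v 0 := by
    simpa using ((hasDerivAt_id (0 : ℝ)).smul_const v).const_add z
  have h2 := h1.norm_sq.sqrt (by simpa using hz)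
  simp only [zero_smul, add_zero, Real.sqrt_sq (norm_nonneg _)] at h2
  convert h2 using 1
  field_simp

lemma lipschitzWith_integral_Ioi {g : ℝ → ℝ} {M : NNReal} (hg : Integrable g)
    (hM : ∀ t, ‖g t‖ ≤ M) : LipschitzWith M (fun r => ∫ t in Ioi r, g t) := by
  refine LipschitzWith.of_dist_le_mul fun a b => ?_
  rw [Real.dist_eq, intervalIntegral.integral_Ioi_sub_Ioi' hg.integrableOn hg.integrableOn,
    Real.dist_eq, abs_sub_comm]
  exact intervalIntegral.norm_integral_le_of_norm_le_const fun t _ => hM t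

lemma ae_hasDerivAt_integral_Ioi {g : ℝ → ℝ} (hg : Integrable g) :
    ∀ᵐ r, HasDerivAt (fun r => ∫ t in Ioi r, g t) (-g r) r := by
  filter_upwards [LocallyIntegrable.ae_hasDerivAt_integral hg.locallyIntegrable] with r hr
  have h := (hr 0).const_sub (∫ t in Ioi 0, g t)
  refine h.congr_of_eventuallyEq (.of_forall fun s => ?_)
  simp only
  rw [← intervalIntegral.integral_Ioi_sub_Ioi' hg.integrableOn hg.integrableOn]
  ring

section Radial

variable {E : Type*} [NormedAddCommGroup E] [InnerProductSpace ℝ E] [FiniteDimensional ℝ E]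
  [MeasurableSpace E] [BorelSpace E]

/-- The norm pulls back Lebesgue null sets of `ℝ` to null sets. -/
lemma ae_norm_of_ae [Nontrivial E] {p : ℝ → Prop} (h : ∀ᵐ t : ℝ, p t) :
    ∀ᵐ z : E, p ‖z‖ := by
  set N : Set ℝ := toMeasurable volume {t | ¬ p t}
  have hN : volume N = 0 := by rw [measure_toMeasurable]; exact h
  have hNm : MeasurableSet N := measurableSet_toMeasurable _ _
  set f : ℝ → ℝ := N.indicator fun _ => 1
  have hf : (fun y : ℝ => y ^ (Module.finrank ℝ E - 1) • f y) =ᵐ[volume.restrict (Ioi 0)] 0 := by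
    refine ae_restrict_of_ae ?_
    filter_upwards [compl_mem_ae_iff.2 hN] with t ht
    simp [f, indicator_of_notMem ht]
  have hintegrable : Integrable (fun z : E => f ‖z‖) volume :=
    (integrable_fun_norm_addHaar volume).2 ((integrable_zero _ _ _).congr hf.symm)
  have hzero : ∫ z : E, f ‖z‖ = 0 := by
    rw [integral_fun_norm_addHaar, integral_congr_ae hf]
    simp
  have hnonneg : 0 ≤ fun z : E => f ‖z‖ := fun z => indicator_nonneg (fun _ _ => zero_le_one) _
  filter_upwards [(integral_eq_zero_iff_of_nonneg hnonneg hintegrable).1 hzero] with z hz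
  by_contra hp
  have hmem : ‖z‖ ∈ N := subset_toMeasurable _ _ hp
  simp [f, indicator_of_mem hmem] at hz

/-- Integration by parts against the radial potential `z ↦ ∫_{|z|}^∞ g` of a bounded compactly
supported density `g`. -/
lemma integral_lineDeriv_mul_potential [Nontrivial E] {g : ℝ → ℝ} {M : NNReal} {R : ℝ}
    (hg : Integrable g) (hM : ∀ t, ‖g t‖ ≤ M) (hR : ∀ t, R < t → g t = 0)
    {φ : E → ℝ} {K : NNReal} (hφ : LipschitzWith K φ) (v : E) :
    ∫ z, lineDeriv ℝ φ z v * (∫ t in Ioi ‖z‖, g t) =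
      ∫ z, g ‖z‖ * (⟪z, v⟫_ℝ / ‖z‖) * φ z := by
  have hlip : LipschitzWith (M * 1) (fun z : E => ∫ t in Ioi ‖z‖, g t) :=
    (lipschitzWith_integral_Ioi hg hM).comp lipschitzWith_one_norm
  have hcs : HasCompactSupport (fun z : E => ∫ t in Ioi ‖z‖, g t) := by
    refine HasCompactSupport.intro (isCompact_closedBall (0 : E) R) fun z hz => ?_
    rw [mem_closedBall_zero_iff, not_le] at hz
    exact setIntegral_eq_zero_of_forall_eq_zero fun t ht => hR t (hz.trans ht)
  rw [LipschitzWith.integral_lineDeriv_mul_eq hφ hlip hcs]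
  refine integral_congr_ae ?_
  have hne : ∀ᵐ z : E, z ≠ 0 := by simp [ae_iff]
  filter_upwards [ae_norm_of_ae (E := E) (ae_hasDerivAt_integral_Ioi hg), hne] with z hz hz0
  have h1 := hasDerivAt_norm_add_smul hz0 (-v)
  have h2 : HasDerivAt (fun r => ∫ t in Ioi r, g t) (-g ‖z‖) ‖z + (0 : ℝ) • (-v)‖ := by
    simpa using hz
  have h3 : HasLineDerivAt ℝ (fun z : E => ∫ t in Ioi ‖z‖, g t)
      (-g ‖z‖ * (⟪z, -v⟫_ℝ / ‖z‖)) z (-v) := by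
    have h4 := HasDerivAt.comp (0 : ℝ) h2 h1
    exact h4
  simp only [h3.lineDeriv, inner_neg_right]
  ring

variable {g : ℝ → ℝ}

lemma integrableOn_pow_mul_of_integrable_radial [Nontrivial E]
    (hgi : Integrable fun z : E => g ‖z‖ * ‖z‖) :
    IntegrableOn (fun t => t ^ Module.finrank ℝ E * g t) (Ioi 0) := by
  have h := (integrable_fun_norm_addHaar (E := E) volume (f := fun t => g t * t)).1 hgi
  refine h.congr_fun (fun t _ => ?_) measurableSet_Ioi
  obtain ⟨d, hd⟩ := Nat.exists_eq_succ_of_ne_zero (Module.finrank_pos (R := ℝ) (M := E)).ne'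
  simp only [hd, smul_eq_mul, Nat.succ_eq_add_one, Nat.add_sub_cancel]
  ring

lemma aestronglyMeasurable_of_integrable_radial [Nontrivial E]
    (hgi : Integrable fun z : E => g ‖z‖ * ‖z‖) (hneg : ∀ t ≤ 0, g t = 0) :
    AEStronglyMeasurable g volume := by
  have h : AEStronglyMeasurable
      (fun t => (t ^ Module.finrank ℝ E)⁻¹ * (t ^ Module.finrank ℝ E * g t))
      (volume.restrict (Ioi 0)) :=
    (by fun_prop : Measurable fun t : ℝ => (t ^ Module.finrank ℝ E)⁻¹).aestronglyMeasurable.mul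
      (integrableOn_pow_mul_of_integrable_radial hgi).aestronglyMeasurable
  have hpos : AEStronglyMeasurable g (volume.restrict (Ioi 0)) := by
    refine h.congr ((ae_restrict_mem measurableSet_Ioi).mono fun t ht => ?_)
    have : t ≠ 0 := (mem_Ioi.1 ht).ne'
    simp [this]
  rw [← aestronglyMeasurable_indicator_iff measurableSet_Ioi] at hpos
  refine hpos.congr (.of_forall fun t => ?_)
  by_cases ht : t ∈ Ioi (0 : ℝ)
  · simp [ht]
  · simp [ht, hneg t (not_lt.1 ht)]

lemma integrableOn_Ioi_of_integrable_radial [Nontrivial E]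
    (hgi : Integrable fun z : E => g ‖z‖ * ‖z‖) (hneg : ∀ t ≤ 0, g t = 0) {r : ℝ} (hr : 0 < r) :
    IntegrableOn g (Ioi r) := by
  have h := ((integrableOn_pow_mul_of_integrable_radial hgi).mono_set
    (Ioi_subset_Ioi hr.le)).norm.const_mul (r ^ Module.finrank ℝ E)⁻¹
  refine Integrable.mono' h (aestronglyMeasurable_of_integrable_radial hgi hneg).restrict
    ((ae_restrict_mem measurableSet_Ioi).mono fun t ht => ?_)
  have ht' : r < t := ht
  have hpow : r ^ Module.finrank ℝ E ≤ t ^ Module.finrank ℝ E := by gcongr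
  have hp : 0 < r ^ Module.finrank ℝ E := by positivity
  rw [norm_mul, Real.norm_of_nonneg (hp.le.trans hpow), inv_mul_eq_div, le_div_iff₀ hp, mul_comm]
  gcongr

/-- The radial potential `z ↦ ∫_{|z|}^∞ g` is integrable when `z ↦ |z| g(|z|)` is. -/
lemma integrable_potential [Nontrivial E]
    (hgi : Integrable fun z : E => g ‖z‖ * ‖z‖) (hneg : ∀ t ≤ 0, g t = 0) :
    Integrable fun z : E => ∫ t in Ioi ‖z‖, g t := by
  have hS : MeasurableSet {p : E × ℝ | ‖p.1‖ < p.2} :=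
    measurableSet_lt (by fun_prop) (by fun_prop)
  have hmeas : AEStronglyMeasurable
      ({p : E × ℝ | ‖p.1‖ < p.2}.indicator fun p => g p.2)
      ((volume : Measure E).prod (volume : Measure ℝ)) :=
    (aestronglyMeasurable_of_integrable_radial hgi hneg).comp_snd.indicator hS
  have hslice : ∀ t : ℝ, (fun z : E => {p : E × ℝ | ‖p.1‖ < p.2}.indicator (fun p => g p.2) (z, t))
      = (ball (0 : E) t).indicator fun _ => g t := by
    intro t
    funext z
    by_cases h : ‖z‖ < t
    · rw [indicator_of_mem (mem_ball_zero_iff.2 h), indicator_of_mem (by exact h)]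
    · rw [indicator_of_notMem (mt mem_ball_zero_iff.1 h), indicator_of_notMem (by exact h)]
  have hintegrable : Integrable ({p : E × ℝ | ‖p.1‖ < p.2}.indicator fun p => g p.2)
      ((volume : Measure E).prod (volume : Measure ℝ)) := by
    rw [integrable_prod_iff' hmeas]
    refine ⟨.of_forall fun t => ?_, ?_⟩
    · rw [hslice t, integrable_indicator_iff measurableSet_ball]
      exact integrableOn_const measure_ball_lt_top.ne
    · have hnorm : ∀ t : ℝ,
          ∫ z : E, ‖{p : E × ℝ | ‖p.1‖ < p.2}.indicator (fun p => g p.2) (z, t)‖ =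
          (Ioi (0 : ℝ)).indicator (fun t => (volume : Measure E).real (ball 0 1) *
            ‖t ^ Module.finrank ℝ E * g t‖) t := by
        intro t
        have h1 : ∀ z : E, ‖{p : E × ℝ | ‖p.1‖ < p.2}.indicator (fun p => g p.2) (z, t)‖ =
            (ball (0 : E) t).indicator (fun _ => ‖g t‖) z := by
          intro z
          rw [congrFun (hslice t) z, norm_indicator_eq_indicator_norm]
        simp_rw [h1]
        rw [integral_indicator measurableSet_ball, setIntegral_const, smul_eq_mul]
        by_cases ht : 0 < t
        · rw [indicator_of_mem (mem_Ioi.2 ht), norm_mul,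
            Real.norm_of_nonneg (by positivity : 0 ≤ t ^ Module.finrank ℝ E), measureReal_def,
            Measure.addHaar_ball_of_pos _ _ ht, ENNReal.toReal_mul,
            ENNReal.toReal_ofReal (by positivity), measureReal_def]
          ring
        · rw [indicator_of_notMem (by simpa using ht), hneg t (not_lt.1 ht)]
          simp
      simp_rw [hnorm]
      rw [integrable_indicator_iff measurableSet_Ioi]
      exact (integrableOn_pow_mul_of_integrable_radial hgi).norm.const_mul _
  refine hintegrable.integral_prod_left.congr (.of_forall fun z => ?_)
  simp only
  rw [← integral_indicator measurableSet_Ioi]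
  congr 1

/-- Integration by parts against the radial potential of a nonnegative, possibly singular
density. -/
lemma integral_lineDeriv_mul_potential_of_integrable_radial [Nontrivial E] {R : ℝ}
    (hgi : Integrable fun z : E => g ‖z‖ * ‖z‖) (hneg : ∀ t ≤ 0, g t = 0) (hg0 : ∀ t, 0 ≤ g t)
    (hR : ∀ t, R < t → g t = 0) {φ : E → ℝ} {K : NNReal} (hφ : LipschitzWith K φ)
    (hφ0 : φ 0 = 0) (v : E) :
    ∫ z, lineDeriv ℝ φ z v * (∫ t in Ioi ‖z‖, g t) =
      ∫ z, g ‖z‖ * (⟪z, v⟫_ℝ / ‖z‖) * φ z := by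
  have hgm := aestronglyMeasurable_of_integrable_radial hgi hneg
  have hne : ∀ᵐ z : E, z ≠ 0 := by simp [ae_iff]
  have htrunc : ∀ k : ℕ, ∀ t, ‖min (g t) k‖ ≤ g t := fun k t => by
    rw [Real.norm_of_nonneg (le_min (hg0 t) k.cast_nonneg)]
    exact min_le_left _ _
  have htend : ∀ t, Filter.Tendsto (fun k : ℕ => min (g t) k) Filter.atTop (nhds (g t)) := by
    intro t
    obtain ⟨N, hN⟩ := exists_nat_ge (g t)
    refine tendsto_const_nhds.congr' ?_
    filter_upwards [Filter.eventually_ge_atTop N] with k hk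
    exact (min_eq_left (hN.trans (by exact_mod_cast hk))).symm
  have htm : ∀ k : ℕ, AEStronglyMeasurable (fun t => min (g t) (k : ℝ)) volume := fun k =>
    (hgm.aemeasurable.min aemeasurable_const).aestronglyMeasurable
  have hti : ∀ k : ℕ, Integrable (fun t => min (g t) (k : ℝ)) := by
    intro k
    have hb : Integrable ((Icc (0 : ℝ) R).indicator fun _ => (k : ℝ)) := by
      rw [integrable_indicator_iff measurableSet_Icc]
      exact integrableOn_const measure_Icc_lt_top.ne
    refine Integrable.mono' hb (htm k) (.of_forall fun t => ?_)
    by_cases ht : t ∈ Icc (0 : ℝ) R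
    · rw [indicator_of_mem ht, Real.norm_of_nonneg (le_min (hg0 t) k.cast_nonneg)]
      exact min_le_right _ _
    · have : g t = 0 := by
        by_cases h : t ≤ 0
        · exact hneg t h
        · exact hR t (by by_contra hRt; exact ht ⟨(not_le.1 h).le, not_lt.1 hRt⟩)
      simp [indicator_of_notMem ht, this]
  have hmeasφ : Measurable fun z => lineDeriv ℝ φ z v := measurable_lineDeriv hφ.continuous
  have hIBP : ∀ k : ℕ, ∫ z, lineDeriv ℝ φ z v * (∫ t in Ioi ‖z‖, min (g t) (k : ℝ)) =
      ∫ z, min (g ‖z‖) (k : ℝ) * (⟪z, v⟫_ℝ / ‖z‖) * φ z := fun k =>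
    integral_lineDeriv_mul_potential (M := (k : NNReal)) (R := R) (hti k)
      (fun t => by
        rw [Real.norm_of_nonneg (le_min (hg0 t) k.cast_nonneg)]
        exact min_le_right _ _)
      (fun t ht => by simp [hR t ht]) hφ v
  have hleft : Filter.Tendsto
      (fun k : ℕ => ∫ z, lineDeriv ℝ φ z v * (∫ t in Ioi ‖z‖, min (g t) (k : ℝ))) Filter.atTop
      (nhds (∫ z, lineDeriv ℝ φ z v * (∫ t in Ioi ‖z‖, g t))) := by
    refine tendsto_integral_of_dominated_convergence
      (fun z => K * ‖v‖ * ∫ t in Ioi ‖z‖, g t) (fun k => ?_)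
      ((integrable_potential hgi hneg).const_mul _) (fun k => ?_) ?_
    · refine hmeasφ.aestronglyMeasurable.mul ?_
      refine ((lipschitzWith_integral_Ioi (M := (k : NNReal)) (hti k) fun t => ?_).continuous.comp
        continuous_norm).aestronglyMeasurable
      rw [Real.norm_of_nonneg (le_min (hg0 t) k.cast_nonneg)]
      exact min_le_right _ _
    · filter_upwards [hne] with z hz
      rw [norm_mul]
      refine mul_le_mul (norm_lineDeriv_le_of_lipschitz ℝ hφ) ?_ (norm_nonneg _) (by positivity)
      exact norm_integral_le_of_norm_le
        (integrableOn_Ioi_of_integrable_radial hgi hneg (norm_pos_iff.2 hz))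
        (.of_forall fun t => htrunc k t)
    · filter_upwards [hne] with z hz
      refine Filter.Tendsto.const_mul _ ?_
      exact tendsto_integral_of_dominated_convergence g (fun k => (htm k).restrict)
        (integrableOn_Ioi_of_integrable_radial hgi hneg (norm_pos_iff.2 hz))
        (fun k => .of_forall fun t => htrunc k t) (.of_forall fun t => htend t)
  have hright : Filter.Tendsto
      (fun k : ℕ => ∫ z, min (g ‖z‖) (k : ℝ) * (⟪z, v⟫_ℝ / ‖z‖) * φ z) Filter.atTop
      (nhds (∫ z, g ‖z‖ * (⟪z, v⟫_ℝ / ‖z‖) * φ z)) := by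
    refine tendsto_integral_of_dominated_convergence
      (fun z => (‖v‖ * K) * (g ‖z‖ * ‖z‖)) (fun k => ?_)
      (hgi.const_mul _) (fun k => .of_forall fun z => ?_) (.of_forall fun z => ?_)
    · have hm : AEStronglyMeasurable (fun z : E => g ‖z‖) volume := by
        refine ((hgi.aestronglyMeasurable.mul
          (by fun_prop : Measurable fun z : E => ‖z‖⁻¹).aestronglyMeasurable)).congr ?_
        filter_upwards [hne] with z hz
        have : ‖z‖ ≠ 0 := norm_ne_zero_iff.2 hz
        simp only [Pi.mul_apply]
        field_simp
      refine ((hm.aemeasurable.min aemeasurable_const).aestronglyMeasurable.mul ?_).mul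
        hφ.continuous.aestronglyMeasurable
      exact (by fun_prop : Measurable fun z : E => ⟪z, v⟫_ℝ / ‖z‖).aestronglyMeasurable
    · have h1 : ‖⟪z, v⟫_ℝ / ‖z‖‖ ≤ ‖v‖ := by
        rw [norm_div, norm_norm]
        refine div_le_of_le_mul₀ (norm_nonneg _) (norm_nonneg _) ?_
        rw [mul_comm]
        exact norm_inner_le_norm z v
      have h2 : ‖φ z‖ ≤ K * ‖z‖ := by
        simpa [hφ0] using hφ.dist_le_mul z 0
      rw [norm_mul, norm_mul]
      calc _ ≤ g ‖z‖ * ‖v‖ * (K * ‖z‖) := by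
            have := hg0 ‖z‖
            gcongr
            exact htrunc k _
        _ = _ := by ring
    · exact ((htend ‖z‖).mul_const _).mul_const _
  exact tendsto_nhds_unique (hleft.congr hIBP) hright

end Radial
/-! ### Convolutions with an even integrable kernel -/

section Convolution

variable {E : Type*} [NormedAddCommGroup E] [MeasurableSpace E] {μ : Measure E} {Q f g : E → ℝ}

lemma norm_integral_mul_sub_le {M : ℝ} (hQ : Integrable Q μ) (hM : ∀ x, ‖g x‖ ≤ M) (x : E) :
    ‖∫ z, Q z * g (x - z) ∂μ‖ ≤ ∫ z, ‖Q z‖ * M ∂μ :=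
  norm_integral_le_of_norm_le (hQ.norm.mul_const M) <| .of_forall fun z => by
    rw [norm_mul]
    exact mul_le_mul_of_nonneg_left (hM _) (norm_nonneg _)

variable [BorelSpace E]

lemma continuous_integral_mul_sub {M : ℝ} (hQ : Integrable Q μ) (hg : Continuous g)
    (hM : ∀ x, ‖g x‖ ≤ M) : Continuous fun x => ∫ z, Q z * g (x - z) ∂μ :=
  BddAbove.continuous_convolution_right_of_integrable (ContinuousLinearMap.mul ℝ ℝ)
    ⟨M, by rintro _ ⟨x, rfl⟩; exact hM x⟩ hQ hg

variable [NormedSpace ℝ E] [FiniteDimensional ℝ E] [μ.IsAddHaarMeasure]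

lemma integrable_integral_mul_sub (hQ : Integrable Q μ) (hf : Integrable f μ) :
    Integrable (fun x => ∫ z, Q z * f (x - z) ∂μ) μ :=
  hQ.integrable_convolution (ContinuousLinearMap.mul ℝ ℝ) hf

/-- Convolution with an even kernel is symmetric. -/
lemma integral_mul_conv_eq {M : ℝ} (hQ : Integrable Q μ) (hQe : ∀ z, Q (-z) = Q z)
    (hf : Integrable f μ) (hg : Continuous g) (hM : ∀ x, ‖g x‖ ≤ M) :
    ∫ x, f x * ∫ z, Q z * g (x - z) ∂μ ∂μ = ∫ x, (∫ z, Q z * f (x - z) ∂μ) * g x ∂μ := by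
  have h1 : Integrable (Function.uncurry fun x z => f x * (Q z * g (x - z))) (μ.prod μ) := by
    have := (hf.mul_prod hQ).mul_bdd (c := M) (g := fun p : E × E => g (p.1 - p.2))
      (by fun_prop : Continuous fun p : E × E => g (p.1 - p.2)).aestronglyMeasurable
      (.of_forall fun p => hM _)
    refine this.congr (.of_forall fun p => ?_)
    simp only [Function.uncurry]
    ring
  have h2 : Integrable (Function.uncurry fun x z => Q z * f (x - z) * g x) (μ.prod μ) := by
    exact (hQ.convolution_integrand (ContinuousLinearMap.mul ℝ ℝ) hf).mul_bdd (c := M)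
      (g := fun p : E × E => g p.1)
      (by fun_prop : Continuous fun p : E × E => g p.1).aestronglyMeasurable
      (.of_forall fun p => hM _)
  simp_rw [← integral_const_mul, ← integral_mul_const]
  rw [integral_integral_swap h1, integral_integral_swap h2, ← integral_neg_eq_self]
  congr 1
  funext z
  rw [← integral_sub_right_eq_self _ z]
  congr 1
  funext x
  rw [hQe, sub_neg_eq_add, sub_add_cancel]
  ring

/-- Associativity of convolution for an integrable kernel and a bounded continuous function. -/
lemma integral_conv_mul_eq {M : ℝ} (hQ : Integrable Q μ) (hg : Continuous g)
    (hM : ∀ x, ‖g x‖ ≤ M) (x : E) :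
    ∫ y, (∫ z, Q z * Q (x - y - z) ∂μ) * g y ∂μ =
      ∫ z, Q z * ∫ y, Q y * g (x - z - y) ∂μ ∂μ := by
  have h1 : Integrable (fun p : E × E => Q p.2 * Q (p.1 - p.2) * g (x - p.1)) (μ.prod μ) :=
    (hQ.convolution_integrand (ContinuousLinearMap.mul ℝ ℝ) hQ).mul_bdd (c := M)
      (by fun_prop : Continuous fun p : E × E => g (x - p.1)).aestronglyMeasurable
      (.of_forall fun p => hM _)
  rw [← integral_sub_left_eq_self _ μ x]
  simp_rw [← integral_mul_const, sub_sub_cancel]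
  rw [integral_integral_swap (f := fun y z => Q z * Q (y - z) * g (x - y)) h1]
  congr 1
  funext z
  rw [← integral_const_mul, ← integral_add_right_eq_self _ z]
  congr 1
  funext y
  rw [add_sub_cancel_right, sub_sub x z y, add_comm z y]
  ring

lemma integrable_conv_mul {M : ℝ} (hQ : Integrable Q μ) (hg : Continuous g)
    (hM : ∀ x, ‖g x‖ ≤ M) (x : E) :
    Integrable (fun y => (∫ z, Q z * Q (x - y - z) ∂μ) * g y) μ :=
  ((integrable_integral_mul_sub hQ hQ).comp_sub_left x).mul_bdd (c := M) hg.aestronglyMeasurable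
    (.of_forall hM)

lemma integrable_mul_conv_conv {M : ℝ} (hQ : Integrable Q μ) (hf : Integrable f μ)
    (hg : Continuous g) (hM : ∀ x, ‖g x‖ ≤ M) :
    Integrable (fun x => f x * ∫ y, (∫ z, Q z * Q (x - y - z) ∂μ) * g y ∂μ) μ := by
  simp_rw [integral_conv_mul_eq hQ hg hM]
  have hb := norm_integral_mul_sub_le (g := g) hQ hM
  have hc := continuous_integral_mul_sub hQ hg hM
  exact hf.mul_bdd (continuous_integral_mul_sub hQ hc hb).aestronglyMeasurable
    (.of_forall (norm_integral_mul_sub_le hQ hb))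

lemma integral_mul_conv_conv {M : ℝ} (hQ : Integrable Q μ) (hQe : ∀ z, Q (-z) = Q z)
    (hf : Integrable f μ) (hg : Continuous g) (hM : ∀ x, ‖g x‖ ≤ M) :
    ∫ x, f x * ∫ y, (∫ z, Q z * Q (x - y - z) ∂μ) * g y ∂μ ∂μ =
      ∫ x, (∫ z, Q z * f (x - z) ∂μ) * (∫ z, Q z * g (x - z) ∂μ) ∂μ := by
  simp_rw [integral_conv_mul_eq hQ hg hM]
  exact integral_mul_conv_eq hQ hQe hf (continuous_integral_mul_sub hQ hg hM)
    (norm_integral_mul_sub_le hQ hM)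

lemma integrable_conv_mul_conv {M : ℝ} (hQ : Integrable Q μ)
    (hf : Integrable f μ) (hg : Continuous g) (hM : ∀ x, ‖g x‖ ≤ M) :
    Integrable (fun x => (∫ z, Q z * f (x - z) ∂μ) * (∫ z, Q z * g (x - z) ∂μ)) μ :=
  (integrable_integral_mul_sub hQ hf).mul_bdd
    (continuous_integral_mul_sub hQ hg hM).aestronglyMeasurable
    (.of_forall (norm_integral_mul_sub_le hQ hM))

end Convolution
/-! ### The nonlocal gradient as a convolution -/

/-- The radial density `t ↦ ρ̄(t)/t` on `(0, ∞)`, extended by zero. -/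
def radialDensity (ρb : ℝ → ℝ) : ℝ → ℝ := (Ioi 0).indicator fun t => ρb t / t

lemma radialDensity_of_nonpos (ρb : ℝ → ℝ) {t : ℝ} (ht : t ≤ 0) : radialDensity ρb t = 0 :=
  indicator_of_notMem (not_lt.2 ht) _

lemma radialDensity_of_pos (ρb : ℝ → ℝ) {t : ℝ} (ht : 0 < t) :
    radialDensity ρb t = ρb t / t :=
  indicator_of_mem (mem_Ioi.2 ht) _

lemma Qker_eq_integral_radialDensity (ρb : ℝ → ℝ) (z : Eu n) :
    Qker n ρb z = ∫ t in Ioi ‖z‖, radialDensity ρb t :=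
  setIntegral_congr_fun measurableSet_Ioi fun _ ht =>
    (radialDensity_of_pos ρb ((norm_nonneg z).trans_lt ht)).symm

lemma Qker_neg (ρb : ℝ → ℝ) (z : Eu n) : Qker n ρb (-z) = Qker n ρb z := by
  simp only [Qker, norm_neg]

section Kernel

variable {ρ : Eu n → ℝ} {ρb : ℝ → ℝ} {ε : ℝ}

lemma IsKernelH0.exists_norm_eq (hn : 0 < n) (h0 : IsKernelH0 n ρ ρb ε) {t : ℝ} (ht : 0 < t) :
    ∃ x : Eu n, ‖x‖ = t ∧ ρ x = ρb t := by
  have hx : ‖EuclideanSpace.single (⟨0, hn⟩ : Fin n) t‖ = t := by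
    simp [abs_of_pos ht]
  refine ⟨EuclideanSpace.single ⟨0, hn⟩ t, hx, ?_⟩
  rw [h0.2.1 _ (norm_pos_iff.1 (hx.symm ▸ ht)), hx]

lemma IsKernelH0.radialDensity_nonneg (hn : 0 < n) (h0 : IsKernelH0 n ρ ρb ε) (t : ℝ) :
    0 ≤ radialDensity ρb t := by
  refine indicator_nonneg (fun t ht => ?_) t
  obtain ⟨x, -, hx⟩ := h0.exists_norm_eq hn ht
  exact div_nonneg (hx ▸ h0.1 x) (le_of_lt ht)

lemma IsKernelH0.exists_radialDensity_eq_zero (hn : 0 < n) (h0 : IsKernelH0 n ρ ρb ε)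
    (hsupp : HasCompactSupport ρ) : ∃ R : ℝ, ∀ t, R < t → radialDensity ρb t = 0 := by
  obtain ⟨R, hR⟩ := hsupp.isCompact.isBounded.subset_closedBall (0 : Eu n)
  refine ⟨R, fun t ht => ?_⟩
  rcases le_or_gt t 0 with h | h
  · exact radialDensity_of_nonpos ρb h
  · obtain ⟨x, hxt, hx⟩ := h0.exists_norm_eq hn h
    have : ρ x = 0 := by
      refine image_eq_zero_of_notMem_tsupport fun hmem => ?_
      have := mem_closedBall_zero_iff.1 (hR hmem)
      linarith
    rw [radialDensity_of_pos ρb h, ← hx, this, zero_div]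

lemma IsKernelH0.radialDensity_norm (h0 : IsKernelH0 n ρ ρb ε) {z : Eu n} (hz : z ≠ 0) :
    radialDensity ρb ‖z‖ = ρ z / ‖z‖ := by
  rw [radialDensity_of_pos ρb (norm_pos_iff.2 hz), h0.2.1 z hz]

lemma IsKernelH0.integrable_radialDensity (hn : 0 < n) (h0 : IsKernelH0 n ρ ρb ε)
    (hsupp : HasCompactSupport ρ) :
    Integrable fun z : Eu n => radialDensity ρb ‖z‖ * ‖z‖ := by
  have : Nonempty (Fin n) := ⟨⟨0, hn⟩⟩
  have hne : ∀ᵐ z : Eu n, z ≠ 0 := by simp [ae_iff]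
  have hρ : Integrable ρ :=
    (integrableOn_iff_integrable_of_support_subset (subset_tsupport ρ)).1
      (h0.2.2.1.integrableOn_isCompact hsupp.isCompact)
  refine hρ.congr ?_
  filter_upwards [hne] with z hz
  rw [h0.radialDensity_norm hz, div_mul_cancel₀ _ (norm_ne_zero_iff.2 hz)]

lemma IsKernelH0.integrable_Qker (hn : 0 < n) (h0 : IsKernelH0 n ρ ρb ε)
    (hsupp : HasCompactSupport ρ) : Integrable (Qker n ρb) := by
  have : Nonempty (Fin n) := ⟨⟨0, hn⟩⟩
  rw [funext (Qker_eq_integral_radialDensity ρb)]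
  exact integrable_potential (h0.integrable_radialDensity hn hsupp)
    fun _ => radialDensity_of_nonpos ρb

variable {v : Eu n → Eu n}

lemma contDiff_component (hv : ContDiff ℝ (⊤ : ℕ∞) v) (i : Fin n) :
    ContDiff ℝ (⊤ : ℕ∞) fun z => v z i :=
  contDiff_euclidean.1 hv i

lemma hasCompactSupport_component (hvs : HasCompactSupport v) (i : Fin n) :
    HasCompactSupport fun z => v z i :=
  hvs.comp_left (g := fun y : Eu n => y i) rfl

lemma continuous_jacobianM (hv : ContDiff ℝ (⊤ : ℕ∞) v) (i j : Fin n) :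
    Continuous fun x => jacobianM v x i j :=
  ((contDiff_component hv i).continuous_fderiv (by simp)).clm_apply continuous_const

lemma hasCompactSupport_jacobianM (hvs : HasCompactSupport v) (i j : Fin n) :
    HasCompactSupport fun x => jacobianM v x i j :=
  ((hasCompactSupport_component hvs i).fderiv (𝕜 := ℝ)).comp_left
    (g := fun L : Eu n →L[ℝ] ℝ => L (EuclideanSpace.single j 1)) rfl

/-- The nonlocal gradient is the convolution of the classical gradient with `Q_ρ`. -/
lemma IsKernelH0.nlGradM_eq_conv (hn : 0 < n) (h0 : IsKernelH0 n ρ ρb ε)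
    (hsupp : HasCompactSupport ρ) (hv : ContDiff ℝ (⊤ : ℕ∞) v) (hvs : HasCompactSupport v)
    (x : Eu n) (i j : Fin n) :
    nlGradM ρ v x i j = ∫ z, Qker n ρb z * jacobianM v (x - z) i j := by
  have : Nonempty (Fin n) := ⟨⟨0, hn⟩⟩
  have hne : ∀ᵐ z : Eu n, z ≠ 0 := by simp [ae_iff]
  obtain ⟨K, hK⟩ := (contDiff_component hv i).lipschitzWith_of_hasCompactSupport
    (hasCompactSupport_component hvs i) (by simp)
  obtain ⟨R, hR⟩ := h0.exists_radialDensity_eq_zero hn hsupp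
  have hφ : LipschitzWith K fun z => v x i - v (x - z) i := by
    refine LipschitzWith.of_dist_le_mul fun a b => ?_
    have := hK.dist_le_mul (x - a) (x - b)
    simpa only [dist_sub_left] using this
  have hline : ∀ z, lineDeriv ℝ (fun z => v x i - v (x - z) i) z (EuclideanSpace.single j 1) =
      jacobianM v (x - z) i j := by
    intro z
    have h1 : HasFDerivAt (fun z => v z i) (fderiv ℝ (fun z => v z i) (x - z)) (x - z) :=
      ((contDiff_component hv i).differentiable (by simp) _).hasFDerivAt
    have h2 := (h1.comp z ((hasFDerivAt_id z).const_sub x)).const_sub (v x i)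
    refine (h2.hasLineDerivAt (EuclideanSpace.single j 1)).lineDeriv.trans ?_
    simp [jacobianM]
  have key := integral_lineDeriv_mul_potential_of_integrable_radial
    (h0.integrable_radialDensity hn hsupp) (fun _ => radialDensity_of_nonpos ρb)
    (h0.radialDensity_nonneg hn) hR hφ (by simp) (EuclideanSpace.single j 1)
  simp_rw [hline, ← Qker_eq_integral_radialDensity] at key
  calc nlGradM ρ v x i j = ∫ z, nlGradMInt ρ v x i j (x - z) :=
        (integral_sub_left_eq_self _ volume x).symm
    _ = ∫ z, radialDensity ρb ‖z‖ * (⟪z, EuclideanSpace.single j 1⟫_ℝ / ‖z‖) *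
          (v x i - v (x - z) i) := by
        refine integral_congr_ae ?_
        filter_upwards [hne] with z hz
        rw [h0.radialDensity_norm hz]
        simp only [nlGradMInt, sub_sub_cancel, PiLp.sub_apply, EuclideanSpace.inner_single_right]
        simp
        ring
    _ = _ := by
        rw [← key]
        exact integral_congr_ae (.of_forall fun z => mul_comm _ _)

end Kernel

/-- The elastic bilinear form expanded in matrix entries. -/
lemma exists_frobInner_symPart_eq_sum
    (C : Matrix (Fin n) (Fin n) ℝ →ₗ[ℝ] Matrix (Fin n) (Fin n) ℝ) :
    ∃ c : (Fin n × Fin n) × (Fin n × Fin n) → ℝ, ∀ M N : Matrix (Fin n) (Fin n) ℝ,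
      frobInner (C (symPart M)) (symPart N) =
        ∑ s, c s * (M s.1.1 s.1.2 * N s.2.1 s.2.2) := by
  let B : Matrix (Fin n) (Fin n) ℝ →ₗ[ℝ] Matrix (Fin n) (Fin n) ℝ →ₗ[ℝ] ℝ :=
    LinearMap.mk₂ ℝ (fun M N => frobInner (C (symPart M)) (symPart N))
      (fun M M₂ N => by
        have : symPart (M + M₂) = symPart M + symPart M₂ := by
          simp only [symPart, transpose_add, ← smul_add]; congr 1; abel
        simp [this, frobInner, add_mul, Finset.sum_add_distrib])
      (fun a M N => by
        have : symPart (a • M) = a • symPart M := by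
          simp only [symPart, transpose_smul, ← smul_add]; rw [smul_comm]
        simp [this, frobInner, Finset.mul_sum, mul_assoc])
      (fun M N N₂ => by
        have : symPart (N + N₂) = symPart N + symPart N₂ := by
          simp only [symPart, transpose_add, ← smul_add]; congr 1; abel
        simp [this, frobInner, mul_add, Finset.sum_add_distrib])
      (fun a M N => by
        have : symPart (a • N) = a • symPart N := by
          simp only [symPart, transpose_smul, ← smul_add]; rw [smul_comm]
        simp [this, frobInner, Finset.mul_sum, mul_left_comm])
  refine ⟨fun s => B (Matrix.single s.1.1 s.1.2 1) (Matrix.single s.2.1 s.2.2 1), fun M N => ?_⟩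
  have hexp : ∀ M : Matrix (Fin n) (Fin n) ℝ,
      M = ∑ p : Fin n × Fin n, M p.1 p.2 • Matrix.single p.1 p.2 (1 : ℝ) := by
    intro M
    rw [Fintype.sum_prod_type]
    simpa [Matrix.smul_single] using Matrix.matrix_eq_sum_single M
  change B M N = _
  conv_lhs => rw [hexp M, hexp N]
  simp only [map_sum, LinearMap.sum_apply, map_smul, LinearMap.smul_apply, smul_eq_mul,
    Finset.mul_sum]
  rw [Finset.sum_comm, Fintype.sum_prod_type (f := fun s : (Fin n × Fin n) × (Fin n × Fin n) => _)]
  exact Finset.sum_congr rfl fun p _ => Finset.sum_congr rfl fun q _ => by ring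

variable (n)

/-- equality of the Eringen bilinear form (kernel `Q_ρ * Q_ρ`) with the
bilinear form of nonlocal linear elasticity. -/
theorem stmt1 (hn : 0 < n) (ρ : Eu n → ℝ) (ρb : ℝ → ℝ) (ε : ℝ)
    (h0 : IsKernelH0 n ρ ρb ε) (hsupp : HasCompactSupport ρ)
    (C : Matrix (Fin n) (Fin n) ℝ →ₗ[ℝ] Matrix (Fin n) (Fin n) ℝ)
    (v w : Eu n → Eu n) (hv : ContDiff ℝ (⊤ : ℕ∞) v) (hvs : HasCompactSupport v)
    (hw : ContDiff ℝ (⊤ : ℕ∞) w) (hws : HasCompactSupport w) :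
    ∫ x, ∫ y, (∫ z, Qker n ρb z * Qker n ρb (x - y - z)) *
        frobInner (C (symPart (jacobianM v x))) (symPart (jacobianM w y)) =
      ∫ x, frobInner (C (symPart (nlGradM ρ v x))) (symPart (nlGradM ρ w x)) := by
  obtain ⟨c, hc⟩ := exists_frobInner_symPart_eq_sum C
  have hQ := h0.integrable_Qker hn hsupp
  have hF : ∀ i j, Integrable fun x => jacobianM v x i j := fun i j =>
    (continuous_jacobianM hv i j).integrable_of_hasCompactSupport
      (hasCompactSupport_jacobianM hvs i j)
  have hG : ∀ i j, ∃ M, ∀ x, ‖jacobianM w x i j‖ ≤ M := fun i j =>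
    (hasCompactSupport_jacobianM hws i j).exists_bound_of_continuous (continuous_jacobianM hw i j)
  choose M hM using hG
  have hGc := fun i j => continuous_jacobianM hw i j
  have hinner : ∀ x, ∫ y, (∫ z, Qker n ρb z * Qker n ρb (x - y - z)) *
      frobInner (C (symPart (jacobianM v x))) (symPart (jacobianM w y)) =
      ∑ s, c s * (jacobianM v x s.1.1 s.1.2 *
        ∫ y, (∫ z, Qker n ρb z * Qker n ρb (x - y - z)) * jacobianM w y s.2.1 s.2.2) := by
    intro x
    simp_rw [hc, Finset.mul_sum, ← integral_const_mul]
    rw [← integral_finsetSum _ fun s _ =>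
      ((integrable_conv_mul hQ (hGc s.2.1 s.2.2) (hM _ _) x).const_mul _).const_mul _]
    congr 1
    funext y
    exact Finset.sum_congr rfl fun s _ => by ring
  simp_rw [hinner, hc, h0.nlGradM_eq_conv hn hsupp hv hvs, h0.nlGradM_eq_conv hn hsupp hw hws]
  rw [integral_finsetSum _ fun s _ =>
      (integrable_mul_conv_conv hQ (hF s.1.1 s.1.2) (hGc s.2.1 s.2.2) (hM _ _)).const_mul _,
    integral_finsetSum _ fun s _ =>
      (integrable_conv_mul_conv hQ (hF s.1.1 s.1.2) (hGc s.2.1 s.2.2) (hM _ _)).const_mul _]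
  refine Finset.sum_congr rfl fun s _ => ?_
  rw [integral_const_mul, integral_const_mul,
    integral_mul_conv_conv hQ (Qker_neg ρb) (hF _ _) (hGc _ _) (hM _ _)]
end
end

section
/- Let ρ satisfy (H0) and have compact support, and set A_ρ(x, y) := (Q_ρ * Q_ρ)(x − y). Then for every v ∈ C_c^∞(ℝ^n; ℝ^n), ∫_{ℝ^n} ∫_{ℝ^n} A_ρ(x, y) Dv(x) : Dv(y) dx dy = ∫_{ℝ^n} |D_ρ v(x)|² dx = ‖D_ρ v‖_{L²(ℝ^n; ℝ^{n×n})}², where Dv denotes the classical Jacobian matrix and |·| the Frobenius norm. (The inner product induced by the Eringen kernel Q_ρ * Q_ρ coincides with the L² norm of the nonlocal gradient.) -/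
open MeasureTheory Metric Set Matrix
open scoped ENNReal InnerProductSpace

noncomputable section

variable {n : ℕ}

attribute [local instance] Matrix.frobeniusNormedAddCommGroup

variable (n)

section Radial

variable {E : Type*} [NormedAddCommGroup E] [InnerProductSpace ℝ E] [FiniteDimensional ℝ E]
  [MeasurableSpace E] [BorelSpace E]

/-- Integration in polar coordinates. -/
lemma integral_eq_integral_Ioi_sphere (μ : Measure E) [μ.IsAddHaarMeasure] [Nontrivial E]
    {F : E → ℝ} (hF : Integrable F μ) :
    ∫ x, F x ∂μ = ∫ t in Ioi (0 : ℝ),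
      t ^ (Module.finrank ℝ E - 1) * ∫ ω, F (t • (ω : E)) ∂μ.toSphere := by
  set d := Module.finrank ℝ E - 1 with hd
  have hmp := μ.measurePreserving_homeomorphUnitSphereProd
  have hemb := (homeomorphUnitSphereProd E).measurableEmbedding
  have key : ∀ x : ({(0)}ᶜ : Set E),
      F x = (fun p : sphere (0 : E) 1 × Ioi (0 : ℝ) => F ((p.2 : ℝ) • (p.1 : E)))
        (homeomorphUnitSphereProd E x) := by
    intro x
    have hx : ‖(x : E)‖ ≠ 0 := norm_ne_zero_iff.mpr x.2
    simp [smul_smul, hx]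
  have hint : Integrable (fun p : sphere (0 : E) 1 × Ioi (0 : ℝ) => F ((p.2 : ℝ) • (p.1 : E)))
      (μ.toSphere.prod (.volumeIoiPow d)) := by
    rw [hd, ← hmp.integrable_comp_emb hemb]
    have h1 : IntegrableOn F ({0}ᶜ : Set E) μ := hF.integrableOn
    rw [integrableOn_iff_comap_subtypeVal (measurableSet_singleton _).compl] at h1
    refine h1.congr (.of_forall fun x => ?_)
    exact key x
  calc
    ∫ x, F x ∂μ = ∫ x : ({(0)}ᶜ : Set E), F x ∂(μ.comap (↑)) := by
      rw [integral_subtype_comap (measurableSet_singleton _).compl fun x ↦ F x,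
        restrict_compl_singleton]
    _ = ∫ p, F ((p.2 : ℝ) • (p.1 : E)) ∂(μ.toSphere.prod (.volumeIoiPow d)) := by
      rw [hd, ← hmp.integral_comp hemb]
      exact integral_congr_ae (.of_forall key)
    _ = ∫ t : Ioi (0 : ℝ), ∫ ω, F ((t : ℝ) • (ω : E)) ∂μ.toSphere ∂(.volumeIoiPow d) :=
      integral_prod_symm _ hint
    _ = _ := by
      simp only [Measure.volumeIoiPow, ENNReal.ofReal]
      rw [integral_withDensity_eq_integral_smul,
        integral_subtype_comap measurableSet_Ioi fun a ↦ Real.toNNReal (a ^ d) •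
          ∫ ω, F ((a : ℝ) • (ω : E)) ∂μ.toSphere,
        setIntegral_congr_fun measurableSet_Ioi fun x hx ↦ ?_]
      · simp only [NNReal.smul_def, Real.coe_toNNReal _ (pow_nonneg hx.out.le _), smul_eq_mul]
      · exact (measurable_subtype_coe.pow_const _).real_toNNReal

lemma continuous_integral_sphere_smul (μ : Measure E) [μ.IsAddHaarMeasure]
    {f : E → ℝ} (hf : Continuous f) {c : sphere (0 : E) 1 → ℝ} (hc : Continuous c) :
    Continuous fun t : ℝ => ∫ ω, f (t • (ω : E)) * c ω ∂μ.toSphere := by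
  have := continuous_parametric_integral_of_continuous (μ := μ.toSphere) (X := ℝ)
    (f := fun t (ω : sphere (0 : E) 1) => f (t • (ω : E)) * c ω)
    (by simp only [Function.uncurry_def]; fun_prop) (s := univ) isCompact_univ
  simpa using this

lemma continuousOn_integral_ball (μ : Measure E) [μ.IsAddHaarMeasure] [Nontrivial E]
    {f : E → ℝ} (hf : Continuous f) :
    ContinuousOn (fun t : ℝ => ∫ x in ball (0 : E) t, f x ∂μ) (Ioi 0) := by
  set d := Module.finrank ℝ E - 1 with hd
  have hc : Continuous fun s : ℝ => s ^ d * ∫ ω : sphere (0 : E) 1, f (s • (ω : E)) ∂μ.toSphere := by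
    have := continuous_integral_sphere_smul μ hf (c := fun _ => 1) continuous_const
    simp only [mul_one] at this
    fun_prop
  have hprim : Continuous fun t : ℝ => ∫ s in (0 : ℝ)..t,
      s ^ d * ∫ ω : sphere (0 : E) 1, f (s • (ω : E)) ∂μ.toSphere :=
    intervalIntegral.continuous_primitive (fun a b => hc.intervalIntegrable a b) 0
  refine hprim.continuousOn.congr fun t ht => ?_
  have ht' : (0 : ℝ) < t := ht
  have hint : Integrable ((ball (0 : E) t).indicator f) μ := by
    rw [integrable_indicator_iff measurableSet_ball]
    exact (hf.continuousOn.integrableOn_compact (isCompact_closedBall 0 t)).mono_set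
      ball_subset_closedBall
  dsimp only
  rw [← integral_indicator measurableSet_ball, integral_eq_integral_Ioi_sphere μ hint,
    intervalIntegral.integral_of_le ht'.le, integral_Ioc_eq_integral_Ioo,
    ← integral_indicator measurableSet_Ioo, ← integral_indicator measurableSet_Ioi]
  congr 1
  ext s
  by_cases hs : 0 < s
  · have hmem : ∀ ω : sphere (0 : E) 1, s • (ω : E) ∈ ball (0 : E) t ↔ s < t := by
      intro ω
      simp [norm_smul, abs_of_pos hs]
    by_cases hst : s < t
    · simp [indicator, hs, hst, hmem, hd]
    · simp [indicator, hs, hst, hmem]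
  · simp [indicator, hs]

lemma aestronglyMeasurable_of_integrable_norm_mul (μ : Measure E) [μ.IsAddHaarMeasure]
    [Nontrivial E] {K : ℝ → ℝ} (hK : Integrable (fun x : E => ‖x‖ * K ‖x‖) μ) :
    AEStronglyMeasurable K (volume.restrict (Ioi 0)) := by
  have h := ((integrable_fun_norm_addHaar μ (f := fun t => t * K t)).1 hK).aestronglyMeasurable
  have h2 : AEStronglyMeasurable (fun t : ℝ => (t ^ (Module.finrank ℝ E - 1))⁻¹ * t⁻¹)
    (volume.restrict (Ioi 0)) := by
    apply Measurable.aestronglyMeasurable; fun_prop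
  refine (h2.mul h).congr ?_
  filter_upwards [ae_restrict_mem measurableSet_Ioi] with t ht
  have : t ≠ 0 := (mem_Ioi.1 ht).ne'
  simp only [smul_eq_mul, Pi.mul_apply]
  field_simp

/-- The kernel `(x, t) ↦ 1_{‖x‖ < t} K(t)` is integrable as soon as `‖x‖ K(‖x‖)` is. -/
lemma integrable_prod_indicator_norm_lt (μ : Measure E) [μ.IsAddHaarMeasure] [Nontrivial E]
    {K : ℝ → ℝ} (hK : Integrable (fun x : E => ‖x‖ * K ‖x‖) μ) :
    Integrable (fun p : E × ℝ => (Ioi ‖p.1‖).indicator K p.2)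
      (μ.prod (volume.restrict (Ioi 0))) := by
  have hKm := aestronglyMeasurable_of_integrable_norm_mul μ hK
  have hset : MeasurableSet {p : E × ℝ | ‖p.1‖ < p.2} :=
    measurableSet_lt (by fun_prop) (by fun_prop)
  have heq : (fun p : E × ℝ => (Ioi ‖p.1‖).indicator K p.2) =
      {p : E × ℝ | ‖p.1‖ < p.2}.indicator (fun p => K p.2) := by
    ext p; simp [indicator]
  have hslice : ∀ t : ℝ, (fun x : E => (Ioi ‖x‖).indicator K t) =
      (ball (0 : E) t).indicator (fun _ => K t) := by
    intro t; ext x; simp [indicator]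
  have hm : AEStronglyMeasurable (fun p : E × ℝ => (Ioi ‖p.1‖).indicator K p.2)
      (μ.prod (volume.restrict (Ioi 0))) := by
    rw [heq]; exact (hKm.comp_snd).indicator hset
  rw [integrable_prod_iff' hm]
  constructor
  · refine .of_forall fun t => ?_
    rw [hslice]
    exact (integrable_indicator_iff measurableSet_ball).2 (integrableOn_const measure_ball_lt_top.ne)
  · have h := ((integrable_fun_norm_addHaar μ (f := fun t => t * K t)).1 hK).norm.const_mul
      (μ.real (ball 0 1))
    refine h.congr ?_
    filter_upwards [ae_restrict_mem measurableSet_Ioi] with t ht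
    have ht' : 0 < t := ht
    have : (fun x : E => ‖(Ioi ‖x‖).indicator K t‖) =
      (ball (0 : E) t).indicator (fun _ => ‖K t‖) := by
      ext x; by_cases hx : ‖x‖ < t <;> simp [indicator, hx]
    rw [this, integral_indicator measurableSet_ball, setIntegral_const]
    have hdim : Module.finrank ℝ E - 1 + 1 = Module.finrank ℝ E :=
      Nat.sub_add_cancel Module.finrank_pos
    simp only [Measure.real, Measure.addHaar_ball_of_pos μ _ ht', smul_eq_mul, norm_mul, norm_pow,
      Real.norm_of_nonneg ht'.le, ENNReal.toReal_mul,
      ENNReal.toReal_ofReal (pow_nonneg ht'.le _)]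
    nth_rw 2 [← hdim]
    ring

lemma setIntegral_Ioi_indicator_norm {E : Type*} [SeminormedAddGroup E] (K : ℝ → ℝ) (x : E) :
    ∫ t in Ioi (0 : ℝ), (Ioi ‖x‖).indicator K t = ∫ t in Ioi ‖x‖, K t := by
  rw [setIntegral_indicator measurableSet_Ioi, inter_eq_right.2 (Ioi_subset_Ioi (norm_nonneg x))]

lemma integrable_integral_Ioi_norm (μ : Measure E) [μ.IsAddHaarMeasure] [Nontrivial E]
    {K : ℝ → ℝ} (hK : Integrable (fun x : E => ‖x‖ * K ‖x‖) μ) :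
    Integrable (fun x : E => ∫ t in Ioi ‖x‖, K t) μ := by
  have := (integrable_prod_indicator_norm_lt μ hK).integral_prod_left
  simpa only [setIntegral_Ioi_indicator_norm] using this

lemma integral_integral_Ioi_norm_mul (μ : Measure E) [μ.IsAddHaarMeasure] [Nontrivial E]
    {K : ℝ → ℝ} (hK : Integrable (fun x : E => ‖x‖ * K ‖x‖) μ) {f : E → ℝ} (hf : Continuous f)
    {C : ℝ} (hC : ∀ x, ‖f x‖ ≤ C) :
    ∫ x, (∫ t in Ioi ‖x‖, K t) * f x ∂μ =
      ∫ t in Ioi (0 : ℝ), K t * ∫ x in ball (0 : E) t, f x ∂μ := by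
  have h := (integrable_prod_indicator_norm_lt μ hK).mul_bdd
    (g := fun p => f p.1) (c := C)
    (by exact (hf.comp continuous_fst).aestronglyMeasurable) (.of_forall fun p => hC p.1)
  calc
    _ = ∫ x, (∫ t in Ioi (0 : ℝ), (Ioi ‖x‖).indicator K t * f x) ∂μ := by
      simp only [integral_mul_const, setIntegral_Ioi_indicator_norm]
    _ = ∫ t in Ioi (0 : ℝ), ∫ x, (Ioi ‖x‖).indicator K t * f x ∂μ := integral_integral_swap h
    _ = _ := by
      congr 1; ext t
      rw [← integral_const_mul, ← integral_indicator measurableSet_ball]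
      congr 1; ext x
      simp [indicator]

lemma integrable_mul_inner_div_norm_mul (μ : Measure E) [μ.IsAddHaarMeasure]
    {K : ℝ → ℝ} (hK : Integrable (fun x : E => ‖x‖ * K ‖x‖) μ) {g : E → ℝ} (hg : Continuous g)
    {C : ℝ} (hC : ∀ x, ‖g x‖ ≤ C * ‖x‖) (e : E) :
    Integrable (fun x => g x * (⟪x, e⟫_ℝ / ‖x‖) * K ‖x‖) μ := by
  have h := hK.bdd_mul (f := fun x => g x * ⟪x, e⟫_ℝ / ‖x‖ ^ 2) (c := C * ‖e‖)
    (by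
      have : Measurable g := hg.measurable
      apply Measurable.aestronglyMeasurable; fun_prop)
    (.of_forall fun x => by
      by_cases hx : x = 0
      · subst hx
        have := (norm_nonneg _).trans (hC e)
        simp only [inner_zero_left, mul_zero, zero_div, norm_zero]
        exact this
      · have hx' : 0 < ‖x‖ := norm_pos_iff.2 hx
        rw [norm_div, norm_mul, norm_pow, norm_norm, div_le_iff₀ (by positivity)]
        calc ‖g x‖ * ‖⟪x, e⟫_ℝ‖ ≤ (C * ‖x‖) * (‖x‖ * ‖e‖) :=
              mul_le_mul (hC x) (norm_inner_le_norm x e) (norm_nonneg _)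
                ((norm_nonneg _).trans (hC x))
          _ = _ := by ring)
  refine h.congr (.of_forall fun x => ?_)
  by_cases hx : x = 0
  · simp [hx]
  · have hx' : ‖x‖ ≠ 0 := norm_ne_zero_iff.2 hx
    dsimp only
    field_simp

lemma integral_mul_inner_div_norm_mul (μ : Measure E) [μ.IsAddHaarMeasure] [Nontrivial E]
    {K : ℝ → ℝ} (hK : Integrable (fun x : E => ‖x‖ * K ‖x‖) μ) {g : E → ℝ} (hg : Continuous g)
    {C : ℝ} (hC : ∀ x, ‖g x‖ ≤ C * ‖x‖) (e : E) :
    ∫ x, g x * (⟪x, e⟫_ℝ / ‖x‖) * K ‖x‖ ∂μ = ∫ t in Ioi (0 : ℝ), K t *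
      (t ^ (Module.finrank ℝ E - 1) *
        ∫ ω : sphere (0 : E) 1, g (t • (ω : E)) * ⟪(ω : E), e⟫_ℝ ∂μ.toSphere) := by
  rw [integral_eq_integral_Ioi_sphere μ (integrable_mul_inner_div_norm_mul μ hK hg hC e)]
  refine setIntegral_congr_fun measurableSet_Ioi fun t ht => ?_
  have ht' : (0 : ℝ) < t := ht
  have : ∀ ω : sphere (0 : E) 1, g (t • (ω : E)) * (⟪t • (ω : E), e⟫_ℝ / ‖t • (ω : E)‖) *
      K ‖t • (ω : E)‖ = g (t • (ω : E)) * ⟪(ω : E), e⟫_ℝ * K t := by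
    intro ω
    have h1 : ‖t • (ω : E)‖ = t := by simp [norm_smul, abs_of_pos ht']
    rw [h1, real_inner_smul_left, mul_div_cancel_left₀ _ ht'.ne']
  simp only [this, integral_mul_const]
  ring

lemma integrable_norm_mul_of_hasCompactSupport (μ : Measure E) [μ.IsAddHaarMeasure]
    {ψ : ℝ → ℝ} (hψ : Continuous ψ) (hψc : HasCompactSupport ψ) :
    Integrable (fun x : E => ‖x‖ * ψ ‖x‖) μ := by
  obtain ⟨R, hR⟩ := hψc.isCompact.isBounded.subset_closedBall (0 : ℝ)
  refine Continuous.integrable_of_hasCompactSupport (by fun_prop) ?_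
  refine HasCompactSupport.intro (isCompact_closedBall (0 : E) R) fun x hx => ?_
  have hx' : ψ ‖x‖ = 0 := image_eq_zero_of_notMem_tsupport fun h => hx (by simpa using hR h)
  rw [hx', mul_zero]

/-- Integration by parts against a compactly supported radial function that is constant near the origin. -/
lemma integral_mul_inner_div_norm_mul_of_tsupport_subset (μ : Measure E) [μ.IsAddHaarMeasure]
    {ψ : ℝ → ℝ} (hψ : Continuous ψ) (hψc : HasCompactSupport ψ) (hψs : tsupport ψ ⊆ Ioi 0)
    {g : E → ℝ} (hg : ContDiff ℝ 1 g) {C : ℝ} (hC : ∀ x, ‖g x‖ ≤ C * ‖x‖) (e : E) :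
    ∫ x, g x * (⟪x, e⟫_ℝ / ‖x‖) * ψ ‖x‖ ∂μ =
      ∫ x, (∫ t in Ioi ‖x‖, ψ t) * fderiv ℝ g x e ∂μ := by
  have hψi : Integrable ψ := hψ.integrable_of_hasCompactSupport hψc
  set Φ : ℝ → ℝ := fun s => ∫ t in Ioi s, ψ t with hΦ
  have hΦeq : Φ = fun s => (∫ t, ψ t) - ((∫ t in Iic (0 : ℝ), ψ t) + ∫ t in (0 : ℝ)..s, ψ t) := by
    ext s
    have h1 := intervalIntegral.integral_Iic_add_Ioi (b := s) hψi.integrableOn hψi.integrableOn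
    have h2 := intervalIntegral.integral_Iic_sub_Iic (a := 0) (b := s)
      hψi.integrableOn hψi.integrableOn
    simp only [hΦ]
    linarith
  have hΦd : ∀ s, HasDerivAt Φ (-ψ s) s := by
    intro s
    rw [hΦeq]
    exact ((hψ.integral_hasStrictDerivAt 0 s).hasDerivAt.const_add _).const_sub _
  obtain ⟨R, hR⟩ := hψc.isCompact.isBounded.subset_closedBall (0 : ℝ)
  have hψR : ∀ t, R < t → ψ t = 0 := fun t ht => image_eq_zero_of_notMem_tsupport fun h => by
    have := hR h
    rw [mem_closedBall_zero_iff, Real.norm_eq_abs] at this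
    linarith [le_abs_self t]
  have hΦR : ∀ s, R < s → Φ s = 0 := fun s hs =>
    setIntegral_eq_zero_of_forall_eq_zero fun t ht => hψR t (hs.trans ht)
  have hψ0 : ψ 0 = 0 := image_eq_zero_of_notMem_tsupport fun h => lt_irrefl (0 : ℝ) (hψs h)
  have hfd : ∀ x : E, HasFDerivAt (fun x : E => Φ ‖x‖) (-(ψ ‖x‖ / ‖x‖) • innerSL ℝ x) x := by
    intro x
    by_cases hx : x = 0
    · subst hx
      have hmem : (tsupport ψ)ᶜ ∈ nhds (0 : ℝ) :=
        (isClosed_tsupport ψ).isOpen_compl.mem_nhds fun h => lt_irrefl (0 : ℝ) (hψs h)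
      obtain ⟨δ, hδ, hball⟩ := Metric.mem_nhds_iff.1 hmem
      have hconst : (fun x : E => Φ ‖x‖) =ᶠ[nhds 0] fun _ => Φ 0 := by
        filter_upwards [Metric.ball_mem_nhds (0 : E) hδ] with x hx
        rw [mem_ball_zero_iff] at hx
        simp only [hΦeq, intervalIntegral.integral_same]
        congr 2
        rw [intervalIntegral.integral_of_le (norm_nonneg x)]
        refine setIntegral_eq_zero_of_forall_eq_zero fun t ht =>
          image_eq_zero_of_notMem_tsupport (hball ?_)
        rw [mem_ball_zero_iff, Real.norm_eq_abs, abs_of_pos ht.1]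
        exact ht.2.trans_lt hx
      simpa [hψ0] using (hasFDerivAt_const (Φ 0) (0 : E)).congr_of_eventuallyEq hconst
    · have hn : HasFDerivAt (fun x : E => ‖x‖) (‖x‖⁻¹ • innerSL ℝ x) x := by
        have h1 := (hasStrictFDerivAt_norm_sq x).hasFDerivAt.sqrt
          (pow_ne_zero 2 (norm_ne_zero_iff.2 hx))
        simp only [Real.sqrt_sq (norm_nonneg _)] at h1
        convert h1 using 1
        ext y
        simp
        field_simp
      have h2 := (hΦd ‖x‖).comp_hasFDerivAt x hn
      rwa [smul_smul, neg_mul, ← div_eq_mul_inv] at h2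
  have hΦc : Continuous (fun x : E => Φ ‖x‖) :=
    continuous_iff_continuousAt.2 fun x => (hfd x).continuousAt
  have hΦs : HasCompactSupport (fun x : E => Φ ‖x‖) := by
    refine HasCompactSupport.intro (isCompact_closedBall (0 : E) R) fun x hx => hΦR _ ?_
    simpa using hx
  have hψn := integrable_norm_mul_of_hasCompactSupport μ hψ hψc
  have hgc := hg.continuous
  have hgd : Continuous fun x => fderiv ℝ g x e :=
    (hg.continuous_fderiv one_ne_zero).clm_apply continuous_const
  have hder : ∀ x, fderiv ℝ (fun x : E => Φ ‖x‖) x e * g x =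
      -(g x * (⟪x, e⟫_ℝ / ‖x‖) * ψ ‖x‖) := by
    intro x
    rw [(hfd x).fderiv]
    simp
    ring
  have hparts := integral_mul_fderiv_eq_neg_fderiv_mul_of_integrable (μ := μ) (v := e)
    (f := fun x : E => Φ ‖x‖) (g := g)
    (by
      simp only [hder]
      exact (integrable_mul_inner_div_norm_mul μ hψn hgc hC e).neg)
    ((hΦc.mul hgd).integrable_of_hasCompactSupport hΦs.mul_right)
    ((hΦc.mul hgc).integrable_of_hasCompactSupport hΦs.mul_right)
    (fun x _ => (hfd x).differentiableAt)
    (fun x _ => hg.differentiable one_ne_zero x)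
  rw [hparts]
  simp only [hder, integral_neg, neg_neg]

/-- Gauss--Green formula on balls centred at the origin, for almost every radius. -/
lemma ae_sphere_integral_eq_integral_ball_fderiv (μ : Measure E) [μ.IsAddHaarMeasure] [Nontrivial E]
    {g : E → ℝ} (hg : ContDiff ℝ 1 g) {C : ℝ} (hC : ∀ x, ‖g x‖ ≤ C * ‖x‖) (e : E)
    {C' : ℝ} (hC' : ∀ x, ‖fderiv ℝ g x e‖ ≤ C') :
    ∀ᵐ t ∂(volume : Measure ℝ), t ∈ Ioi (0 : ℝ) →
      t ^ (Module.finrank ℝ E - 1) *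
        (∫ ω : sphere (0 : E) 1, g (t • (ω : E)) * ⟪(ω : E), e⟫_ℝ ∂μ.toSphere) -
      ∫ x in ball (0 : E) t, fderiv ℝ g x e ∂μ = 0 := by
  have hgd : Continuous fun x => fderiv ℝ g x e :=
    (hg.continuous_fderiv one_ne_zero).clm_apply continuous_const
  have hG := continuous_integral_sphere_smul μ hg.continuous
    (c := fun ω : sphere (0 : E) 1 => ⟪(ω : E), e⟫_ℝ) (by fun_prop)
  have hcont : ContinuousOn (fun t : ℝ => t ^ (Module.finrank ℝ E - 1) *
        (∫ ω : sphere (0 : E) 1, g (t • (ω : E)) * ⟪(ω : E), e⟫_ℝ ∂μ.toSphere)) (Ioi 0) := by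
    fun_prop
  have hM := continuousOn_integral_ball μ hgd
  refine isOpen_Ioi.ae_eq_zero_of_integral_contDiff_smul_eq_zero
    ((hcont.sub hM).locallyIntegrableOn measurableSet_Ioi) fun ψ hψd hψc hψs => ?_
  have hψ : Continuous ψ := hψd.continuous
  have hψ0 : ∀ t, t ∉ Ioi (0 : ℝ) → ψ t = 0 := fun t ht =>
    image_eq_zero_of_notMem_tsupport fun h => ht (hψs h)
  have hψn := integrable_norm_mul_of_hasCompactSupport μ hψ hψc
  have hint : ∀ f : ℝ → ℝ, ContinuousOn f (Ioi 0) →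
      IntegrableOn (fun t => ψ t * f t) (Ioi 0) := by
    intro f hf
    have h1 : IntegrableOn (fun t => ψ t * f t) (tsupport ψ) :=
      (hψ.continuousOn.mul (hf.mono hψs)).integrableOn_compact hψc
    refine h1.of_forall_sdiff_eq_zero measurableSet_Ioi fun t ht => ?_
    rw [image_eq_zero_of_notMem_tsupport ht.2, zero_mul]
  have h := integral_mul_inner_div_norm_mul_of_tsupport_subset μ hψ hψc hψs hg hC e
  rw [integral_mul_inner_div_norm_mul μ hψn hg.continuous hC e,
    integral_integral_Ioi_norm_mul μ hψn hgd hC', ← sub_eq_zero,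
    ← integral_sub (hint _ hcont) (hint _ hM)] at h
  rw [← setIntegral_eq_integral_of_forall_compl_eq_zero (s := Ioi 0)
    fun t ht => by rw [hψ0 t ht, zero_smul]]
  simpa only [smul_eq_mul, mul_sub] using h

/-- Integration by parts against the singular radial kernel `x ↦ ∫_{‖x‖}^∞ K`. -/
lemma integral_radial_kernel_by_parts (μ : Measure E) [μ.IsAddHaarMeasure] [Nontrivial E]
    {K : ℝ → ℝ} (hK : Integrable (fun x : E => ‖x‖ * K ‖x‖) μ)
    {g : E → ℝ} (hg : ContDiff ℝ 1 g) {C : ℝ} (hC : ∀ x, ‖g x‖ ≤ C * ‖x‖) (e : E)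
    {C' : ℝ} (hC' : ∀ x, ‖fderiv ℝ g x e‖ ≤ C') :
    ∫ x, g x * (⟪x, e⟫_ℝ / ‖x‖) * K ‖x‖ ∂μ =
      ∫ x, (∫ t in Ioi ‖x‖, K t) * fderiv ℝ g x e ∂μ := by
  have hgd : Continuous fun x => fderiv ℝ g x e :=
    (hg.continuous_fderiv one_ne_zero).clm_apply continuous_const
  rw [integral_mul_inner_div_norm_mul μ hK hg.continuous hC e,
    integral_integral_Ioi_norm_mul μ hK hgd hC']
  refine setIntegral_congr_ae measurableSet_Ioi ?_
  filter_upwards [ae_sphere_integral_eq_integral_ball_fderiv μ hg hC e hC'] with t ht htm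
  rw [sub_eq_zero.1 (ht htm)]

end Radial

section Convolution

open ContinuousLinearMap Convolution in
/-- For an even integrable kernel `q`, the squared `L²` norm of `q ⋆ a` is the quadratic form
induced by `q ⋆ q`. -/
lemma integral_convolution_sq_eq {E : Type*} [NormedAddCommGroup E] [NormedSpace ℝ E]
    [FiniteDimensional ℝ E] [MeasurableSpace E] [BorelSpace E] (μ : Measure E)
    [μ.IsAddHaarMeasure] {q a : E → ℝ} (hq : Integrable q μ) (heven : ∀ x, q (-x) = q x)
    (ha : Continuous a) (hac : HasCompactSupport a) :
    Integrable (fun x => (∫ h, q h * a (x - h) ∂μ) * ∫ h, q h * a (x - h) ∂μ) μ ∧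
    (∀ x, Integrable (fun y => (∫ z, q z * q (x - y - z) ∂μ) * (a x * a y)) μ) ∧
    Integrable (fun x => ∫ y, (∫ z, q z * q (x - y - z) ∂μ) * (a x * a y) ∂μ) μ ∧
    ∫ x, ∫ y, (∫ z, q z * q (x - y - z) ∂μ) * (a x * a y) ∂μ ∂μ =
      ∫ x, (∫ h, q h * a (x - h) ∂μ) * (∫ h, q h * a (x - h) ∂μ) ∂μ := by
  obtain ⟨C, hC⟩ := hac.exists_bound_of_continuous ha
  have hai : Integrable a μ := ha.integrable_of_hasCompactSupport hac
  set f : E → ℝ := q ⋆[mul ℝ ℝ, μ] a with hf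
  set Q : E → ℝ := q ⋆[mul ℝ ℝ, μ] q
  have hfi : Integrable f μ := hq.integrable_convolution _ hai
  have hQi : Integrable Q μ := hq.integrable_convolution _ hq
  have hfb : ∀ x, ‖f x‖ ≤ (∫ h, ‖q h‖ ∂μ) * C := by
    intro x
    rw [← integral_mul_const]
    refine norm_integral_le_of_norm_le (hq.norm.mul_const C) (.of_forall fun h => ?_)
    simp only [ContinuousLinearMap.mul_apply', norm_mul]
    exact mul_le_mul_of_nonneg_left (hC _) (norm_nonneg _)
  have hfm := hfi.aestronglyMeasurable
  have hQa : ∀ x, Integrable (fun y => Q (x - y) * a y) μ := fun x =>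
    (hQi.comp_sub_left x).mul_bdd (c := C) ha.aestronglyMeasurable (.of_forall hC)
  have hinner : ∀ x, ∫ y, Q (x - y) * (a x * a y) ∂μ = (Q ⋆[mul ℝ ℝ, μ] a) x * a x := by
    intro x
    rw [convolution_eq_swap, ← integral_mul_const]
    congr 1; ext y
    simp only [ContinuousLinearMap.mul_apply']
    ring
  have hassoc : ∀ x, (Q ⋆[mul ℝ ℝ, μ] a) x = (q ⋆[mul ℝ ℝ, μ] f) x := by
    intro x
    refine convolution_assoc' _ _ _ _ (fun a b c => by simp [mul_assoc])
      (hq.ae_convolution_exists _ hq) (hq.ae_convolution_exists _ hai) ?_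
    have := (hq.convolution_integrand (mul ℝ ℝ) hq (μ := μ)).mul_bdd (c := C)
      (g := fun p => a (x - p.1))
      (by
        have : Continuous fun p : E × E => a (x - p.1) := by fun_prop
        exact this.aestronglyMeasurable) (.of_forall fun p => hC _)
    refine this.congr (.of_forall fun p => ?_)
    simp [Function.uncurry, mul_assoc]
  refine ⟨hfi.mul_bdd hfm (.of_forall hfb), fun x => ?_, ?_, ?_⟩
  · refine ((hQa x).const_mul (a x)).congr (.of_forall fun y => ?_)
    change a x * (Q (x - y) * a y) = Q (x - y) * (a x * a y)
    ring
  · change Integrable (fun x => ∫ y, Q (x - y) * (a x * a y) ∂μ) μ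
    simp only [hinner]
    exact (hQi.integrable_convolution _ hai).mul_bdd (c := C) ha.aestronglyMeasurable
      (.of_forall hC)
  · change ∫ x, ∫ y, Q (x - y) * (a x * a y) ∂μ ∂μ = ∫ x, f x * f x ∂μ
    simp only [hinner, hassoc]
    have hint : Integrable (Function.uncurry fun x y => a y * q (x - y) * f x) (μ.prod μ) :=
      (hai.convolution_integrand (mul ℝ ℝ) hq (μ := μ)).mul_bdd
        (g := fun p : E × E => f p.1) hfm.comp_fst (.of_forall fun p => hfb p.1)
    calc
      ∫ y, (q ⋆[mul ℝ ℝ, μ] f) y * a y ∂μ = ∫ y, ∫ x, a y * q (x - y) * f x ∂μ ∂μ := by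
        congr 1; ext y
        rw [convolution_eq_swap, ← integral_mul_const]
        congr 1; ext x
        rw [← heven (x - y), neg_sub, ContinuousLinearMap.mul_apply']
        ring
      _ = ∫ x, ∫ y, a y * q (x - y) * f x ∂μ ∂μ := (integral_integral_swap hint).symm
      _ = ∫ x, f x * f x ∂μ := by
        congr 1; ext x
        rw [integral_mul_const]
        congr 1
        rw [hf, convolution_eq_swap]
        congr 1; ext y
        rw [ContinuousLinearMap.mul_apply', mul_comm]

end Convolution

section NonlocalGradient

variable {n}

lemma integrable_of_isKernelH0 {ρ : Eu n → ℝ} {ρb : ℝ → ℝ} {ε : ℝ} (hn : 0 < n)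
    (h0 : IsKernelH0 n ρ ρb ε) (hsupp : HasCompactSupport ρ) :
    Integrable (fun x : Eu n => ‖x‖ * (ρb ‖x‖ / ‖x‖)) := by
  have : Nonempty (Fin n) := ⟨⟨0, hn⟩⟩
  obtain ⟨-, hrad, hloc, -⟩ := h0
  have hρ : Integrable ρ := by
    rw [← integrableOn_iff_integrable_of_support_subset (subset_tsupport ρ)]
    exact hloc.integrableOn_isCompact hsupp
  refine hρ.congr ?_
  filter_upwards [compl_mem_ae_iff.2 (measure_singleton (0 : Eu n))] with x hx
  rw [hrad x hx, mul_div_cancel₀ _ (norm_ne_zero_iff.2 hx)]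

/-- The nonlocal gradient is the convolution of `Q_ρ` with the classical Jacobian. -/
lemma nlGradM_apply_eq_integral {ρ : Eu n → ℝ} {ρb : ℝ → ℝ} {ε : ℝ} (hn : 0 < n)
    (h0 : IsKernelH0 n ρ ρb ε) (hsupp : HasCompactSupport ρ)
    {v : Eu n → Eu n} (hv : ContDiff ℝ 1 v) (hvs : HasCompactSupport v)
    (x : Eu n) (i j : Fin n) :
    nlGradM ρ v x i j = ∫ h, Qker n ρb h * jacobianM v (x - h) i j := by
  have : Nonempty (Fin n) := ⟨⟨0, hn⟩⟩
  have hK := integrable_of_isKernelH0 hn h0 hsupp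
  have hw : ContDiff ℝ 1 (fun z => v z i) := (contDiff_euclidean.1 hv) i
  have hws : HasCompactSupport (fun z => v z i) :=
    hvs.comp_left (g := fun u : Eu n => u i) rfl
  obtain ⟨C, hC⟩ := (hws.fderiv ℝ).exists_bound_of_continuous (hw.continuous_fderiv one_ne_zero)
  set g : Eu n → ℝ := fun h => v x i - v (x - h) i with hg
  have hgd : ContDiff ℝ 1 g := contDiff_const.sub (hw.comp (contDiff_const.sub contDiff_id))
  have hgf : ∀ h, fderiv ℝ g h = fderiv ℝ (fun z => v z i) (x - h) := by
    intro h
    have h1 : HasFDerivAt (fun h : Eu n => x - h) (-ContinuousLinearMap.id ℝ (Eu n)) h :=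
      (hasFDerivAt_id h).const_sub x
    have h2 := ((hw.differentiable one_ne_zero (x - h)).hasFDerivAt.comp h h1).const_sub (v x i)
    refine h2.fderiv.trans ?_
    ext y
    simp
  have hgC : ∀ h, ‖g h‖ ≤ C * ‖h‖ := by
    intro h
    have := convex_univ.norm_image_sub_le_of_norm_fderiv_le (𝕜 := ℝ) (f := g) (C := C) (x := 0)
      (y := h) (fun z _ => hgd.differentiable one_ne_zero z) (fun z _ => by rw [hgf]; exact hC _)
      (mem_univ _) (mem_univ _)
    simpa [hg] using this
  have hparts := integral_radial_kernel_by_parts (volume : Measure (Eu n))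
    (K := fun t => ρb t / t) hK hgd hgC
    (EuclideanSpace.single j 1) (C' := C * ‖(EuclideanSpace.single j 1 : Eu n)‖)
    (fun h => by
      rw [hgf]
      exact (ContinuousLinearMap.le_opNorm _ _).trans
        (mul_le_mul_of_nonneg_right (hC _) (norm_nonneg _)))
  simp only [hgf] at hparts
  refine Eq.trans ?_ hparts
  simp only [nlGradM, nlGradMInt, Matrix.of_apply]
  rw [← integral_sub_left_eq_self _ volume x]
  congr 1; ext h
  by_cases hh : h = 0
  · simp [hh]
  · have hh' : ‖h‖ ≠ 0 := norm_ne_zero_iff.2 hh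
    simp only [sub_sub_cancel, hg, h0.2.1 h hh, PiLp.sub_apply, EuclideanSpace.inner_single_right]
    simp
    field_simp

lemma frobInner_self_eq_norm_sq (A : Matrix (Fin n) (Fin n) ℝ) : frobInner A A = ‖A‖ ^ 2 := by
  rw [Matrix.frobenius_norm_def, ← Real.sqrt_eq_rpow, Real.sq_sqrt (by positivity)]
  simp [frobInner, sq]

end NonlocalGradient

/-- the inner product induced by the Eringen kernel `Q_ρ * Q_ρ` coincides with
the squared L² norm of the nonlocal gradient. -/
theorem stmt2 (hn : 0 < n) (ρ : Eu n → ℝ) (ρb : ℝ → ℝ) (ε : ℝ)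
    (h0 : IsKernelH0 n ρ ρb ε) (hsupp : HasCompactSupport ρ)
    (v : Eu n → Eu n) (hv : ContDiff ℝ (⊤ : ℕ∞) v) (hvs : HasCompactSupport v) :
    (∫ x, ∫ y, (∫ z, Qker n ρb z * Qker n ρb (x - y - z)) *
        frobInner (jacobianM v x) (jacobianM v y)) =
      ∫ x, frobInner (nlGradM ρ v x) (nlGradM ρ v x) ∧
    (∫ x, frobInner (nlGradM ρ v x) (nlGradM ρ v x)) =
      ((eLpNorm (fun x => nlGradM ρ v x) 2 volume).toReal) ^ 2 := by
  have : Nonempty (Fin n) := ⟨⟨0, hn⟩⟩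
  have hv1 : ContDiff ℝ 1 v := hv.of_le (by exact_mod_cast le_top)
  have hq : Integrable (Qker n ρb) :=
    integrable_integral_Ioi_norm volume (integrable_of_isKernelH0 hn h0 hsupp)
  have heven : ∀ x, Qker n ρb (-x) = Qker n ρb x := fun x => by simp [Qker]
  have hD : ∀ x i j, nlGradM ρ v x i j = ∫ h, Qker n ρb h * jacobianM v (x - h) i j :=
    nlGradM_apply_eq_integral hn h0 hsupp hv1 hvs
  have key := fun i j : Fin n => integral_convolution_sq_eq volume
    (a := fun x => jacobianM v x i j) hq heven
    ((((contDiff_euclidean.1 hv1) i).continuous_fderiv one_ne_zero).clm_apply continuous_const)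
    ((hvs.comp_left (g := fun u : Eu n => u i) rfl).fderiv_apply ℝ _)
  have hfrob : ∀ x, frobInner (nlGradM ρ v x) (nlGradM ρ v x) = ∑ i, ∑ j,
      (∫ h, Qker n ρb h * jacobianM v (x - h) i j) *
        ∫ h, Qker n ρb h * jacobianM v (x - h) i j := fun x => by simp only [frobInner, hD]
  have hint : Integrable fun x => frobInner (nlGradM ρ v x) (nlGradM ρ v x) := by
    simp only [hfrob]
    exact integrable_finsetSum _ fun i _ => integrable_finsetSum _ fun j _ => (key i j).1
  constructor
  · simp only [hfrob]
    rw [integral_finsetSum _ fun i _ => integrable_finsetSum _ fun j _ => (key i j).1]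
    simp only [integral_finsetSum _ fun j _ => (key _ j).1, ← (key _ _).2.2.2]
    simp only [frobInner, Finset.mul_sum]
    have hy : ∀ x, ∫ y, ∑ i, ∑ j, (∫ z, Qker n ρb z * Qker n ρb (x - y - z)) *
          (jacobianM v x i j * jacobianM v y i j) =
        ∑ i, ∑ j, ∫ y, (∫ z, Qker n ρb z * Qker n ρb (x - y - z)) *
          (jacobianM v x i j * jacobianM v y i j) := by
      intro x
      rw [integral_finsetSum _ fun i _ =>
        integrable_finsetSum _ fun j _ => (key i j).2.1 x]
      exact Finset.sum_congr rfl fun i _ =>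
        integral_finsetSum _ fun j _ => (key i j).2.1 x
    simp only [hy]
    rw [integral_finsetSum _ fun i _ =>
      integrable_finsetSum _ fun j _ => (key i j).2.2.1]
    exact Finset.sum_congr rfl fun i _ =>
      integral_finsetSum _ fun j _ => (key i j).2.2.1
  · rw [integral_eq_lintegral_of_nonneg_ae
      (.of_forall fun x => by rw [frobInner_self_eq_norm_sq]; positivity) hint.aestronglyMeasurable,
      ← ENNReal.toReal_pow, eLpNorm_eq_lintegral_rpow_enorm_toReal two_ne_zero ENNReal.ofNat_ne_top,
      ← ENNReal.rpow_natCast, ← ENNReal.rpow_mul]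
    simp only [frobInner_self_eq_norm_sq, ENNReal.ofReal_pow (norm_nonneg _), ofReal_norm]
    norm_num
end
end
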